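/- arXiv:1208.1203 — 3 statements merged into one kernel-verified Lean document; each statement's English description precedes it below -/
import Mathlib

section
/- Let n ≥ 2 and let f be a nonconstant continuous function on [0,∞) such that x ↦ f(|x|) is positive definite on ℝ^{n+1} (i.e. f ∈ Φ_{n+1}). Let X = {x_k}_{k≥1} be a sequence of points x_k = (x_{k1}, …, x_{kn}) ∈ ℝ^n, and let X_n := {x_{kn}}_{k≥1} be the sequence of n-th coordinates. If d_*(X_n) > 0 and D*(X_n) = 0, then x ↦ f(|x|) is strongly X-positive definite on ℝ^n. -/
open MeasureTheory Filter
open scoped ComplexOrder ENNReal RealInnerProductSpace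

noncomputable section

/-- The Hilbert space `ℓ²(ℕ)` of square-summable complex sequences. -/
abbrev ell2 : Type := lp (fun _ : ℕ => ℂ) 2

/-- The standard basis vector `e k` of `ℓ²(ℕ)`. -/
def stdBasis (k : ℕ) : ell2 := lp.single 2 k (1 : ℂ)

/-- A sequence in a normed space is a *Riesz–Fischer sequence* if there is `c > 0` with
`‖∑_{k<m} ξ_k f_k‖² ≥ c ∑_{k<m} |ξ_k|²` for all `m` and all coefficients `ξ`. -/
def IsRieszFischerSeq {F : Type*} [NormedAddCommGroup F] [NormedSpace ℂ F] (f : ℕ → F) : Prop :=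
  ∃ c : ℝ, 0 < c ∧ ∀ (m : ℕ) (ξ : Fin m → ℂ),
    c * ∑ k, ‖ξ k‖ ^ 2 ≤ ‖∑ k, ξ k • f (k : ℕ)‖ ^ 2

/-- A sequence in a normed space is a *Bessel sequence* if there is `C > 0` with
`‖∑_{k<m} ξ_k f_k‖² ≤ C ∑_{k<m} |ξ_k|²` for all `m` and all coefficients `ξ`. -/
def IsBesselSeq {F : Type*} [NormedAddCommGroup F] [NormedSpace ℂ F] (f : ℕ → F) : Prop :=
  ∃ C : ℝ, 0 < C ∧ ∀ (m : ℕ) (ξ : Fin m → ℂ),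
    ‖∑ k, ξ k • f (k : ℕ)‖ ^ 2 ≤ C * ∑ k, ‖ξ k‖ ^ 2

/-- `g` is *strongly `X`-positive definite*: there is `c > 0` such that for every finite
choice of distinct points from (the range of) `X` and all complex coefficients `ξ`,
`∑_{j,k} ξ_k conj(ξ_j) g(y_k − y_j) ≥ c ∑_k |ξ_k|²` (inequality in the complex order). -/
def IsStronglyPosDef {E : Type*} [NormedAddCommGroup E] (X : ℕ → E) (g : E → ℂ) : Prop :=
  ∃ c : ℝ, 0 < c ∧ ∀ (m : ℕ) (y : Fin m → E),
    (∀ i, y i ∈ Set.range X) → Function.Injective y → ∀ ξ : Fin m → ℂ,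
      ((c * ∑ k, ‖ξ k‖ ^ 2 : ℝ) : ℂ) ≤ ∑ j, ∑ k, ξ k * (starRingEnd ℂ) (ξ j) * g (y k - y j)

/-- `g` is a *positive definite function*: it is continuous at `0` and all quadratic forms
`∑_{j,k} ξ_k conj(ξ_j) g(x_k − x_j)` are nonnegative (in the complex order). -/
def IsPosDefFn {E : Type*} [NormedAddCommGroup E] (g : E → ℂ) : Prop :=
  ContinuousAt g 0 ∧ ∀ (m : ℕ) (x : Fin m → E) (ξ : Fin m → ℂ),
    (0 : ℂ)≤ ∑ j, ∑ k, ξ k * (starRingEnd ℂ) (ξ j) * g (x k - x j)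

/-- `d_*(X) > 0`: the points of the sequence `X` are uniformly separated. -/
def SeparatedSeq {E : Type*} [MetricSpace E] (X : ℕ → E) : Prop :=
  ∃ d : ℝ, 0 < d ∧ ∀ k j, k ≠ j → d ≤ dist (X k) (X j)

/-- The upper density `D*(Λ)` of a real sequence: the (limsup form of the) limit of
`n(r)/r`, where `n(r)` is the largest number of terms of `Λ` lying in an interval
of length `r`. -/
def upperDensity (Λ : ℕ → ℝ) : ℝ≥0∞ :=
  Filter.limsup (fun r : ℝ =>
    (⨆ a : ℝ, ∑' _ : {k : ℕ // Λ k ∈ Set.Icc a (a + r)}, (1 : ℝ≥0∞)) / ENNReal.ofReal r)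
    Filter.atTop

/-! ### Combinatorics of separated points -/

lemma SPD_factorial_le_prod (T : Finset ℕ) (hT : ∀ t ∈ T, 1 ≤ t) :
    (T.card.factorial : ℕ) ≤ ∏ t ∈ T, t := by
  induction T using Finset.induction_on_max with
  | empty => simp
  | insert a s hmax ih =>
    have ha : a ∉ s := fun h => lt_irrefl _ (hmax a h)
    rw [Finset.card_insert_of_notMem ha, Finset.prod_insert ha, Nat.factorial_succ]
    apply Nat.mul_le_mul
    · have hsub : s ⊆ Finset.Ico 1 a := by
        intro t ht
        exact Finset.mem_Ico.2 ⟨hT t (Finset.mem_insert_of_mem ht), hmax t ht⟩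
      have := Finset.card_le_card hsub
      have h1 := hT a (Finset.mem_insert_self _ _)
      simp at this
      omega
    · exact ih fun t ht => hT t (Finset.mem_insert_of_mem ht)

lemma SPD_floor {ι : Type*} (S : Finset ι) (g : ι → ℝ) (d : ℝ) (hd : 0 < d)
    (h1 : ∀ l ∈ S, d ≤ g l) (h2 : ∀ l ∈ S, ∀ l' ∈ S, l ≠ l' → d ≤ |g l - g l'|) :
    (∀ l ∈ S, 1 ≤ ⌊g l / d⌋₊ ∧ d * ⌊g l / d⌋₊ ≤ g l) ∧
      Set.InjOn (fun l => ⌊g l / d⌋₊) (S : Set ι) := by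
  constructor
  · intro l hl
    have h := h1 l hl
    have h0 : 1 ≤ g l / d := by rw [le_div_iff₀ hd]; linarith
    refine ⟨(Nat.one_le_floor_iff _).2 h0, ?_⟩
    have := Nat.floor_le (show 0 ≤ g l / d by linarith)
    rw [le_div_iff₀ hd] at this
    linarith
  · intro l hl l' hl' heq
    by_contra hne
    have h := h2 l hl l' hl' hne
    simp only at heq
    have a1 : 0 ≤ g l / d := div_nonneg (by linarith [h1 l hl]) hd.le
    have a2 : 0 ≤ g l' / d := div_nonneg (by linarith [h1 l' hl']) hd.le
    have b1 := Nat.floor_le a1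
    have b2 := Nat.floor_le a2
    have c1 := Nat.lt_floor_add_one (g l / d)
    have c2 := Nat.lt_floor_add_one (g l' / d)
    rw [heq] at b1 c1
    have : |g l / d - g l' / d| < 1 := by
      rw [abs_lt]; constructor <;> linarith
    rw [← sub_div, abs_div, abs_of_pos hd, div_lt_one hd] at this
    linarith

def SPD_Z : ℝ := ∑' n : ℕ, 1 / (n : ℝ) ^ 2

lemma SPD_Z_nonneg : 0 ≤ SPD_Z := tsum_nonneg fun _ => by positivity

lemma SPD_sum_side {ι : Type*} (S : Finset ι) (g : ι → ℝ) (d : ℝ) (hd : 0 < d)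
    (h1 : ∀ l ∈ S, d ≤ g l) (h2 : ∀ l ∈ S, ∀ l' ∈ S, l ≠ l' → d ≤ |g l - g l'|) :
    ∑ l ∈ S, 1 / (g l) ^ 2 ≤ SPD_Z / d ^ 2 := by
  obtain ⟨hf, hinj⟩ := SPD_floor S g d hd h1 h2
  classical
  have hs : Summable fun n : ℕ => 1 / (n : ℝ) ^ 2 :=
    Real.summable_one_div_nat_pow.2 (by norm_num)
  calc ∑ l ∈ S, 1 / (g l) ^ 2 ≤ ∑ l ∈ S, (1 / ((⌊g l / d⌋₊ : ℕ) : ℝ) ^ 2) / d ^ 2 := by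
        apply Finset.sum_le_sum
        intro l hl
        obtain ⟨p, q⟩ := hf l hl
        have p' : (1 : ℝ) ≤ (⌊g l / d⌋₊ : ℕ) := by exact_mod_cast p
        rw [div_div]
        apply one_div_le_one_div_of_le (by positivity)
        rw [← mul_pow]
        apply pow_le_pow_left₀ (by positivity)
        linarith
    _ = (∑ l ∈ S, (1 / ((⌊g l / d⌋₊ : ℕ) : ℝ) ^ 2)) / d ^ 2 := by rw [Finset.sum_div]
    _ ≤ SPD_Z / d ^ 2 := by
        gcongr
        rw [← Finset.sum_image (f := fun n : ℕ => 1 / (n : ℝ) ^ 2) hinj]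
        exact hs.sum_le_tsum _ fun _ _ => by positivity

lemma SPD_prod_side {ι : Type*} (S : Finset ι) (g : ι → ℝ) (d : ℝ) (hd : 0 < d)
    (h1 : ∀ l ∈ S, d ≤ g l) (h2 : ∀ l ∈ S, ∀ l' ∈ S, l ≠ l' → d ≤ |g l - g l'|) :
    d ^ S.card * S.card.factorial ≤ ∏ l ∈ S, g l := by
  obtain ⟨hf, hinj⟩ := SPD_floor S g d hd h1 h2
  classical
  have h := SPD_factorial_le_prod (S.image fun l => ⌊g l / d⌋₊) (by
    intro t ht
    obtain ⟨l, hl, rfl⟩ := Finset.mem_image.1 ht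
    exact (hf l hl).1)
  rw [Finset.card_image_of_injOn hinj, Finset.prod_image hinj] at h
  have h' : (S.card.factorial : ℝ) ≤ ∏ l ∈ S, ((⌊g l / d⌋₊ : ℕ) : ℝ) := by exact_mod_cast h
  calc d ^ S.card * (S.card.factorial : ℝ) ≤ d ^ S.card * ∏ l ∈ S, ((⌊g l / d⌋₊ : ℕ) : ℝ) := by
        gcongr
    _ = ∏ l ∈ S, (d * ((⌊g l / d⌋₊ : ℕ) : ℝ)) := by
        rw [Finset.prod_mul_distrib, Finset.prod_const]
    _ ≤ _ := Finset.prod_le_prod (fun _ _ => by positivity) fun l hl => (hf l hl).2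

/-- one-sided product bound -/
lemma SPD_prod_side_exp {ι : Type*} (S : Finset ι) (g : ι → ℝ) (d τ R : ℝ) (hd : 0 < d)
    (hτ : 0 < τ) (hR : 0 < R) (ε : ℝ)
    (hK : 1 ≤ 1 / (d * τ)) (hε : ε * Real.log (1 / (d * τ)) ≤ τ) (hS : (S.card : ℝ) ≤ ε * R)
    (h1 : ∀ l ∈ S, d ≤ g l) (h2 : ∀ l ∈ S, ∀ l' ∈ S, l ≠ l' → d ≤ |g l - g l'|) :
    ∏ l ∈ S, (R / g l) ≤ Real.exp (2 * τ * R) := by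
  have h := SPD_prod_side S g d hd h1 h2
  have hpos : 0 < d ^ S.card * (S.card.factorial : ℝ) := by positivity
  rw [Finset.prod_div_distrib, Finset.prod_const]
  calc R ^ S.card / ∏ l ∈ S, g l ≤ R ^ S.card / (d ^ S.card * (S.card.factorial : ℝ)) := by
        gcongr
    _ = (1 / (d * τ)) ^ S.card * ((τ * R) ^ S.card / S.card.factorial) := by
        rw [div_pow, mul_pow, mul_pow, one_pow]; field_simp
    _ ≤ Real.exp (τ * R) * Real.exp (τ * R) := by
        apply mul_le_mul
        · rw [← Real.exp_log (show 0 < 1 / (d * τ) by positivity), ← Real.exp_nat_mul]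
          apply Real.exp_le_exp.2
          have hl : 0 ≤ Real.log (1 / (d * τ)) := Real.log_nonneg hK
          calc (S.card : ℝ) * Real.log (1 / (d * τ)) ≤ ε * R * Real.log (1 / (d * τ)) := by gcongr
            _ = R * (ε * Real.log (1 / (d * τ))) := by ring
            _ ≤ R * τ := by gcongr
            _ = τ * R := by ring
        · exact Real.pow_div_factorial_le_exp _ (by positivity) _
        · positivity
        · positivity
    _ = _ := by rw [← Real.exp_add]; ring_nf

section
variable {ι : Type*} [Fintype ι]

lemma SPD_sum_sep [DecidableEq ι] (lam : ι → ℝ) (d : ℝ) (hd : 0 < d)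
    (hsep : ∀ k j, k ≠ j → d ≤ |lam k - lam j|) (k : ι) :
    ∑ j ∈ Finset.univ.erase k, 1 / (lam j - lam k) ^ 2 ≤ 2 * SPD_Z / d ^ 2 := by
  rw [← Finset.sum_filter_add_sum_filter_not _ (fun j => lam k < lam j)]
  have e1 := SPD_sum_side ((Finset.univ.erase k).filter (fun j => lam k < lam j))
    (fun j => lam j - lam k) d hd (by
      intro l hl
      simp only [Finset.mem_filter, Finset.mem_erase, Finset.mem_univ, and_true] at hl
      have := hsep l k hl.1
      rwa [abs_of_pos (by linarith [hl.2])] at this) (by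
      intro l hl l' hl' hne
      have := hsep l l' hne
      simpa using this)
  have e2 := SPD_sum_side ((Finset.univ.erase k).filter (fun j => ¬ lam k < lam j))
    (fun j => lam k - lam j) d hd (by
      intro l hl
      simp only [Finset.mem_filter, Finset.mem_erase, Finset.mem_univ, and_true] at hl
      have := hsep k l (Ne.symm hl.1)
      rwa [abs_of_nonneg (by linarith [hl.2])] at this) (by
      intro l hl l' hl' hne
      have := hsep l' l hne.symm
      simpa using this)
  have e3 : ∑ j ∈ (Finset.univ.erase k).filter (fun j => ¬ lam k < lam j), 1 / (lam k - lam j) ^ 2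
    = ∑ j ∈ (Finset.univ.erase k).filter (fun j => ¬ lam k < lam j), 1 / (lam j - lam k) ^ 2 := by
    apply Finset.sum_congr rfl
    intro j _
    rw [show (lam k - lam j) ^ 2 = (lam j - lam k) ^ 2 by ring]
  rw [e3] at e2
  calc _ ≤ SPD_Z / d ^ 2 + SPD_Z / d ^ 2 := add_le_add e1 e2
    _ = _ := by ring

lemma SPD_prod_sep {ι : Type*} (lam : ι → ℝ) (d : ℝ) (hd : 0 < d)
    (hsep : ∀ k j, k ≠ j → d ≤ |lam k - lam j|) (k : ι) (τ R ε : ℝ) (hτ : 0 < τ) (hR : 0 < R)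
    (hK : 1 ≤ 1 / (d * τ)) (hε : ε * Real.log (1 / (d * τ)) ≤ τ) (S : Finset ι) (hk : k ∉ S)
    (hS : (S.card : ℝ) ≤ ε * R) :
    ∏ l ∈ S, (R / |lam k - lam l|) ≤ Real.exp (4 * τ * R) := by
  rw [← Finset.prod_filter_mul_prod_filter_not S (fun j => lam k < lam j)]
  have hne : ∀ l ∈ S, l ≠ k := fun l hl h => hk (h ▸ hl)
  have e1 := SPD_prod_side_exp (S.filter (fun j => lam k < lam j))
    (fun j => |lam k - lam j|) d τ R hd hτ hR ε hK hε
    (le_trans (by exact_mod_cast Finset.card_filter_le _ _) hS)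
    (fun l hl => hsep k l (hne l (Finset.mem_filter.1 hl).1).symm) (by
      intro l hl l' hl' hne
      have := hsep l' l hne.symm
      have g1 := (Finset.mem_filter.1 hl).2
      have g2 := (Finset.mem_filter.1 hl').2
      have g3 : |lam k - lam l| = lam l - lam k := by rw [abs_of_neg (by linarith)]; ring
      have g4 : |lam k - lam l'| = lam l' - lam k := by rw [abs_of_neg (by linarith)]; ring
      rw [abs_sub_comm] at this
      rw [g3, g4]
      convert this using 2; ring)
  have e2 := SPD_prod_side_exp (S.filter (fun j => ¬ lam k < lam j))
    (fun j => |lam k - lam j|) d τ R hd hτ hR ε hK hε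
    (le_trans (by exact_mod_cast Finset.card_filter_le _ _) hS)
    (fun l hl => hsep k l (hne l (Finset.mem_filter.1 hl).1).symm) (by
      intro l hl l' hl' hne
      have := hsep l' l hne.symm
      have g1 := (Finset.mem_filter.1 hl).2
      have g2 := (Finset.mem_filter.1 hl').2
      have g3 : |lam k - lam l| = lam k - lam l := abs_of_nonneg (by linarith)
      have g4 : |lam k - lam l'| = lam k - lam l' := abs_of_nonneg (by linarith)
      rw [g3, g4]
      convert this using 2; ring)
  calc _ ≤ Real.exp (2 * τ * R) * Real.exp (2 * τ * R) :=
        mul_le_mul e1 e2 (Finset.prod_nonneg fun _ _ => by positivity) (by positivity)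
    _ = _ := by rw [← Real.exp_add]; ring_nf

/-- Schur test, bilinear. -/
lemma SPD_schur_bil (e : ι → ι → ℝ) (he : ∀ k j, 0 ≤ e k j) (S : ℝ)
    (hr : ∀ k, ∑ j, e k j ≤ S) (hc : ∀ j, ∑ k, e k j ≤ S) (t : ι → ℝ) :
    ∑ k, ∑ j, e k j * (t k * t j) ≤ S * ∑ k, t k ^ 2 := by
  calc ∑ k, ∑ j, e k j * (t k * t j) ≤ ∑ k, ∑ j, (e k j * t k ^ 2 / 2 + e k j * t j ^ 2 / 2) := by
        gcongr with k _ j _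
        nlinarith [he k j, mul_nonneg (he k j) (sq_nonneg (t k - t j))]
    _ = (∑ k, (∑ j, e k j) * t k ^ 2) / 2 + (∑ j, (∑ k, e k j) * t j ^ 2) / 2 := by
        simp only [Finset.sum_add_distrib, Finset.sum_mul, Finset.sum_div]
        rw [Finset.sum_comm (f := fun j k => e k j * t j ^ 2 / 2)]
    _ ≤ (∑ k, S * t k ^ 2) / 2 + (∑ j, S * t j ^ 2) / 2 := by
        gcongr with k _ j _
        · exact hr k
        · exact hc j
    _ = _ := by rw [Finset.mul_sum]; ring

/-- Schur test, operator norm. -/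
lemma SPD_schur_op (e : ι → ι → ℝ) (he : ∀ k j, 0 ≤ e k j) (S : ℝ) (hS : 0 ≤ S)
    (hr : ∀ k, ∑ j, e k j ≤ S) (hc : ∀ j, ∑ k, e k j ≤ S) (t : ι → ℝ) :
    ∑ k, (∑ j, e k j * t j) ^ 2 ≤ S ^ 2 * ∑ k, t k ^ 2 := by
  have h1 : ∀ k, (∑ j, e k j * t j) ^ 2 ≤ S * ∑ j, e k j * t j ^ 2 := by
    intro k
    have := Finset.sum_mul_sq_le_sq_mul_sq Finset.univ (fun j => √(e k j))
      (fun j => √(e k j) * t j)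
    simp only [mul_pow, Real.sq_sqrt (he _ _), ← mul_assoc, Real.mul_self_sqrt (he _ _)] at this
    refine this.trans ?_
    apply mul_le_mul_of_nonneg_right (hr k)
    exact Finset.sum_nonneg fun j _ => mul_nonneg (he k j) (sq_nonneg _)
  calc ∑ k, (∑ j, e k j * t j) ^ 2 ≤ ∑ k, S * ∑ j, e k j * t j ^ 2 := Finset.sum_le_sum fun k _ => h1 k
    _ = S * ∑ j, (∑ k, e k j) * t j ^ 2 := by
        rw [← Finset.mul_sum, Finset.sum_comm]; simp only [Finset.sum_mul]
    _ ≤ S * ∑ j, S * t j ^ 2 := by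
        gcongr with j _
        exact hc j
    _ = _ := by rw [← Finset.mul_sum]; ring
end

/-! ### Fourier transform of powers of the cosine -/

def SPD_I (m : ℕ) (x : ℝ) : ℂ :=
  ∫ u in (-(Real.pi / 2))..(Real.pi / 2), (Real.cos u : ℂ) ^ m * Complex.exp (x * u * Complex.I)

lemma SPD_I_cont (m : ℕ) (x : ℝ) :
    Continuous fun u : ℝ => (Real.cos u : ℂ) ^ m * Complex.exp (x * u * Complex.I) := by
  fun_prop

lemma SPD_I_rec (k : ℕ) (x : ℝ) :
    (((k + 2 : ℕ) : ℂ) ^ 2 - x ^ 2) * SPD_I (k + 2) x = (k + 2 : ℕ) * (k + 1 : ℕ) * SPD_I k x := by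
  set H : ℝ → ℂ := fun u => (((k + 2 : ℕ) : ℂ) * ((Real.cos u : ℂ) ^ (k + 1) * (Real.sin u : ℂ)) +
    Complex.I * x * (Real.cos u : ℂ) ^ (k + 2)) * Complex.exp (x * u * Complex.I)
  have hd : ∀ u : ℝ, HasDerivAt H (((((k + 2 : ℕ) : ℂ) ^ 2 - x ^ 2)) *
      ((Real.cos u : ℂ) ^ (k + 2) * Complex.exp (x * u * Complex.I)) -
      (k + 2 : ℕ) * (k + 1 : ℕ) * ((Real.cos u : ℂ) ^ k * Complex.exp (x * u * Complex.I))) u := by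
    intro u
    have hc : HasDerivAt (fun u : ℝ => (Real.cos u : ℂ)) (-(Real.sin u : ℂ)) u := by
      have := (Real.hasDerivAt_cos u).ofReal_comp
      simpa using this
    have hs : HasDerivAt (fun u : ℝ => (Real.sin u : ℂ)) (Real.cos u : ℂ) u :=
      (Real.hasDerivAt_sin u).ofReal_comp
    have he : HasDerivAt (fun u : ℝ => Complex.exp (x * u * Complex.I))
        (Complex.exp (x * u * Complex.I) * (x * Complex.I)) u := by
      have : HasDerivAt (fun u : ℝ => ((x : ℂ) * u * Complex.I)) (x * Complex.I) u := by
        have := ((hasDerivAt_id u).ofReal_comp.const_mul (x : ℂ)).mul_const Complex.I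
        simpa using this
      exact this.cexp
    have := ((((hc.fun_pow (k + 1)).fun_mul hs).const_mul ((k + 2 : ℕ) : ℂ)).fun_add
      ((hc.fun_pow (k + 2)).const_mul (Complex.I * x))).fun_mul he
    refine this.congr_deriv ?_
    have hsc : (Real.sin u : ℂ) ^ 2 = 1 - (Real.cos u : ℂ) ^ 2 := by
      have := Real.sin_sq u
      exact_mod_cast congrArg (Complex.ofReal) this
    have hI : Complex.I ^ 2 = -1 := Complex.I_sq
    generalize (Real.cos u : ℂ) = C at *
    generalize (Real.sin u : ℂ) = s at *
    generalize Complex.exp (x * u * Complex.I) = E at *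
    simp only [Nat.add_sub_cancel, show k + 2 - 1 = k + 1 from rfl]
    push_cast
    linear_combination (-(k+2 : ℂ) * (k+1) * C ^ k * E) * hsc + (x ^ 2 * C ^ (k+2) * E) * hI
  have hintg := intervalIntegral.integral_eq_sub_of_hasDerivAt (a := -(Real.pi / 2))
    (b := Real.pi / 2) (fun u _ => hd u) (by
      apply Continuous.intervalIntegrable
      fun_prop)
  have hz : H (Real.pi / 2) - H (-(Real.pi / 2)) = 0 := by
    simp [H]
  rw [hz, intervalIntegral.integral_sub, intervalIntegral.integral_const_mul,
    intervalIntegral.integral_const_mul] at hintg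
  · exact sub_eq_zero.1 hintg
  · apply Continuous.intervalIntegrable; fun_prop
  · apply Continuous.intervalIntegrable; fun_prop

lemma SPD_I_le (m : ℕ) (x : ℝ) : ‖SPD_I m x‖ ≤ Real.pi := by
  have := intervalIntegral.norm_integral_le_of_norm_le_const (a := -(Real.pi / 2))
    (b := Real.pi / 2) (C := 1)
    (f := fun u : ℝ => (Real.cos u : ℂ) ^ m * Complex.exp (x * u * Complex.I)) (by
      intro u _
      rw [norm_mul, show (x * u * Complex.I : ℂ) = ((x * u : ℝ) : ℂ) * Complex.I by push_cast; ring,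
        Complex.norm_exp_ofReal_mul_I, norm_pow, Complex.norm_real, mul_one]
      exact pow_le_one₀ (norm_nonneg _) (Real.abs_cos_le_one u))
  refine this.trans (le_of_eq ?_)
  rw [one_mul, abs_of_pos] <;> linarith [Real.pi_pos]

lemma SPD_I_rec_norm (k : ℕ) (x : ℝ) :
    |((k + 2 : ℕ) : ℝ) ^ 2 - x ^ 2| * ‖SPD_I (k + 2) x‖ = (k + 2 : ℕ) * (k + 1 : ℕ) * ‖SPD_I k x‖ := by
  have h := congrArg norm (SPD_I_rec k x)
  rw [norm_mul, norm_mul, norm_mul] at h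
  simp only [Complex.norm_natCast] at h
  rw [← h]
  congr 1
  rw [show (((k + 2 : ℕ) : ℂ) ^ 2 - x ^ 2) = (((((k + 2 : ℕ) : ℝ) ^ 2 - x ^ 2 : ℝ)) : ℂ) by
    push_cast; ring, Complex.norm_real, Real.norm_eq_abs]

lemma SPD_I_sq (k : ℕ) (x : ℝ) :
    x ^ 2 * ‖SPD_I (k + 2) x‖ ≤ 2 * Real.pi * ((k + 2 : ℕ) : ℝ) ^ 2 := by
  have h := SPD_I_rec_norm k x
  have h1 := SPD_I_le (k + 2) x
  have h2 := SPD_I_le k x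
  have h3 : x ^ 2 - ((k + 2 : ℕ) : ℝ) ^ 2 ≤ |((k + 2 : ℕ) : ℝ) ^ 2 - x ^ 2| := by
    rw [abs_sub_comm]; exact le_abs_self _
  have h4 := mul_le_mul_of_nonneg_right h3 (norm_nonneg (SPD_I (k + 2) x))
  have h5 : ((k + 2 : ℕ) : ℝ) * (k + 1 : ℕ) * ‖SPD_I k x‖ ≤ ((k + 2 : ℕ) : ℝ) ^ 2 * Real.pi := by
    have : ((k + 1 : ℕ) : ℝ) ≤ (k + 2 : ℕ) := by push_cast; linarith
    rw [sq]
    gcongr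
  have h6 : ((k + 2 : ℕ) : ℝ) ^ 2 * ‖SPD_I (k + 2) x‖ ≤ ((k + 2 : ℕ) : ℝ) ^ 2 * Real.pi := by gcongr
  linarith

lemma SPD_I_zero (q : ℕ) : Real.pi * (1 / 2) ^ q ≤ ‖SPD_I (2 * q) 0‖ := by
  induction q with
  | zero =>
    simp [SPD_I]
    rw [abs_of_pos Real.pi_pos]
  | succ q ih =>
    have h := SPD_I_rec_norm (2 * q) 0
    have hp : (0 : ℝ) < ((2 * q + 2 : ℕ) : ℝ) := by positivity
    rw [zero_pow two_ne_zero, sub_zero, abs_of_nonneg (by positivity)] at h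
    have h' : ((2 * q + 2 : ℕ) : ℝ) * ‖SPD_I (2 * q + 2) 0‖ = (2 * q + 1 : ℕ) * ‖SPD_I (2 * q) 0‖ := by
      apply mul_left_cancel₀ hp.ne'
      linarith
    rw [show 2 * (q + 1) = 2 * q + 2 by ring, pow_succ]
    have h7 : ((2 * q + 2 : ℕ) : ℝ) ≤ 2 * (2 * q + 1 : ℕ) := by push_cast; linarith [(Nat.cast_nonneg q : (0:ℝ) ≤ q)]
    have h8 := mul_le_mul_of_nonneg_right h7 (norm_nonneg (SPD_I (2 * q) 0))
    have : ((2 * q + 2 : ℕ) : ℝ) * (‖SPD_I (2 * q) 0‖ / 2) ≤ ((2 * q + 2 : ℕ) : ℝ) * ‖SPD_I (2 * q + 2) 0‖ := by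
      linarith
    have := le_of_mul_le_mul_left this hp
    linarith

lemma SPD_I_step (k : ℕ) (x : ℝ) (hx : 2 * ((k + 2 : ℕ) : ℝ) ≤ |x|) :
    ‖SPD_I (k + 2) x‖ ≤ 4 / 3 * ((k + 2 : ℕ) : ℝ) ^ 2 / x ^ 2 * ‖SPD_I k x‖ := by
  have h := SPD_I_rec_norm k x
  have hp : (0 : ℝ) < ((k + 2 : ℕ) : ℝ) := by positivity
  have hx2 : 4 * ((k + 2 : ℕ) : ℝ) ^ 2 ≤ x ^ 2 := by
    rw [← sq_abs x]; nlinarith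
  have hx0 : 0 < x ^ 2 := by nlinarith [sq_pos_of_pos hp]
  have h1 : 3 / 4 * x ^ 2 ≤ |((k + 2 : ℕ) : ℝ) ^ 2 - x ^ 2| := by
    rw [abs_sub_comm]
    refine le_trans ?_ (le_abs_self _)
    linarith
  have h2 := mul_le_mul_of_nonneg_right h1 (norm_nonneg (SPD_I (k + 2) x))
  have h5 : ((k + 2 : ℕ) : ℝ) * (k + 1 : ℕ) * ‖SPD_I k x‖ ≤ ((k + 2 : ℕ) : ℝ) ^ 2 * ‖SPD_I k x‖ := by
    have : ((k + 1 : ℕ) : ℝ) ≤ (k + 2 : ℕ) := by push_cast; linarith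
    rw [sq]
    gcongr
  rw [div_mul_eq_mul_div, le_div_iff₀ hx0]
  linarith

lemma SPD_I_decay (q : ℕ) (x : ℝ) (hx : 4 * (q : ℝ) ≤ |x|) :
    ‖SPD_I (2 * q) x‖ ≤ Real.pi * (1 / 3) ^ q := by
  induction q with
  | zero => simpa using SPD_I_le 0 x
  | succ q ih =>
    have ih' := ih (le_trans (by push_cast; linarith) hx)
    have hx' : 2 * ((2 * q + 2 : ℕ) : ℝ) ≤ |x| := by
      refine le_trans (le_of_eq ?_) hx; push_cast; ring
    have h := SPD_I_step (2 * q) x hx'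
    have hp : (0 : ℝ) < ((2 * q + 2 : ℕ) : ℝ) := by positivity
    have hx2 : 4 * ((2 * q + 2 : ℕ) : ℝ) ^ 2 ≤ x ^ 2 := by
      rw [← sq_abs x]; nlinarith
    have hx0 : 0 < x ^ 2 := by nlinarith [sq_pos_of_pos hp]
    have h3 : 4 / 3 * ((2 * q + 2 : ℕ) : ℝ) ^ 2 / x ^ 2 ≤ 1 / 3 := by
      rw [div_le_iff₀ hx0]; linarith
    rw [show 2 * (q + 1) = 2 * q + 2 by ring]
    calc _ ≤ _ := h
      _ ≤ 1 / 3 * (Real.pi * (1 / 3) ^ q) := by gcongr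
      _ = _ := by ring

/-- ratio bound -/
lemma SPD_I_ratio (q : ℕ) (hq : 1 ≤ q) (x : ℝ) (hx : 4 * (q : ℝ) ≤ |x|) :
    ‖SPD_I (2 * q) x‖ / ‖SPD_I (2 * q) 0‖ ≤ 16 * (q : ℝ) ^ 2 * (2 / 3) ^ q * (1 / x ^ 2) := by
  obtain ⟨p, rfl⟩ : ∃ p, q = p + 1 := ⟨q - 1, by omega⟩
  have hx' : 2 * ((2 * p + 2 : ℕ) : ℝ) ≤ |x| := by
    refine le_trans (le_of_eq ?_) hx; push_cast; ring
  have h := SPD_I_step (2 * p) x hx'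
  have h0 := SPD_I_zero (p + 1)
  have hpi := Real.pi_pos
  have hd := SPD_I_decay p x (le_trans (by push_cast; linarith) hx)
  have hpos : 0 < ‖SPD_I (2 * (p + 1)) 0‖ := lt_of_lt_of_le (by positivity) h0
  rw [div_le_iff₀ hpos]
  rw [show 2 * (p + 1) = 2 * p + 2 by ring] at h0 ⊢
  calc _ ≤ _ := h
    _ ≤ 4 / 3 * ((2 * p + 2 : ℕ) : ℝ) ^ 2 / x ^ 2 * (Real.pi * (1 / 3) ^ p) := by gcongr
    _ = 16 * ((p + 1 : ℕ) : ℝ) ^ 2 * (2 / 3) ^ (p + 1) * (1 / x ^ 2) * (Real.pi * (1 / 2) ^ (p + 1)) := by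
        have : (2 / 3 : ℝ) ^ (p + 1) * (1 / 2) ^ (p + 1) = (1 / 3) ^ p * (1 / 3) := by
          rw [← mul_pow, pow_succ]; norm_num
        push_cast
        calc _ = 16 * ((p : ℝ) + 1) ^ 2 * (1 / x ^ 2) * Real.pi * ((1 / 3) ^ p * (1 / 3)) := by ring
          _ = _ := by rw [← this]; ring
    _ ≤ _ := by gcongr

lemma SPD_poly {ι : Type*} (w : ι → ℂ) (hw : ∀ l, ‖w l‖ = 1) (S : Finset ι) :
    ∃ c : ℕ → ℂ, (∀ i, ‖c i‖ ≤ 2 ^ S.card) ∧ ∀ N, S.card ≤ N → ∀ z : ℂ,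
      ∏ l ∈ S, (1 - w l * z) = ∑ i ∈ Finset.range (N + 1), c i * z ^ i := by
  classical
  set p : Finset ι → Polynomial ℂ := fun S =>
    ∏ l ∈ S, (1 - Polynomial.C (w l) * Polynomial.X) with hp
  have hdeg : ∀ S : Finset ι, (p S).natDegree ≤ S.card := by
    intro S
    refine (Polynomial.natDegree_prod_le _ _).trans ?_
    rw [Finset.card_eq_sum_ones]
    apply Finset.sum_le_sum
    intro l _
    refine (Polynomial.natDegree_sub_le _ _).trans ?_
    simp only [Polynomial.natDegree_one, zero_le, sup_of_le_right]
    refine (Polynomial.natDegree_C_mul_le _ _).trans Polynomial.natDegree_X_le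
  have hco : ∀ S : Finset ι, ∀ i, ‖(p S).coeff i‖ ≤ 2 ^ S.card := by
    intro S
    induction S using Finset.induction_on with
    | empty =>
      intro i
      simp only [hp, Finset.prod_empty, Polynomial.coeff_one, Finset.card_empty, pow_zero]
      split_ifs <;> simp
    | insert a S ha ih =>
      intro i
      have : p (insert a S) = p S - Polynomial.C (w a) * (p S * Polynomial.X) := by
        simp only [hp, Finset.prod_insert ha]; ring
      rw [this, Polynomial.coeff_sub, Polynomial.coeff_C_mul, Finset.card_insert_of_notMem ha, pow_succ]
      refine (norm_sub_le _ _).trans ?_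
      rw [norm_mul, hw, one_mul]
      have h2 : ‖(p S * Polynomial.X).coeff i‖ ≤ 2 ^ S.card := by
        cases i with
        | zero => simp
        | succ i => rw [Polynomial.coeff_mul_X]; exact ih i
      linarith [ih i]
  refine ⟨(p S).coeff, hco S, fun N hN z => ?_⟩
  rw [← Polynomial.eval_eq_sum_range' (lt_of_le_of_lt (hdeg S) (Nat.lt_succ_of_le hN))]
  simp [hp, Polynomial.eval_prod]

section
variable {ι : Type*} [Fintype ι]

lemma SPD_e_norm (x : ℝ) (u : ℝ) : ‖Complex.exp (x * u * Complex.I)‖ = 1 := by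
  rw [show (x * u * Complex.I : ℂ) = ((x * u : ℝ) : ℂ) * Complex.I by push_cast; ring,
        Complex.norm_exp_ofReal_mul_I]

lemma SPD_e_conj (x : ℝ) (u : ℝ) : (starRingEnd ℂ) (Complex.exp (x * u * Complex.I))
    = Complex.exp (-(x * u * Complex.I)) := by
  rw [← Complex.exp_conj]; simp

lemma SPD_normsq_sum (a : ι → ℂ) :
    ((‖∑ k, a k‖ ^ 2 : ℝ) : ℂ) = ∑ k, ∑ j, a k * (starRingEnd ℂ) (a j) := by
  push_cast
  rw [← Complex.mul_conj', map_sum, Finset.sum_mul_sum]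

/-- Upper bound of the Gram form. -/
lemma SPD_gram_upper (lam : ι → ℝ) (d : ℝ) (hd : 0 < d)
    (hsep : ∀ k j, k ≠ j → d ≤ |lam k - lam j|) (q : ℕ) (hq : 1 ≤ q) (y : ι → ℂ) :
    ∫ u in (-(Real.pi / 2))..(Real.pi / 2),
      ‖∑ k, (Real.cos u : ℂ) ^ (2 * q) * (y k * Complex.exp (lam k * u * Complex.I))‖ ^ 2
      ≤ (Real.pi + 2 * Real.pi * (4 * q) ^ 2 * (2 * SPD_Z / d ^ 2)) * ∑ k, ‖y k‖ ^ 2 := by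
  classical
  have e1 : ((∫ u in (-(Real.pi / 2))..(Real.pi / 2),
      ‖∑ k, (Real.cos u : ℂ) ^ (2 * q) * (y k * Complex.exp (lam k * u * Complex.I))‖ ^ 2 : ℝ) : ℂ)
      = ∑ k, ∑ j, y k * (starRingEnd ℂ) (y j) * SPD_I (4 * q) (lam k - lam j) := by
    rw [← intervalIntegral.integral_ofReal]
    simp only [SPD_normsq_sum]
    rw [intervalIntegral.integral_finsetSum]
    · apply Finset.sum_congr rfl; intro k _
      rw [intervalIntegral.integral_finsetSum]
      · apply Finset.sum_congr rfl; intro j _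
        rw [SPD_I, ← intervalIntegral.integral_const_mul]
        apply intervalIntegral.integral_congr
        intro u _
        simp only [map_mul, SPD_e_conj, map_pow, Complex.conj_ofReal]
        rw [show ((lam k - lam j : ℝ) : ℂ) * u * Complex.I = lam k * u * Complex.I +
          -(lam j * u * Complex.I) by push_cast; ring, Complex.exp_add]
        ring
      · intro j _
        apply Continuous.intervalIntegrable; fun_prop
    · intro k _
      apply Continuous.intervalIntegrable; fun_prop
  have e2 := congrArg Complex.re e1
  rw [Complex.ofReal_re] at e2
  rw [e2]
  set e : ι → ι → ℝ := fun k j => if j = k then Real.pi else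
    2 * Real.pi * (4 * q) ^ 2 * (1 / (lam j - lam k) ^ 2) with he
  have hpi := Real.pi_pos
  have hsym : ∀ k j, e k j = e j k := by
    intro k j
    by_cases h : j = k
    · subst h; rfl
    · simp only [he, if_neg h, if_neg (Ne.symm h)]
      rw [show (lam j - lam k) ^ 2 = (lam k - lam j) ^ 2 by ring]
  have hrow : ∀ k, ∑ j, e k j ≤ Real.pi + 2 * Real.pi * (4 * q) ^ 2 * (2 * SPD_Z / d ^ 2) := by
    intro k
    rw [← Finset.add_sum_erase _ _ (Finset.mem_univ k)]
    apply add_le_add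
    · simp [he]
    · have : ∑ j ∈ Finset.univ.erase k, e k j = 2 * Real.pi * (4 * q) ^ 2 *
          ∑ j ∈ Finset.univ.erase k, 1 / (lam j - lam k) ^ 2 := by
        rw [Finset.mul_sum]
        apply Finset.sum_congr rfl
        intro j hj
        simp only [he, if_neg (Finset.ne_of_mem_erase hj)]
      rw [this]
      gcongr
      exact SPD_sum_sep lam d hd hsep k
  have hIe : ∀ k j, ‖SPD_I (4 * q) (lam k - lam j)‖ ≤ e k j := by
    intro k j
    by_cases h : j = k
    · simp only [he, if_pos h]; exact SPD_I_le _ _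
    · simp only [he, if_neg h]
      have hs := hsep j k h
      have h0 : 0 < (lam j - lam k) ^ 2 := by rw [← sq_abs]; have := lt_of_lt_of_le hd hs; positivity
      rw [mul_one_div, le_div_iff₀ h0]
      have := SPD_I_sq (4 * q - 2) (lam k - lam j)
      rw [show 4 * q - 2 + 2 = 4 * q by omega] at this
      push_cast at this
      calc _ = (lam k - lam j) ^ 2 * ‖SPD_I (4 * q) (lam k - lam j)‖ := by ring
        _ ≤ _ := this
  calc _ ≤ ∑ k, ∑ j, e k j * (‖y k‖ * ‖y j‖) := by
        refine (Complex.re_le_norm _).trans ((norm_sum_le _ _).trans ?_)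
        apply Finset.sum_le_sum; intro k _
        refine (norm_sum_le _ _).trans ?_
        apply Finset.sum_le_sum; intro j _
        rw [norm_mul, norm_mul, Complex.norm_conj, mul_comm]
        gcongr
        exact hIe k j
    _ ≤ _ := SPD_schur_bil e (fun k j => by simp only [he]; split_ifs <;> positivity) _ hrow
        (fun j => by simp only [hsym _ j]; exact hrow j) _

/-- Bessel inequality. -/
lemma SPD_bessel (lam : ι → ℝ) (d : ℝ) (hd : 0 < d)
    (hsep : ∀ k j, k ≠ j → d ≤ |lam k - lam j|) (q : ℕ) (hq : 1 ≤ q) (H : ℝ → ℂ)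
    (hH : Continuous H) :
    ∑ k, ‖∫ u in (-(Real.pi / 2))..(Real.pi / 2),
        (Real.cos u : ℂ) ^ (2 * q) * Complex.exp (-(lam k * u * Complex.I)) * H u‖ ^ 2 ≤
      (Real.pi + 2 * Real.pi * (4 * q) ^ 2 * (2 * SPD_Z / d ^ 2)) *
        ∫ u in (-(Real.pi / 2))..(Real.pi / 2), ‖H u‖ ^ 2 := by
  set C := (Real.pi + 2 * Real.pi * (4 * q) ^ 2 * (2 * SPD_Z / d ^ 2))
  have hpi := Real.pi_pos
  have hC : 0 < C := by have := SPD_Z_nonneg; positivity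
  set y : ι → ℂ := fun k => ∫ u in (-(Real.pi / 2))..(Real.pi / 2),
        (Real.cos u : ℂ) ^ (2 * q) * Complex.exp (-(lam k * u * Complex.I)) * H u with hy
  have hG := SPD_gram_upper lam d hd hsep q hq y
  set K : ℝ → ℂ := fun u =>
    ∑ k, (Real.cos u : ℂ) ^ (2 * q) * (y k * Complex.exp (lam k * u * Complex.I)) with hK
  have hKc : Continuous K := by fun_prop
  have h1 : ((∑ k, ‖y k‖ ^ 2 : ℝ) : ℂ) =
      ∫ u in (-(Real.pi / 2))..(Real.pi / 2), (starRingEnd ℂ) (K u) * H u := by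
    simp only [hK, map_sum, Finset.sum_mul]
    rw [intervalIntegral.integral_finsetSum]
    · rw [Complex.ofReal_sum]
      apply Finset.sum_congr rfl; intro k _
      rw [Complex.ofReal_pow, ← Complex.conj_mul']
      change (starRingEnd ℂ) (y k) * (∫ u in (-(Real.pi / 2))..(Real.pi / 2),
        (Real.cos u : ℂ) ^ (2 * q) * Complex.exp (-(lam k * u * Complex.I)) * H u) = _
      rw [← intervalIntegral.integral_const_mul]
      apply intervalIntegral.integral_congr
      intro u _
      simp only [map_mul, SPD_e_conj, map_pow, Complex.conj_ofReal]
      ring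
    · intro k _
      apply Continuous.intervalIntegrable; fun_prop
  have h2 : ∑ k, ‖y k‖ ^ 2 ≤ ∫ u in (-(Real.pi / 2))..(Real.pi / 2),
      (C / 2 * ‖H u‖ ^ 2 + 1 / (2 * C) * ‖K u‖ ^ 2) := by
    calc ∑ k, ‖y k‖ ^ 2 = ‖((∑ k, ‖y k‖ ^ 2 : ℝ) : ℂ)‖ := by
          rw [Complex.norm_real, Real.norm_of_nonneg]; positivity
      _ ≤ ∫ u in (-(Real.pi / 2))..(Real.pi / 2), ‖(starRingEnd ℂ) (K u) * H u‖ := by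
          rw [h1]
          apply intervalIntegral.norm_integral_le_integral_norm; linarith
      _ ≤ _ := by
          apply intervalIntegral.integral_mono_on (by linarith)
          · apply Continuous.intervalIntegrable; fun_prop
          · apply Continuous.intervalIntegrable; fun_prop
          · intro u _
            rw [norm_mul, Complex.norm_conj]
            have : 0 ≤ (C * ‖H u‖ - ‖K u‖) ^ 2 / (2 * C) := by positivity
            have h3 : (C * ‖H u‖ - ‖K u‖) ^ 2 / (2 * C) = C / 2 * ‖H u‖ ^ 2 + 1 / (2 * C) * ‖K u‖ ^ 2
              - ‖K u‖ * ‖H u‖ := by field_simp; ring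
            linarith
  rw [intervalIntegral.integral_add, intervalIntegral.integral_const_mul,
    intervalIntegral.integral_const_mul] at h2
  · have h3 : 1 / (2 * C) * ∫ u in (-(Real.pi / 2))..(Real.pi / 2), ‖K u‖ ^ 2
        ≤ 1 / (2 * C) * (C * ∑ k, ‖y k‖ ^ 2) := by gcongr
    have h4 : 1 / (2 * C) * (C * ∑ k, ‖y k‖ ^ 2) = (∑ k, ‖y k‖ ^ 2) / 2 := by field_simp
    linarith
  · apply Continuous.intervalIntegrable; fun_prop
  · apply Continuous.intervalIntegrable; fun_prop
end

section
variable {ι : Type*} [Fintype ι]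

lemma SPD_fac_norm (b x y : ℝ) :
    ‖1 - Complex.exp (-(2 * b * y * Complex.I)) * Complex.exp (2 * b * x * Complex.I)‖
      = 2 * |Real.sin (b * (x - y))| := by
  rw [← Complex.exp_add, show (-(2 * b * y * Complex.I) + 2 * b * x * Complex.I : ℂ)
    = Complex.I * ((2 * (b * (x - y)) : ℝ) : ℂ) by push_cast; ring, norm_sub_rev,
    Complex.norm_exp_I_mul_ofReal_sub_one, Real.norm_eq_abs, abs_mul]
  norm_num

lemma SPD_ingham_core (lam : ι → ℝ) (d : ℝ) (hd : 0 < d)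
    (hsep : ∀ k j, k ≠ j → d ≤ |lam k - lam j|) (q : ℕ) (hq : 1 ≤ q) (τ ε : ℝ) (hτ : 0 < τ)
    (hK : 1 ≤ 1 / (d * τ)) (hε : ε * Real.log (1 / (d * τ)) ≤ τ) (hε0 : 0 < ε) (hε2 : ε ≤ 1 / 2)
    (hcard : ∀ k (S : Finset ι), (∀ l ∈ S, |lam l - lam k| ≤ 4 * q) → (S.card : ℝ) ≤ ε * (4 * q))
    (hsmall : 16 * (q : ℝ) ^ 2 * (2 / 3) ^ q * Real.exp (4 * τ * (4 * q)) * (2 * SPD_Z / d ^ 2) ≤ 1 / 2)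
    (ξ : ι → ℂ) (N : ℕ) (hN : N = ⌊ε * (4 * q)⌋₊) (B : ℝ)
    (hB : B = 2 ^ N * Real.exp (4 * τ * (4 * q)) / ‖SPD_I (2 * q) 0‖) :
    ∑ k, ‖ξ k‖ ^ 2 ≤ 4 * (B ^ 2 * (N + 1) ^ 2 *
      (Real.pi + 2 * Real.pi * (4 * q) ^ 2 * (2 * SPD_Z / d ^ 2))) *
      ∫ u in (-Real.pi)..Real.pi, ‖∑ k, ξ k * Complex.exp (lam k * u * Complex.I)‖ ^ 2 := by
  classical
  have hpi := Real.pi_pos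
  set C := (Real.pi + 2 * Real.pi * (4 * q) ^ 2 * (2 * SPD_Z / d ^ 2))
  have hC : 0 < C := by have := SPD_Z_nonneg; positivity
  set R : ℝ := 4 * q with hR
  have hq' : (1 : ℝ) ≤ q := by exact_mod_cast hq
  have hR0 : 0 < R := by positivity
  set b : ℝ := Real.pi / (2 * R) with hb
  have hb0 : 0 < b := by positivity
  set I0 := SPD_I (2 * q) 0 with hI0
  have hI0pos : 0 < ‖I0‖ := lt_of_lt_of_le (by positivity) (SPD_I_zero q)
  set S : ι → Finset ι := fun k => Finset.univ.filter fun l => l ≠ k ∧ |lam l - lam k| ≤ R with hS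
  have hScard : ∀ k, ((S k).card : ℝ) ≤ ε * R := fun k => hcard k (S k) (by
    intro l hl; exact (Finset.mem_filter.1 hl).2.2)
  have hScardN : ∀ k, (S k).card ≤ N := fun k => by rw [hN]; exact Nat.le_floor (hScard k)
  have hkS : ∀ k, k ∉ S k := fun k hk => (Finset.mem_filter.1 hk).2.1 rfl
  set w : ι → ℂ := fun l => Complex.exp (-(2 * b * lam l * Complex.I)) with hw
  set z : ι → ℂ := fun l => Complex.exp (2 * b * lam l * Complex.I) with hz
  have hwn : ∀ l, ‖w l‖ = 1 := by
    intro l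
    simp only [hw]
    rw [show (-(2 * b * lam l * Complex.I) : ℂ) = ((-(2 * b * lam l) : ℝ) : ℂ) * Complex.I by
      push_cast; ring, Complex.norm_exp_ofReal_mul_I]
  choose c hc1 hc2 using fun k => SPD_poly w hwn (S k)
  set p : ι → ι → ℂ := fun k j => ∏ l ∈ S k, (1 - w l * z j) with hp
  have hprod : ∀ k, ∏ l ∈ S k, (R / |lam k - lam l|) ≤ Real.exp (4 * τ * R) := fun k =>
    SPD_prod_sep lam d hd hsep k τ R ε hτ hR0 hK hε (S k) (hkS k) (hScard k)
  -- lower bound for the diagonal factor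
  have hfac : ∀ k, ∀ l ∈ S k, 0 < |lam k - lam l| ∧ 2 * (|lam k - lam l| / R) ≤ ‖1 - w l * z k‖ := by
    intro k l hl
    obtain ⟨-, hlk, hlR⟩ := Finset.mem_filter.1 hl
    refine ⟨lt_of_lt_of_le hd (hsep k l (Ne.symm hlk)), ?_⟩
    simp only [hw, hz]
    rw [SPD_fac_norm]
    have hle : |b * (lam k - lam l)| ≤ Real.pi / 2 := by
      rw [abs_mul, abs_of_pos hb0, abs_sub_comm]
      calc b * |lam l - lam k| ≤ b * R := by gcongr
        _ = Real.pi / 2 := by rw [hb]; field_simp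
    have := Real.mul_abs_le_abs_sin hle
    rw [abs_mul, abs_of_pos hb0] at this
    have e : 2 / Real.pi * (b * |lam k - lam l|) = |lam k - lam l| / R := by rw [hb]; field_simp
    rw [e] at this
    linarith
  have hDpos : ∀ k, 0 < ‖p k k‖ := by
    intro k
    simp only [hp, norm_prod]
    apply Finset.prod_pos
    intro l hl
    obtain ⟨h1, h2⟩ := hfac k l hl
    exact lt_of_lt_of_le (by positivity) h2
  have hratio : ∀ k j, ‖p k j‖ / ‖p k k‖ ≤ Real.exp (4 * τ * R) := by
    intro k j
    refine le_trans ?_ (hprod k)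
    simp only [hp, norm_prod]
    rw [← Finset.prod_div_distrib]
    apply Finset.prod_le_prod (fun _ _ => by positivity)
    intro l hl
    obtain ⟨h1, h2⟩ := hfac k l hl
    have h3 : ‖1 - w l * z j‖ ≤ 2 := by
      simp only [hw, hz]
      rw [SPD_fac_norm]
      linarith [Real.abs_sin_le_one (b * (lam j - lam l))]
    calc _ ≤ 2 / (2 * (|lam k - lam l| / R)) := by gcongr
      _ = _ := by field_simp
  have hDinv : ∀ k, 1 / ‖p k k‖ ≤ Real.exp (4 * τ * R) := by
    intro k
    refine le_trans ?_ (hprod k)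
    simp only [hp, norm_prod]
    rw [← Finset.prod_const_one (s := S k), ← Finset.prod_div_distrib]
    apply Finset.prod_le_prod (fun _ _ => by positivity)
    intro l hl
    obtain ⟨h1, h2⟩ := hfac k l hl
    calc _ ≤ 2 / (2 * (|lam k - lam l| / R)) := by gcongr; norm_num
      _ = _ := by field_simp
  set P : ℝ → ℂ := fun u => ∑ k, ξ k * Complex.exp (lam k * u * Complex.I) with hP
  have hPc : Continuous P := by fun_prop
  set y : ℕ → ι → ℂ := fun i k => ∫ u in (-(Real.pi / 2))..(Real.pi / 2),
        (Real.cos u : ℂ) ^ (2 * q) * Complex.exp (-(lam k * u * Complex.I)) * P (u + 2 * b * i) with hy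
  set L : ι → ℂ := fun k => ∑ i ∈ Finset.range (N + 1), c k i * y i k with hL
  -- evaluate y
  have hyev : ∀ i k, y i k = ∑ j, ξ j * z j ^ i * SPD_I (2 * q) (lam j - lam k) := by
    intro i k
    simp only [hy, hP, Finset.mul_sum]
    rw [intervalIntegral.integral_finsetSum]
    · apply Finset.sum_congr rfl; intro j _
      rw [SPD_I, ← intervalIntegral.integral_const_mul]
      apply intervalIntegral.integral_congr
      intro u _
      simp only [hz]
      rw [← Complex.exp_nat_mul]
      have : Complex.exp (-(lam k * u * Complex.I)) * Complex.exp (lam j * ((u + 2 * b * i : ℝ) : ℂ) * Complex.I)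
        = Complex.exp (i * (2 * b * lam j * Complex.I)) * Complex.exp (((lam j - lam k : ℝ) : ℂ) * u * Complex.I) := by
        rw [← Complex.exp_add, ← Complex.exp_add]
        congr 1; push_cast; ring
      linear_combination (Real.cos u : ℂ) ^ (2 * q) * ξ j * this
    · intro j _
      apply Continuous.intervalIntegrable; fun_prop
  have hLev : ∀ k, L k = ∑ j, ξ j * p k j * SPD_I (2 * q) (lam j - lam k) := by
    intro k
    simp only [hL, hyev, Finset.mul_sum]
    rw [Finset.sum_comm]
    apply Finset.sum_congr rfl; intro j _
    simp only [hp]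
    rw [hc2 k N (hScardN k) (z j), Finset.mul_sum, Finset.sum_mul]
    apply Finset.sum_congr rfl; intro i _
    ring
  set M : ℝ := 16 * (q : ℝ) ^ 2 * (2 / 3) ^ q * Real.exp (4 * τ * R) with hM
  set e : ι → ι → ℝ := fun k j => if j = k then 0 else M * (1 / (lam j - lam k) ^ 2) with he
  have hM0 : 0 ≤ M := by positivity
  have he0 : ∀ k j, 0 ≤ e k j := fun k j => by simp only [he]; split_ifs <;> positivity
  have hrow : ∀ k, ∑ j, e k j ≤ 1 / 2 := by
    intro k
    rw [← Finset.add_sum_erase _ _ (Finset.mem_univ k)]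
    have : ∑ j ∈ Finset.univ.erase k, e k j = M *
          ∑ j ∈ Finset.univ.erase k, 1 / (lam j - lam k) ^ 2 := by
        rw [Finset.mul_sum]
        apply Finset.sum_congr rfl
        intro j hj
        simp only [he, if_neg (Finset.ne_of_mem_erase hj)]
    rw [this]
    simp only [he, if_pos, zero_add]
    refine le_trans ?_ hsmall
    gcongr
    exact SPD_sum_sep lam d hd hsep k
  have hsym : ∀ k j, e k j = e j k := by
    intro k j
    by_cases h : j = k
    · subst h; rfl
    · simp only [he, if_neg h, if_neg (Ne.symm h)]
      rw [show (lam j - lam k) ^ 2 = (lam k - lam j) ^ 2 by ring]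
  have hoff : ∀ k j, j ≠ k → ‖p k j * SPD_I (2 * q) (lam j - lam k)‖ / (‖p k k‖ * ‖I0‖) ≤ e k j := by
    intro k j hjk
    simp only [he, if_neg hjk]
    by_cases hjS : |lam j - lam k| ≤ R
    · have hj : j ∈ S k := by simp [hS, hjk, hjS]
      have h0 : p k j = 0 := by
        simp only [hp]
        apply Finset.prod_eq_zero hj
        simp only [hw, hz]
        rw [← Complex.exp_add]; simp
      rw [h0]; simp; positivity
    · have h1 := SPD_I_ratio q hq (lam j - lam k) (not_le.1 hjS).le
      rw [norm_mul, mul_div_mul_comm]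
      calc _ ≤ Real.exp (4 * τ * R) * (16 * (q : ℝ) ^ 2 * (2 / 3) ^ q * (1 / (lam j - lam k) ^ 2)) :=
            mul_le_mul (hratio k j) h1 (by positivity) (by positivity)
        _ = _ := by rw [hM]; ring
  have hξ : ∀ k, ‖ξ k‖ ≤ ‖L k‖ / (‖p k k‖ * ‖I0‖) + ∑ j, e k j * ‖ξ j‖ := by
    intro k
    have hden : 0 < ‖p k k‖ * ‖I0‖ := mul_pos (hDpos k) hI0pos
    have h1 : ξ k * (p k k * I0) = L k - ∑ j ∈ Finset.univ.erase k, ξ j * p k j * SPD_I (2 * q) (lam j - lam k) := by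
      rw [hLev, ← Finset.add_sum_erase _ _ (Finset.mem_univ k), sub_self]
      ring
    have h2 : ‖ξ k‖ * (‖p k k‖ * ‖I0‖) ≤ ‖L k‖ + ∑ j ∈ Finset.univ.erase k, ‖ξ j * p k j * SPD_I (2 * q) (lam j - lam k)‖ := by
      rw [← norm_mul, ← norm_mul, h1]
      exact (norm_sub_le _ _).trans (by gcongr; exact norm_sum_le _ _)
    rw [← le_div_iff₀ hden, add_div, Finset.sum_div] at h2
    refine h2.trans ?_
    gcongr
    rw [← Finset.add_sum_erase _ _ (Finset.mem_univ k)]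
    have : 0 ≤ e k k * ‖ξ k‖ := mul_nonneg (he0 k k) (norm_nonneg _)
    refine le_trans ?_ (le_add_of_nonneg_left this)
    apply Finset.sum_le_sum
    intro j hj
    have := hoff k j (Finset.ne_of_mem_erase hj)
    calc _ = ‖p k j * SPD_I (2 * q) (lam j - lam k)‖ / (‖p k k‖ * ‖I0‖) * ‖ξ j‖ := by
          simp only [norm_mul]; ring
      _ ≤ _ := by gcongr
  have hsch := SPD_schur_op e he0 (1 / 2) (by norm_num) hrow
    (fun j => by simp only [hsym _ j]; exact hrow j) (fun j => ‖ξ j‖)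
  have hY : ∑ k, ‖ξ k‖ ^ 2 ≤ 4 * ∑ k, (‖L k‖ / (‖p k k‖ * ‖I0‖)) ^ 2 := by
    have : ∑ k, ‖ξ k‖ ^ 2 ≤ ∑ k, (2 * (‖L k‖ / (‖p k k‖ * ‖I0‖)) ^ 2 + 2 * (∑ j, e k j * ‖ξ j‖) ^ 2) := by
      apply Finset.sum_le_sum; intro k _
      have h1 := pow_le_pow_left₀ (norm_nonneg _) (hξ k) 2
      nlinarith [sq_nonneg (‖L k‖ / (‖p k k‖ * ‖I0‖) - ∑ j, e k j * ‖ξ j‖)]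
    rw [Finset.sum_add_distrib, ← Finset.mul_sum, ← Finset.mul_sum] at this
    linarith
  have hB0 : 0 ≤ B := by rw [hB]; positivity
  have hLk : ∀ k, (‖L k‖ / (‖p k k‖ * ‖I0‖)) ^ 2 ≤ B ^ 2 * (N + 1) * ∑ i ∈ Finset.range (N + 1), ‖y i k‖ ^ 2 := by
    intro k
    have h1 : ‖L k‖ / (‖p k k‖ * ‖I0‖) ≤ B * ∑ i ∈ Finset.range (N + 1), ‖y i k‖ := by
      have h2 : ‖L k‖ ≤ 2 ^ N * ∑ i ∈ Finset.range (N + 1), ‖y i k‖ := by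
        simp only [hL]
        rw [Finset.mul_sum]
        refine (norm_sum_le _ _).trans ?_
        apply Finset.sum_le_sum; intro i _
        rw [norm_mul]
        gcongr
        exact (hc1 k i).trans (pow_le_pow_right₀ (by norm_num) (hScardN k))
      calc _ = ‖L k‖ * (1 / ‖p k k‖) * (1 / ‖I0‖) := by field_simp
        _ ≤ (2 ^ N * ∑ i ∈ Finset.range (N + 1), ‖y i k‖) * Real.exp (4 * τ * R) * (1 / ‖I0‖) := by
            gcongr
            exact hDinv k
        _ = _ := by rw [hB]; ring
    have h3 := pow_le_pow_left₀ (by positivity) h1 2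
    refine h3.trans ?_
    rw [mul_pow, mul_assoc]
    gcongr
    have := sq_sum_le_card_mul_sum_sq (s := Finset.range (N + 1)) (f := fun i => ‖y i k‖)
    simpa using this
  have hbes : ∀ i ∈ Finset.range (N + 1), ∑ k, ‖y i k‖ ^ 2 ≤ C * ∫ u in (-Real.pi)..Real.pi, ‖P u‖ ^ 2 := by
    intro i hi
    have h1 := SPD_bessel lam d hd hsep q hq (fun u => P (u + 2 * b * i)) (by fun_prop)
    refine h1.trans ?_
    gcongr
    have hiN : (i : ℝ) ≤ N := by exact_mod_cast Nat.lt_succ_iff.1 (Finset.mem_range.1 hi)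
    have hNR : (N : ℝ) ≤ ε * R := by rw [hN]; exact Nat.floor_le (by positivity)
    have hsh : 2 * b * i ≤ Real.pi / 2 := by
      calc 2 * b * i ≤ 2 * b * (1 / 2 * R) := by gcongr; exact hiN.trans (hNR.trans (by gcongr))
        _ = _ := by rw [hb]; field_simp
    have hsh0 : 0 ≤ 2 * b * i := by positivity
    rw [intervalIntegral.integral_comp_add_right (fun u => ‖P u‖ ^ 2)]
    apply intervalIntegral.integral_mono_interval
    · linarith
    · linarith
    · linarith
    · exact Filter.Eventually.of_forall fun u => by positivity
    · apply Continuous.intervalIntegrable; fun_prop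
  calc ∑ k, ‖ξ k‖ ^ 2 ≤ _ := hY
    _ ≤ 4 * ∑ k, B ^ 2 * (N + 1) * ∑ i ∈ Finset.range (N + 1), ‖y i k‖ ^ 2 := by
        gcongr with k _; exact hLk k
    _ = 4 * (B ^ 2 * (N + 1) * ∑ i ∈ Finset.range (N + 1), ∑ k, ‖y i k‖ ^ 2) := by
        rw [← Finset.mul_sum, Finset.sum_comm]
    _ ≤ 4 * (B ^ 2 * (N + 1) * ∑ i ∈ Finset.range (N + 1), C * ∫ u in (-Real.pi)..Real.pi, ‖P u‖ ^ 2) := by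
        gcongr with i hi; exact hbes i hi
    _ = _ := by rw [Finset.sum_const, Finset.card_range, nsmul_eq_mul]; push_cast; ring
end

/-- Ingham–Beurling inequality on `(-π, π)`. -/
lemma SPD_ingham_pi (d : ℝ) (hd : 0 < d) (hd1 : d ≤ 1) : ∃ ε : ℝ, 0 < ε ∧ ∃ q0 : ℕ, ∀ q : ℕ, q0 ≤ q →
    ∃ c : ℝ, 0 < c ∧ ∀ (m : ℕ) (lam : Fin m → ℝ), (∀ k j, k ≠ j → d ≤ |lam k - lam j|) →
      (∀ k (S : Finset (Fin m)), (∀ l ∈ S, |lam l - lam k| ≤ 4 * q) → (S.card : ℝ) ≤ ε * (4 * q)) →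
      ∀ ξ : Fin m → ℂ, c * ∑ k, ‖ξ k‖ ^ 2 ≤
        ∫ u in (-Real.pi)..Real.pi, ‖∑ k, ξ k * Complex.exp (lam k * u * Complex.I)‖ ^ 2 := by
  set τ : ℝ := 1 / 200 with hτ
  have hK : 200 ≤ 1 / (d * τ) := by
    rw [hτ, le_div_iff₀ (by positivity)]; linarith
  have hlog : 0 < Real.log (1 / (d * τ)) := Real.log_pos (by linarith)
  set ε := min (1 / 2) (τ / Real.log (1 / (d * τ))) with hε
  have hτ0 : 0 < τ := by norm_num [hτ]
  have hε0 : 0 < ε := lt_min (by norm_num) (by positivity)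
  have hε1 : ε * Real.log (1 / (d * τ)) ≤ τ := by
    rw [← le_div_iff₀ hlog]; exact min_le_right _ _
  have hexp : Real.exp (16 * τ) ≤ 9 / 8 := by
    have h := Real.add_one_le_exp (-(16 * τ))
    rw [Real.exp_neg] at h
    have h3 : (8 : ℝ) / 9 ≤ (Real.exp (16 * τ))⁻¹ := le_trans (by norm_num [hτ]) h
    have := inv_anti₀ (by norm_num) h3
    rw [inv_inv] at this
    linarith
  have htend : Tendsto (fun q : ℕ => 16 * (2 * SPD_Z / d ^ 2) * ((q : ℝ) ^ 2 * (3 / 4) ^ q)) atTop (nhds 0) := by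
    have := (tendsto_pow_const_mul_const_pow_of_abs_lt_one 2 (r := (3 / 4 : ℝ)) (by norm_num [abs_lt])).const_mul (16 * (2 * SPD_Z / d ^ 2))
    simpa using this
  obtain ⟨q1, hq1⟩ := Filter.eventually_atTop.1 (htend.eventually_le_const (show (0 : ℝ) < 1 / 2 by norm_num))
  refine ⟨ε, hε0, max 1 q1, fun q hq => ?_⟩
  have hqq : 1 ≤ q := le_trans (le_max_left _ _) hq
  have hsmall : 16 * (q : ℝ) ^ 2 * (2 / 3) ^ q * Real.exp (4 * τ * (4 * q)) * (2 * SPD_Z / d ^ 2) ≤ 1 / 2 := by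
    refine le_trans ?_ (hq1 q (le_trans (le_max_right _ _) hq))
    have h1 : Real.exp (4 * τ * (4 * q)) ≤ (9 / 8) ^ q := by
      rw [show 4 * τ * (4 * (q : ℝ)) = q * (16 * τ) by ring, Real.exp_nat_mul]
      gcongr
    have h2 : (2 / 3 : ℝ) ^ q * Real.exp (4 * τ * (4 * q)) ≤ (3 / 4) ^ q := by
      calc _ ≤ (2 / 3 : ℝ) ^ q * (9 / 8) ^ q := by gcongr
        _ = _ := by rw [← mul_pow]; norm_num
    have := SPD_Z_nonneg
    calc _ = 16 * (2 * SPD_Z / d ^ 2) * ((q : ℝ) ^ 2 * ((2 / 3 : ℝ) ^ q * Real.exp (4 * τ * (4 * q)))) := by ring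
      _ ≤ _ := by gcongr
  set N := ⌊ε * (4 * q)⌋₊ with hN
  set B := 2 ^ N * Real.exp (4 * τ * (4 * q)) / ‖SPD_I (2 * q) 0‖ with hB
  have hpi := Real.pi_pos
  have hI : 0 < ‖SPD_I (2 * q) 0‖ := lt_of_lt_of_le (by positivity) (SPD_I_zero q)
  have hBpos : 0 < B := by positivity
  have hZ := SPD_Z_nonneg
  set A := 4 * (B ^ 2 * (N + 1) ^ 2 *
      (Real.pi + 2 * Real.pi * (4 * q) ^ 2 * (2 * SPD_Z / d ^ 2))) with hA
  have hApos : 0 < A := by positivity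
  refine ⟨1 / A, by positivity, fun m lam hsep hcard ξ => ?_⟩
  have := SPD_ingham_core lam d hd hsep q hqq τ ε hτ0 (by linarith) hε1 hε0 (min_le_left _ _) hcard
    hsmall ξ N hN B hB
  rw [one_div, inv_mul_le_iff₀ hApos]
  exact this

/-- Ingham–Beurling inequality for sequences of zero density. -/
theorem SPD_ingham (Λ : ℕ → ℝ) (d : ℝ) (hd : 0 < d) (hsep : ∀ k j, k ≠ j → d ≤ |Λ k - Λ j|)
    (hdens : ∀ ε > 0, ∃ r0 : ℝ, ∀ r ≥ r0, ∀ (x : ℝ) (S : Finset ℕ), (∀ l ∈ S, |Λ l - x| ≤ r) →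
      (S.card : ℝ) ≤ ε * r) (a : ℝ) (ha : 0 < a) :
    ∃ c : ℝ, 0 < c ∧ ∀ (m : ℕ) (κ : Fin m → ℕ), Function.Injective κ → ∀ ξ : Fin m → ℂ,
      c * ∑ k, ‖ξ k‖ ^ 2 ≤
        ∫ u in (-a)..a, ‖∑ k, ξ k * Complex.exp (Λ (κ k) * u * Complex.I)‖ ^ 2 := by
  have hpi := Real.pi_pos
  set s := a / Real.pi with hs
  have hs0 : 0 < s := by positivity
  obtain ⟨ε, hε, q0, H⟩ := SPD_ingham_pi (min 1 (d * s)) (by positivity) (min_le_left _ _)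
  obtain ⟨r0, hr0⟩ := hdens (ε * s) (by positivity)
  obtain ⟨q1, hq1⟩ := exists_nat_ge (r0 * s)
  obtain ⟨c, hc, Hc⟩ := H (max q0 q1) (le_max_left _ _)
  set q := max q0 q1
  have hq : r0 ≤ 4 * q / s := by
    rw [le_div_iff₀ hs0]
    have : (q1 : ℝ) ≤ q := by exact_mod_cast le_max_right _ _
    have : (0 : ℝ) ≤ q := by positivity
    linarith
  refine ⟨s * c, by positivity, fun m κ hκ ξ => ?_⟩
  have h1 := Hc m (fun k => Λ (κ k) * s) (by
    intro k j hkj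
    rw [← sub_mul, abs_mul, abs_of_pos hs0]
    refine (min_le_right _ _).trans ?_
    gcongr
    exact hsep _ _ (hκ.ne hkj)) (by
    intro k S hS
    have := hr0 (4 * q / s) hq (Λ (κ k)) (S.map ⟨κ, hκ⟩) (by
      intro l hl
      obtain ⟨i, hi, rfl⟩ := Finset.mem_map.1 hl
      have := hS i hi
      rw [← sub_mul, abs_mul, abs_of_pos hs0] at this
      rw [le_div_iff₀ hs0]; exact this)
    rw [Finset.card_map] at this
    refine this.trans (le_of_eq ?_)
    field_simp) ξ
  rw [mul_assoc]
  calc s * (c * ∑ k, ‖ξ k‖ ^ 2) ≤ s * ∫ u in (-Real.pi)..Real.pi,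
        ‖∑ k, ξ k * Complex.exp (((Λ (κ k) * s : ℝ) : ℂ) * u * Complex.I)‖ ^ 2 := by gcongr
    _ = s * ∫ u in (-Real.pi)..Real.pi, (fun v : ℝ =>
        ‖∑ k, ξ k * Complex.exp (Λ (κ k) * v * Complex.I)‖ ^ 2) (s * u) := by
        congr 1
        apply intervalIntegral.integral_congr
        intro u _
        simp only
        push_cast
        simp only [mul_assoc]
    _ = _ := by
        have e : s * Real.pi = a := by rw [hs]; field_simp
        have h := intervalIntegral.smul_integral_comp_mul_left (a := -Real.pi) (b := Real.pi)
          (fun v : ℝ => ‖∑ k, ξ k * Complex.exp (Λ (κ k) * v * Complex.I)‖ ^ 2) s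
        rw [smul_eq_mul] at h
        refine h.trans ?_
        rw [mul_neg, e]

theorem SPD_disc {α : Type*} [MeasurableSpace α] (μ : Measure α) [IsProbabilityMeasure μ]
    (H : α → α → ℝ) (hm : Measurable (Function.uncurry H)) (C : ℝ) (hb : ∀ w v, |H w v| ≤ C)
    (hp : ∀ (N : ℕ) (w : Fin N → α), 0 ≤ ∑ a, ∑ b, H (w a) (w b)) :
    0 ≤ ∫ p, Function.uncurry H p ∂(μ.prod μ) := by
  set J := ∫ p, Function.uncurry H p ∂(μ.prod μ) with hJ
  have key : ∀ N : ℕ, 0 ≤ N * C + N * (N - 1) * J := by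
    intro N
    let P : Measure (Fin N → α) := Measure.pi (fun _ => μ)
    have hmab : ∀ a b : Fin N, Measurable (fun w : Fin N → α => H (w a) (w b)) := fun a b => by
      have h := hm.comp ((measurable_pi_apply (X := fun _ : Fin N => α) a).prodMk
        (measurable_pi_apply (X := fun _ : Fin N => α) b))
      exact h
    have hintg : ∀ a b : Fin N, Integrable (fun w : Fin N → α => H (w a) (w b)) P := fun a b =>
      Integrable.of_bound (hmab a b).aestronglyMeasurable C
        (Eventually.of_forall fun w => hb _ _)
    have h0 : 0 ≤ ∫ w, ∑ a, ∑ b, H (w a) (w b) ∂P := integral_nonneg fun w => hp N w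
    rw [integral_finsetSum _ (fun a _ => integrable_finsetSum _ fun b _ => hintg a b)] at h0
    simp_rw [integral_finsetSum _ (fun b _ => hintg _ b)] at h0
    have hoff : ∀ a b : Fin N, a ≠ b → ∫ w, H (w a) (w b) ∂P = J := by
      intro a b hab
      have hi : ProbabilityTheory.iIndepFun (fun (i : Fin N) (w : Fin N → α) => w i) P := by
        exact ProbabilityTheory.iIndepFun_pi (μ := fun _ : Fin N => μ) (X := fun _ x => x)
          (fun i => aemeasurable_id)
      have h2 := (ProbabilityTheory.indepFun_iff_map_prod_eq_prod_map_map
        (measurable_pi_apply a).aemeasurable (measurable_pi_apply b).aemeasurable).1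
        (hi.indepFun hab)
      have ea : ∀ a : Fin N, P.map (fun w => w a) = μ := fun a =>
        (measurePreserving_eval (fun _ : Fin N => μ) a).map_eq
      rw [ea, ea] at h2
      rw [hJ, ← h2, integral_map]
      · rfl
      · exact ((measurable_pi_apply a).prodMk (measurable_pi_apply b)).aemeasurable
      · exact hm.aestronglyMeasurable
    have hdiag : ∀ a : Fin N, ∫ w, H (w a) (w a) ∂P ≤ C := by
      intro a
      have := norm_integral_le_of_norm_le_const (μ := P) (f := fun w => H (w a) (w a)) (C := C)
        (Eventually.of_forall fun w => hb _ _)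
      simp at this
      exact (le_abs_self _).trans this
    have h3 : ∀ a : Fin N, ∑ b, ∫ w, H (w a) (w b) ∂P ≤ C + (N - 1) * J := by
      intro a
      rw [← Finset.add_sum_erase _ _ (Finset.mem_univ a)]
      have : ∑ b ∈ Finset.univ.erase a, ∫ w, H (w a) (w b) ∂P
          = ∑ b ∈ Finset.univ.erase a, J :=
        Finset.sum_congr rfl fun b hb => hoff a b (Finset.ne_of_mem_erase hb).symm
      rw [this, Finset.sum_const, Finset.card_erase_of_mem (Finset.mem_univ a), Finset.card_univ,
        Fintype.card_fin, nsmul_eq_mul]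
      have hN : 1 ≤ N := by have := a.2; omega
      push_cast [hN]
      linarith [hdiag a]
    refine h0.trans ((Finset.sum_le_sum fun a _ => h3 a).trans (le_of_eq ?_))
    simp
    ring
  by_contra hneg
  push Not at hneg
  obtain ⟨N, hN⟩ := exists_nat_gt (C / (-J) + 1)
  have hN1 : C / (-J) < N - 1 := by linarith
  rw [div_lt_iff₀ (by linarith)] at hN1
  have hC : 0 ≤ C := by
    obtain ⟨w⟩ : Nonempty α := by
      by_contra h
      rw [not_nonempty_iff] at h
      have := measure_univ (μ := μ)
      simp [Measure.eq_zero_of_isEmpty] at this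
    exact (abs_nonneg _).trans (hb w w)
  have hNp : (0 : ℝ) < N := by
    have : 0 ≤ C / (-J) := div_nonneg hC (by linarith)
    linarith
  have := key N
  nlinarith

theorem SPD_gauss_int (b : ℝ) (hb : 0 < b) : Integrable (fun w : ℂ => Real.exp (-b * ‖w‖ ^ 2)) := by
  have h := (GaussianFourier.integrable_cexp_neg_mul_sq_norm_add (V := ℂ) (b := (b : ℂ))
    (by simpa using hb) 0 0).norm
  refine h.congr (Eventually.of_forall fun w => ?_)
  simp only [Complex.norm_exp]
  simp [← Complex.ofReal_pow]

theorem SPD_gauss_pos (b : ℝ) (hb : 0 < b) : 0 < ∫ w : ℂ, Real.exp (-b * ‖w‖ ^ 2) :=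
  integral_exp_pos (SPD_gauss_int b hb)

theorem SPD_pd_gauss (g : ℂ → ℝ) (hg : Continuous g) (C : ℝ) (hb : ∀ w, |g w| ≤ C)
    (hp : ∀ (N : ℕ) (w : Fin N → ℂ), 0 ≤ ∑ a, ∑ b, g (w a - w b)) (ε : ℝ) (hε : 0 < ε) :
    0 ≤ ∫ s : ℂ, g s * Real.exp (-ε * ‖s‖ ^ 2) := by
  set Z := ∫ w : ℂ, Real.exp (-(2 * ε) * ‖w‖ ^ 2) with hZ
  have hZ0 : 0 < Z := SPD_gauss_pos _ (by positivity)
  let ρ : ℂ → ℝ := fun w => Real.exp (-(2 * ε) * ‖w‖ ^ 2) / Z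
  have hρ0 : ∀ w, 0 ≤ ρ w := fun w => by positivity
  have hρc : Continuous ρ := by fun_prop
  have hρi : Integrable ρ := (SPD_gauss_int _ (by positivity)).div_const _
  let μ : Measure ℂ := volume.withDensity (fun w => ENNReal.ofReal (ρ w))
  have hμint : ∀ h : ℂ → ℝ, ∫ w, h w ∂μ = ∫ w, ρ w * h w := by
    intro h
    rw [integral_withDensity_eq_integral_toReal_smul (by fun_prop)
      (Eventually.of_forall fun _ => ENNReal.ofReal_lt_top)]
    simp [ENNReal.toReal_ofReal (hρ0 _)]
  have : IsProbabilityMeasure μ := by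
    constructor
    rw [withDensity_apply _ MeasurableSet.univ, Measure.restrict_univ,
      ← ofReal_integral_eq_lintegral_ofReal hρi (Eventually.of_forall hρ0)]
    simp only [ρ, integral_div]
    rw [← hZ, div_self hZ0.ne']; simp
  have h := SPD_disc μ (fun w v => g (w - v)) (by
    exact (show Continuous (fun p : ℂ × ℂ => g (p.1 - p.2)) by fun_prop).measurable) C
    (fun _ _ => hb _) hp
  rw [integral_prod_symm] at h
  swap
  · exact Integrable.of_bound
      (show Continuous (fun p : ℂ × ℂ => g (p.1 - p.2)) by fun_prop).aestronglyMeasurable C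
      (Eventually.of_forall fun w => hb _)
  simp only [Function.uncurry, hμint] at h
  -- h : 0 ≤ ∫ v, ρ v * ∫ w, ρ w * g (w - v)
  have e1 : ∀ v, ρ v * ∫ w, ρ w * g (w - v) = ∫ s, ρ v * (ρ (s + v) * g s) := by
    intro v
    rw [← integral_const_mul,
      ← integral_add_right_eq_self (μ := (volume : Measure ℂ))
        (fun w => ρ v * (ρ w * g (w - v))) v]
    simp
  simp_rw [e1] at h
  rw [integral_integral_swap] at h
  swap
  · have hi : Integrable (fun p : ℂ × ℂ => ρ p.1 * ρ p.2) (volume.prod volume) := hρi.mul_prod hρi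
    have hmp : MeasurePreserving (fun p : ℂ × ℂ => (p.1, p.2 + p.1)) (volume.prod volume)
        (volume.prod volume) := measurePreserving_prod_add_right volume volume
    have hi2 := hmp.integrable_comp_of_integrable hi
    refine (hi2.mul_const C).mono' (by
      refine Continuous.aestronglyMeasurable ?_
      simp only [Function.uncurry_def]; fun_prop) (Eventually.of_forall fun p => ?_)
    simp only [Function.uncurry, Function.comp, norm_mul, Real.norm_eq_abs, abs_of_nonneg (hρ0 _)]
    rw [← mul_assoc]
    exact mul_le_mul_of_nonneg_left (hb _) (mul_nonneg (hρ0 _) (hρ0 _))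
  set K := ∫ w : ℂ, Real.exp (-(4 * ε) * ‖w‖ ^ 2) with hK
  have hK0 : 0 < K := SPD_gauss_pos _ (by positivity)
  have e2 : ∀ s, ∫ v, ρ v * (ρ (s + v) * g s) = (K / Z ^ 2) * (g s * Real.exp (-ε * ‖s‖ ^ 2)) := by
    intro s
    have : ∀ v, ρ v * (ρ (s + v) * g s) =
        (g s * Real.exp (-ε * ‖s‖ ^ 2) / Z ^ 2) * Real.exp (-(4 * ε) * ‖v + s / 2‖ ^ 2) := by
      intro v
      have hexp : Real.exp (-(2 * ε) * ‖v‖ ^ 2) * Real.exp (-(2 * ε) * ‖s + v‖ ^ 2)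
          = Real.exp (-ε * ‖s‖ ^ 2) * Real.exp (-(4 * ε) * ‖v + s / 2‖ ^ 2) := by
        rw [← Real.exp_add, ← Real.exp_add]
        congr 1
        simp only [← Complex.normSq_eq_norm_sq, Complex.normSq_apply]
        simp
        ring
      simp only [ρ]
      calc _ = (Real.exp (-(2 * ε) * ‖v‖ ^ 2) * Real.exp (-(2 * ε) * ‖s + v‖ ^ 2)) * g s / Z ^ 2 := by
            field_simp
        _ = _ := by rw [hexp]; ring
    simp_rw [this]
    rw [integral_const_mul, integral_add_right_eq_self (μ := (volume : Measure ℂ))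
        (fun w => Real.exp (-(4 * ε) * ‖w‖ ^ 2))]
    ring
  simp_rw [e2] at h
  rw [integral_const_mul] at h
  exact nonneg_of_mul_nonneg_right h (by positivity)

def SPD_A (G : ℂ → ℝ) (ε : ℝ) (z : ℂ) : ℝ :=
  ∫ s : ℂ, G s * Real.exp (-ε * ‖s‖ ^ 2) * Real.cos ⟪s, z⟫

def SPD_Psi (G : ℂ → ℝ) (x : ℂ) (β ε : ℝ) : ℝ :=
  ∫ t : ℂ, G (x + Real.sqrt β * t) * Real.exp (-ε * ‖x + Real.sqrt β * t‖ ^ 2)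
    * Real.exp (-(1 / 4) * ‖t‖ ^ 2)

theorem SPD_A_int (G : ℂ → ℝ) (hG : Continuous G) (C : ℝ) (hb : ∀ w, |G w| ≤ C) (ε : ℝ)
    (hε : 0 < ε) : Integrable (fun s : ℂ => G s * Real.exp (-ε * ‖s‖ ^ 2)) := by
  refine ((SPD_gauss_int ε hε).const_mul C).mono' (by fun_prop) (Eventually.of_forall fun s => ?_)
  rw [norm_mul, Real.norm_eq_abs, Real.norm_eq_abs, Real.abs_exp]
  exact mul_le_mul_of_nonneg_right (hb s) (Real.exp_pos _).le

theorem SPD_A_int2 (G : ℂ → ℝ) (hG : Continuous G) (C : ℝ) (hb : ∀ w, |G w| ≤ C) (ε : ℝ)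
    (hε : 0 < ε) (z : ℂ) :
    Integrable (fun s : ℂ => G s * Real.exp (-ε * ‖s‖ ^ 2) * Real.cos ⟪s, z⟫) := by
  refine (SPD_A_int G hG C hb ε hε).norm.mono' (by fun_prop) (Eventually.of_forall fun s => ?_)
  rw [norm_mul _ (Real.cos _)]
  exact mul_le_of_le_one_right (norm_nonneg _) (Real.abs_cos_le_one _)

theorem SPD_A_cont (G : ℂ → ℝ) (hG : Continuous G) (C : ℝ) (hb : ∀ w, |G w| ≤ C) (ε : ℝ)
    (hε : 0 < ε) : Continuous (SPD_A G ε) := by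
  unfold SPD_A
  refine continuous_of_dominated (bound := fun s => ‖G s * Real.exp (-ε * ‖s‖ ^ 2)‖) ?_ ?_ ?_ ?_
  · intro z; fun_prop
  · intro z; refine Eventually.of_forall fun s => ?_
    rw [norm_mul _ (Real.cos _)]
    exact mul_le_of_le_one_right (norm_nonneg _) (Real.abs_cos_le_one _)
  · exact (SPD_A_int G hG C hb ε hε).norm
  · refine Eventually.of_forall fun s => ?_; fun_prop

theorem SPD_A_bound (G : ℂ → ℝ) (hG : Continuous G) (C : ℝ) (hb : ∀ w, |G w| ≤ C) (ε : ℝ)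
    (hε : 0 < ε) : ∃ B : ℝ, ∀ z, |SPD_A G ε z| ≤ B := by
  refine ⟨∫ s : ℂ, ‖G s * Real.exp (-ε * ‖s‖ ^ 2)‖, fun z => ?_⟩
  rw [SPD_A, ← Real.norm_eq_abs]
  refine norm_integral_le_of_norm_le (SPD_A_int G hG C hb ε hε).norm
    (Eventually.of_forall fun s => ?_)
  rw [norm_mul _ (Real.cos _)]
  exact mul_le_of_le_one_right (norm_nonneg _) (Real.abs_cos_le_one _)

theorem SPD_A_radial (G : ℂ → ℝ) (hr : ∀ s t : ℂ, ‖s‖ = ‖t‖ → G s = G t) (ε : ℝ) (z : ℂ) :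
    SPD_A G ε z = SPD_A G ε (‖z‖ : ℂ) := by
  obtain ⟨u, hu⟩ : ∃ u : Circle, (rotation u) (‖z‖ : ℂ) = z := by
    exact ⟨Circle.exp z.arg, by
      rw [rotation_apply, Circle.coe_exp, mul_comm, Complex.norm_mul_exp_arg_mul_I]⟩
  unfold SPD_A
  rw [← (rotation u).measurePreserving.integral_comp
    (rotation u).toHomeomorph.measurableEmbedding]
  refine integral_congr_ae (Eventually.of_forall fun s => ?_)
  simp only
  rw [hr (rotation u s) s ((rotation u).norm_map s), (rotation u).norm_map s]
  congr 2
  rw [← (rotation u).inner_map_map s, hu]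

theorem SPD_gauss_cos (β : ℝ) (hβ : 0 < β) (y : ℂ) :
    ∫ z : ℂ, Real.exp (-β * ‖z‖ ^ 2) * Real.cos ⟪y, z⟫
      = Real.pi / β * Real.exp (-‖y‖ ^ 2 / (4 * β)) := by
  have h := GaussianFourier.integral_cexp_neg_mul_sq_norm_add (V := ℂ) (b := (β : ℂ))
    (by simpa using hβ) Complex.I y
  have hi := GaussianFourier.integrable_cexp_neg_mul_sq_norm_add (V := ℂ) (b := (β : ℂ))
    (by simpa using hβ) Complex.I y
  have h2 := congrArg Complex.re h
  rw [← RCLike.re_eq_complex_re, ← integral_re hi] at h2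
  have e : ∀ z : ℂ, RCLike.re (Complex.exp (-β * ‖z‖ ^ 2 + Complex.I * (⟪y, z⟫ : ℝ)))
      = Real.exp (-β * ‖z‖ ^ 2) * Real.cos ⟪y, z⟫ := by
    intro z
    rw [RCLike.re_eq_complex_re, Complex.exp_re]
    simp [← Complex.ofReal_pow]
  simp_rw [e] at h2
  rw [h2, Complex.finrank_real_complex]
  have : (((2 : ℕ) : ℂ) / 2) = 1 := by norm_num
  rw [this, Complex.cpow_one, Complex.I_sq]
  rw [RCLike.re_eq_complex_re, show (Real.pi : ℂ) / β * Complex.exp (-1 * (‖y‖ : ℂ) ^ 2 / (4 * β)) =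
    ((Real.pi / β * Real.exp (-‖y‖ ^ 2 / (4 * β)) : ℝ) : ℂ) by push_cast; ring_nf]
  exact Complex.ofReal_re _

theorem SPD_Psi_eq (G : ℂ → ℝ) (x : ℂ) (β ε : ℝ) (hβ : 0 < β) :
    SPD_Psi G x β ε = (1 / β) * ∫ s : ℂ, G s * Real.exp (-ε * ‖s‖ ^ 2)
      * Real.exp (-‖x - s‖ ^ 2 / (4 * β)) := by
  have hs : 0 < Real.sqrt β := Real.sqrt_pos.2 hβ
  rw [← integral_add_left_eq_self (μ := (volume : Measure ℂ)) _ x]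
  have h := Measure.integral_comp_smul (volume : Measure ℂ) (fun s : ℂ =>
    G (x + s) * Real.exp (-ε * ‖x + s‖ ^ 2) * Real.exp (-‖x - (x + s)‖ ^ 2 / (4 * β))) (Real.sqrt β)
  rw [Complex.finrank_real_complex, Real.sq_sqrt hβ.le, abs_of_pos (by positivity), smul_eq_mul,
    inv_eq_one_div] at h
  rw [← h]
  unfold SPD_Psi
  refine integral_congr_ae (Eventually.of_forall fun t => ?_)
  simp only [Complex.real_smul]
  congr 2
  rw [sub_add_cancel_left, norm_neg, norm_mul, mul_pow, Complex.norm_real, Real.norm_eq_abs, sq_abs,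
    Real.sq_sqrt hβ.le]
  field_simp

theorem SPD_A_gauss (G : ℂ → ℝ) (hG : Continuous G) (C : ℝ) (hb : ∀ w, |G w| ≤ C)
    (hev : ∀ s, G (-s) = G s) (ε β : ℝ) (hε : 0 < ε) (hβ : 0 < β) (x : ℂ) :
    ∫ z : ℂ, Real.exp (-β * ‖z‖ ^ 2) * Real.cos ⟪x, z⟫ * SPD_A G ε z
      = Real.pi * SPD_Psi G x β ε := by
  have hAi := SPD_A_int G hG C hb ε hε
  have h1 : ∀ z : ℂ, Real.exp (-β * ‖z‖ ^ 2) * Real.cos ⟪x, z⟫ * SPD_A G ε z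
      = ∫ s : ℂ, (G s * Real.exp (-ε * ‖s‖ ^ 2)) *
        (Real.exp (-β * ‖z‖ ^ 2) * Real.cos ⟪x, z⟫ * Real.cos ⟪s, z⟫) := by
    intro z
    rw [SPD_A, ← integral_const_mul]
    refine integral_congr_ae (Eventually.of_forall fun s => ?_)
    simp only; ring
  simp_rw [h1]
  rw [integral_integral_swap]
  swap
  · have := ((SPD_gauss_int β hβ).mul_prod hAi.norm)
    refine this.mono' (by
      refine Continuous.aestronglyMeasurable ?_
      simp only [Function.uncurry_def]; fun_prop) (Eventually.of_forall fun p => ?_)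
    simp only [Function.uncurry]
    rw [norm_mul, mul_comm]
    refine mul_le_mul_of_nonneg_right ?_ (norm_nonneg _)
    rw [norm_mul, norm_mul, Real.norm_eq_abs, Real.norm_eq_abs, Real.norm_eq_abs, Real.abs_exp]
    refine (mul_le_of_le_one_right (by positivity) (Real.abs_cos_le_one _)).trans
      (mul_le_of_le_one_right (by positivity) (Real.abs_cos_le_one _))
  have hci : ∀ y : ℂ, Integrable (fun z : ℂ => Real.exp (-β * ‖z‖ ^ 2) * Real.cos ⟪y, z⟫) := by
    intro y
    refine (SPD_gauss_int β hβ).mono' (by fun_prop) (Eventually.of_forall fun z => ?_)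
    rw [norm_mul, Real.norm_eq_abs, Real.norm_eq_abs, Real.abs_exp]
    exact mul_le_of_le_one_right (by positivity) (Real.abs_cos_le_one _)
  let E : ℂ → ℝ := fun y => Real.exp (-‖y‖ ^ 2 / (4 * β))
  have h2 : ∀ s : ℂ, ∫ z : ℂ, (G s * Real.exp (-ε * ‖s‖ ^ 2)) *
        (Real.exp (-β * ‖z‖ ^ 2) * Real.cos ⟪x, z⟫ * Real.cos ⟪s, z⟫)
      = (Real.pi / β / 2) * (G s * Real.exp (-ε * ‖s‖ ^ 2) * E (x - s)) +
        (Real.pi / β / 2) * (G s * Real.exp (-ε * ‖s‖ ^ 2) * E (x + s)) := by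
    intro s
    rw [integral_const_mul]
    have : ∀ z : ℂ, Real.exp (-β * ‖z‖ ^ 2) * Real.cos ⟪x, z⟫ * Real.cos ⟪s, z⟫
        = (1 / 2) * (Real.exp (-β * ‖z‖ ^ 2) * Real.cos ⟪x - s, z⟫
          + Real.exp (-β * ‖z‖ ^ 2) * Real.cos ⟪x + s, z⟫) := by
      intro z
      rw [inner_sub_left, inner_add_left, Real.cos_sub, Real.cos_add]
      ring
    simp_rw [this]
    rw [integral_const_mul, integral_add (hci _) (hci _), SPD_gauss_cos β hβ, SPD_gauss_cos β hβ]
    simp only [E]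
    ring
  simp_rw [h2]
  have hEi : ∀ φ : ℂ → ℂ, Continuous φ → Integrable (fun s : ℂ =>
      (Real.pi / β / 2) * (G s * Real.exp (-ε * ‖s‖ ^ 2) * E (φ s))) := by
    intro φ hφ
    refine Integrable.const_mul ?_ _
    refine hAi.norm.mono' (Continuous.aestronglyMeasurable (by simp only [E]; fun_prop))
      (Eventually.of_forall fun s => ?_)
    rw [norm_mul _ (E _)]
    refine mul_le_of_le_one_right (norm_nonneg _) ?_
    rw [Real.norm_eq_abs, Real.abs_exp, Real.exp_le_one_iff]
    rw [neg_div]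
    have : 0 ≤ ‖φ s‖ ^ 2 / (4 * β) := by positivity
    linarith
  rw [integral_add (hEi _ (by fun_prop)) (hEi _ (by fun_prop))]
  have h3 : ∫ s : ℂ, (Real.pi / β / 2) * (G s * Real.exp (-ε * ‖s‖ ^ 2) * E (x + s))
      = ∫ s : ℂ, (Real.pi / β / 2) * (G s * Real.exp (-ε * ‖s‖ ^ 2) * E (x - s)) := by
    rw [← integral_neg_eq_self]
    refine integral_congr_ae (Eventually.of_forall fun s => ?_)
    simp only [hev, norm_neg, sub_eq_add_neg]
  rw [h3, integral_const_mul, SPD_Psi_eq G x β ε hβ]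
  simp only [E]
  ring

theorem SPD_Psi_tendsto (G : ℂ → ℝ) (hG : Continuous G) (C : ℝ) (hb : ∀ w, |G w| ≤ C)
    (x : ℂ) (b : ℝ) :
    Tendsto (fun ε => SPD_Psi G x (b + ε) ε) (nhdsWithin 0 (Set.Ioi 0)) (nhds (SPD_Psi G x b 0)) := by
  unfold SPD_Psi
  refine tendsto_integral_filter_of_dominated_convergence
    (fun t => C * Real.exp (-(1 / 4) * ‖t‖ ^ 2)) ?_ ?_ ?_ ?_
  · refine Eventually.of_forall fun ε => ?_; fun_prop
  · filter_upwards [self_mem_nhdsWithin] with ε hε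
    refine Eventually.of_forall fun t => ?_
    rw [norm_mul, norm_mul, Real.norm_eq_abs, Real.norm_eq_abs, Real.norm_eq_abs, Real.abs_exp,
      Real.abs_exp]
    refine mul_le_mul_of_nonneg_right ?_ (Real.exp_pos _).le
    refine (mul_le_of_le_one_right (abs_nonneg _) ?_).trans (hb _)
    rw [Real.exp_le_one_iff]
    have : 0 ≤ ε * ‖x + Real.sqrt (b + ε) * t‖ ^ 2 := mul_nonneg (le_of_lt hε) (by positivity)
    linarith
  · exact (SPD_gauss_int _ (by norm_num)).const_mul C
  · refine Eventually.of_forall fun t => ?_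
    have hc : Continuous (fun ε : ℝ => G (x + Real.sqrt (b + ε) * t) *
      Real.exp (-ε * ‖x + Real.sqrt (b + ε) * t‖ ^ 2) * Real.exp (-(1 / 4) * ‖t‖ ^ 2)) := by fun_prop
    have := (hc.tendsto 0).mono_left (nhdsWithin_le_nhds (s := Set.Ioi 0))
    simpa using this

theorem SPD_Psi_cont (G : ℂ → ℝ) (hG : Continuous G) (C : ℝ) (hb : ∀ w, |G w| ≤ C)
    (x : ℂ) : Continuous (fun b => SPD_Psi G x b 0) := by
  unfold SPD_Psi
  refine continuous_of_dominated (bound := fun t => C * Real.exp (-(1 / 4) * ‖t‖ ^ 2)) ?_ ?_ ?_ ?_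
  · intro b; fun_prop
  · intro b; refine Eventually.of_forall fun t => ?_
    rw [norm_mul, norm_mul]
    simp only [neg_zero, zero_mul, Real.exp_zero, norm_one, mul_one]
    rw [Real.norm_eq_abs, Real.norm_eq_abs, Real.abs_exp]
    exact mul_le_mul_of_nonneg_right (hb _) (Real.exp_pos _).le
  · exact (SPD_gauss_int _ (by norm_num)).const_mul C
  · refine Eventually.of_forall fun t => ?_; fun_prop

theorem SPD_Psi_zero (G : ℂ → ℝ) (x : ℂ) : SPD_Psi G x 0 0 = 4 * Real.pi * G x := by
  have h := SPD_gauss_cos (1 / 4) (by norm_num) 0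
  simp at h
  unfold SPD_Psi
  simp
  rw [integral_const_mul, h]
  ring

theorem SPD_Psi_lt (G : ℂ → ℝ) (hG : Continuous G) (hb : ∀ w, |G w| ≤ G 0) (w0 : ℂ)
    (hw0 : G w0 < G 0) : SPD_Psi G 0 1 0 < SPD_Psi G 0 0 0 := by
  have hi : ∀ b : ℝ, Integrable (fun t : ℂ => G (0 + Real.sqrt b * t) *
      Real.exp (-0 * ‖0 + Real.sqrt b * t‖ ^ 2) * Real.exp (-(1 / 4) * ‖t‖ ^ 2)) := by
    intro b
    have := SPD_A_int (fun t : ℂ => G (0 + Real.sqrt b * t)) (by fun_prop) (G 0)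
      (fun w => hb _) (1 / 4) (by norm_num)
    refine this.congr (Eventually.of_forall fun t => ?_)
    simp
  unfold SPD_Psi
  rw [← sub_pos, ← integral_sub (hi 0) (hi 1)]
  have hc : Continuous (fun t : ℂ => (G 0 - G t) * Real.exp (-(1 / 4) * ‖t‖ ^ 2)) := by fun_prop
  have e : (fun a : ℂ => G (0 + Real.sqrt 0 * a) *
      Real.exp (-0 * ‖0 + Real.sqrt 0 * a‖ ^ 2) * Real.exp (-(1 / 4) * ‖a‖ ^ 2) -
      G (0 + Real.sqrt 1 * a) *
      Real.exp (-0 * ‖0 + Real.sqrt 1 * a‖ ^ 2) * Real.exp (-(1 / 4) * ‖a‖ ^ 2)) =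
      fun t : ℂ => (G 0 - G t) * Real.exp (-(1 / 4) * ‖t‖ ^ 2) := by
    ext t; simp; ring
  have hi2 := (hi 0).sub (hi 1)
  rw [show ((fun a : ℂ => G (0 + Real.sqrt 0 * a) *
      Real.exp (-0 * ‖0 + Real.sqrt 0 * a‖ ^ 2) * Real.exp (-(1 / 4) * ‖a‖ ^ 2)) -
      fun a : ℂ => G (0 + Real.sqrt 1 * a) *
      Real.exp (-0 * ‖0 + Real.sqrt 1 * a‖ ^ 2) * Real.exp (-(1 / 4) * ‖a‖ ^ 2)) =
      fun t : ℂ => (G 0 - G t) * Real.exp (-(1 / 4) * ‖t‖ ^ 2) from e] at hi2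
  rw [e]
  refine integral_pos_of_integrable_nonneg_nonzero (x := w0) hc hi2 ?_ ?_
  · intro t
    exact mul_nonneg (sub_nonneg.2 ((le_abs_self _).trans (hb t))) (Real.exp_pos _).le
  · exact (mul_pos (sub_pos.2 hw0) (Real.exp_pos _)).ne'

theorem SPD_real_normsq {m : ℕ} (η : Fin m → ℝ) (l : Fin m → ℝ) (u : ℝ) :
    ‖∑ k, (η k : ℂ) * Complex.exp (l k * u * Complex.I)‖ ^ 2
      = ∑ k, ∑ j, η k * η j * Real.cos ((l k - l j) * u) := by
  have hre : (∑ k, (η k : ℂ) * Complex.exp (l k * u * Complex.I)).re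
      = ∑ k, η k * Real.cos (l k * u) := by
    rw [Complex.re_sum]
    refine Finset.sum_congr rfl fun k _ => ?_
    rw [Complex.re_ofReal_mul, ← Complex.ofReal_mul, Complex.exp_ofReal_mul_I_re]
  have him : (∑ k, (η k : ℂ) * Complex.exp (l k * u * Complex.I)).im
      = ∑ k, η k * Real.sin (l k * u) := by
    rw [Complex.im_sum]
    refine Finset.sum_congr rfl fun k _ => ?_
    rw [Complex.im_ofReal_mul, ← Complex.ofReal_mul, Complex.exp_ofReal_mul_I_im]
  rw [← Complex.normSq_eq_norm_sq, Complex.normSq_apply, hre, him, Finset.sum_mul_sum,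
    Finset.sum_mul_sum, ← Finset.sum_add_distrib]
  refine Finset.sum_congr rfl fun k _ => ?_
  rw [← Finset.sum_add_distrib]
  refine Finset.sum_congr rfl fun j _ => ?_
  rw [sub_mul, Real.cos_sub]; ring

theorem SPD_psd_factor {m : ℕ} (A : Fin m → Fin m → ℝ) (hs : ∀ k j, A k j = A j k)
    (hp : ∀ c : Fin m → ℝ, 0 ≤ ∑ k, ∑ j, c k * c j * A k j) :
    ∃ B : Fin m → Fin m → ℝ, ∀ k j, A k j = ∑ l, B l k * B l j := by
  have h : (Matrix.of A).PosSemidef := by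
    refine Matrix.PosSemidef.of_dotProduct_mulVec_nonneg ?_ ?_
    · ext k j; simp [Matrix.conjTranspose_apply, hs j k]
    · intro c
      refine (hp c).trans (le_of_eq ?_)
      simp only [dotProduct, Matrix.mulVec, Finset.mul_sum, Matrix.of_apply, Pi.star_apply,
        star_trivial]
      refine Finset.sum_congr rfl fun k _ => Finset.sum_congr rfl fun j _ => ?_
      ring
  obtain ⟨B, hB⟩ : ∃ B : Matrix (Fin m) (Fin m) ℝ, Matrix.of A = B.conjTranspose * B := by
    open scoped MatrixOrder in
    exact CStarAlgebra.nonneg_iff_eq_star_mul_self.mp h.nonneg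
  refine ⟨fun l k => B l k, fun k j => ?_⟩
  have := congrFun (congrFun hB k) j
  simpa [Matrix.mul_apply] using this

theorem SPD_W {m : ℕ} (A : Fin m → Fin m → ℝ) (hs : ∀ k j, A k j = A j k)
    (hp : ∀ c : Fin m → ℝ, 0 ≤ ∑ k, ∑ j, c k * c j * A k j) (l : Fin m → ℝ) (a c : ℝ) (ha : 0 < a)
    (hI : ∀ η : Fin m → ℂ, c * ∑ k, ‖η k‖ ^ 2
      ≤ ∫ u in (-a)..a, ‖∑ k, η k * Complex.exp (l k * u * Complex.I)‖ ^ 2)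
    (ξ : Fin m → ℝ) :
    (∀ u, 0 ≤ ∑ k, ∑ j, ξ k * ξ j * A k j * Real.cos ((l k - l j) * u)) ∧
    c * ∑ k, ξ k ^ 2 * A k k ≤
      ∫ u in (-a)..a, ∑ k, ∑ j, ξ k * ξ j * A k j * Real.cos ((l k - l j) * u) := by
  obtain ⟨B, hB⟩ := SPD_psd_factor A hs hp
  have e : ∀ u, ∑ k, ∑ j, ξ k * ξ j * A k j * Real.cos ((l k - l j) * u)
      = ∑ i, ‖∑ k, ((B i k * ξ k : ℝ) : ℂ) * Complex.exp (l k * u * Complex.I)‖ ^ 2 := by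
    intro u
    simp_rw [SPD_real_normsq, hB, Finset.mul_sum, Finset.sum_mul]
    symm
    rw [Finset.sum_comm]
    refine Finset.sum_congr rfl fun k _ => ?_
    rw [Finset.sum_comm]
    refine Finset.sum_congr rfl fun j _ => Finset.sum_congr rfl fun i _ => ?_
    ring
  constructor
  · intro u; rw [e]; positivity
  · simp_rw [e]
    rw [intervalIntegral.integral_finsetSum]
    swap
    · intro i _
      exact Continuous.intervalIntegrable (by fun_prop) _ _
    refine le_trans (le_of_eq ?_) (Finset.sum_le_sum fun i _ => hI _)
    simp only [Complex.norm_real, Real.norm_eq_abs, sq_abs, hB, Finset.mul_sum]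
    rw [Finset.sum_comm]
    refine Finset.sum_congr rfl fun k _ => Finset.sum_congr rfl fun j _ => ?_
    ring

theorem SPD_angular (W : ℝ → ℝ) (hW : Continuous W) (h0 : ∀ u, 0 ≤ W u) (a r : ℝ) (ha : 0 < a)
    (har : a ≤ r) :
    ∫ u in (-a)..a, W u ≤ r * ∫ θ in (-Real.pi)..Real.pi, W (r * Real.cos θ) := by
  have hr : 0 < r := ha.trans_le har
  have hi : ∀ p q : ℝ, IntervalIntegrable W volume p q := fun p q => hW.intervalIntegrable _ _
  have hi2 : ∀ p q : ℝ, IntervalIntegrable (fun θ => W (r * Real.cos θ)) volume p q :=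
    fun p q => Continuous.intervalIntegrable (by fun_prop) _ _
  have h1 : ∫ u in (-a)..a, W u ≤ ∫ u in (-r)..r, W u :=
    intervalIntegral.integral_mono_interval (by linarith) (by linarith) har
      (Eventually.of_forall h0) (hi _ _)
  have h2 : ∫ u in (-r)..r, W u = r * ∫ θ in (0 : ℝ)..Real.pi, W (r * Real.cos θ) * Real.sin θ := by
    have := intervalIntegral.integral_comp_mul_deriv (a := 0) (b := Real.pi)
      (f := fun θ => r * Real.cos θ) (f' := fun θ => r * (-Real.sin θ)) (g := W)
      (fun x _ => (Real.hasDerivAt_cos x).const_mul r) (by fun_prop) hW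
    simp only [Real.cos_zero, Real.cos_pi, mul_one, mul_neg, Function.comp] at this
    rw [intervalIntegral.integral_symm, ← this, ← intervalIntegral.integral_neg,
      ← intervalIntegral.integral_const_mul]
    refine intervalIntegral.integral_congr fun θ _ => ?_
    ring
  have h3 : ∫ θ in (0 : ℝ)..Real.pi, W (r * Real.cos θ) * Real.sin θ
      ≤ ∫ θ in (0 : ℝ)..Real.pi, W (r * Real.cos θ) := by
    refine intervalIntegral.integral_mono_on Real.pi_pos.le
      (Continuous.intervalIntegrable (by fun_prop) _ _) (hi2 _ _) fun θ _ => ?_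
    exact mul_le_of_le_one_right (h0 _) (Real.sin_le_one _)
  have h4 : ∫ θ in (0 : ℝ)..Real.pi, W (r * Real.cos θ)
      ≤ ∫ θ in (-Real.pi)..Real.pi, W (r * Real.cos θ) :=
    intervalIntegral.integral_mono_interval (by linarith [Real.pi_pos]) Real.pi_pos.le le_rfl
      (Eventually.of_forall fun θ => h0 _) (hi2 _ _)
  rw [h2] at h1
  exact h1.trans (mul_le_mul_of_nonneg_left (h3.trans h4) hr.le)

theorem SPD_polar_nonneg (V : ℂ → ℝ)
    (h : ∀ r : ℝ, 0 < r → 0 ≤ ∫ θ in (-Real.pi)..Real.pi,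
      V (r * (Real.cos θ + Real.sin θ * Complex.I))) : 0 ≤ ∫ z, V z := by
  rw [← Complex.integral_comp_polarCoord_symm]
  by_cases hi : IntegrableOn (fun p : ℝ × ℝ => p.1 • V (Complex.polarCoord.symm p))
      polarCoord.target
  · rw [polarCoord_target] at hi ⊢
    rw [Measure.volume_eq_prod, setIntegral_prod _ hi]
    refine setIntegral_nonneg measurableSet_Ioi fun r hr => ?_
    simp only [Complex.polarCoord_symm_apply, smul_eq_mul]
    rw [integral_const_mul]
    refine mul_nonneg (le_of_lt hr) ?_
    have := h r hr
    rw [intervalIntegral.integral_of_le (by linarith [Real.pi_pos]), integral_Ioc_eq_integral_Ioo]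
      at this
    exact this
  · rw [integral_undef hi]

theorem SPD_bracket (s S a r : ℝ) (hs : 0 < s) (hS : 0 < S) (ha : 0 < a) (hr : 0 < r) :
    (r < a → Real.exp (-s * r ^ 2) - Real.exp (-S * r ^ 2) - S * a ^ 2 ≤ 0) ∧
    2 * Real.sqrt s * r * (Real.exp (-s * r ^ 2) - Real.exp (-S * r ^ 2) - S * a ^ 2) ≤ 1 := by
  constructor
  · intro h
    have h1 : Real.exp (-s * r ^ 2) ≤ 1 := by
      rw [Real.exp_le_one_iff]; nlinarith [mul_pos hs (pow_pos hr 2)]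
    have h2 := Real.add_one_le_exp (-S * r ^ 2)
    have h3 : S * r ^ 2 ≤ S * a ^ 2 := by gcongr
    linarith
  · have hq : 0 < Real.sqrt s := Real.sqrt_pos.2 hs
    have h1 : 2 * Real.sqrt s * r ≤ Real.exp (s * r ^ 2) := by
      have := Real.add_one_le_exp (s * r ^ 2)
      nlinarith [sq_nonneg (Real.sqrt s * r - 1), Real.sq_sqrt hs.le]
    have h2 : 2 * Real.sqrt s * r * Real.exp (-s * r ^ 2) ≤ 1 := by
      calc _ ≤ Real.exp (s * r ^ 2) * Real.exp (-s * r ^ 2) := by gcongr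
        _ = 1 := by rw [← Real.exp_add]; simp
    refine le_trans ?_ h2
    refine mul_le_mul_of_nonneg_left ?_ (by positivity)
    have := Real.exp_pos (-S * r ^ 2)
    have : 0 ≤ S * a ^ 2 := by positivity
    linarith

theorem SPD_core_eps {m : ℕ} (G : Fin m → Fin m → ℂ → ℝ) (g0 : ℂ → ℝ) (C : ℝ)
    (hg0 : Continuous g0) (hb0 : ∀ w, |g0 w| ≤ C) (hr0 : ∀ s t : ℂ, ‖s‖ = ‖t‖ → g0 s = g0 t)
    (hA0 : ∀ ε > 0, ∀ z, 0 ≤ SPD_A g0 ε z)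
    (hG : ∀ k j, Continuous (G k j)) (hb : ∀ k j w, |G k j w| ≤ C)
    (hr : ∀ k j, ∀ s t : ℂ, ‖s‖ = ‖t‖ → G k j s = G k j t)
    (hd : ∀ k, G k k = g0) (hsym : ∀ k j, G k j = G j k)
    (hp : ∀ (c : Fin m → ℝ) (z : ℂ) (N : ℕ) (w : Fin N → ℂ), 0 ≤ ∑ a, ∑ b,
      (∑ k, ∑ j, c k * c j * G k j (w a - w b)) * Real.cos ⟪w a - w b, z⟫)
    (l : Fin m → ℝ) (a c : ℝ) (ha : 0 < a) (hc : 0 < c)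
    (hI : ∀ η : Fin m → ℂ, c * ∑ k, ‖η k‖ ^ 2
      ≤ ∫ u in (-a)..a, ‖∑ k, η k * Complex.exp (l k * u * Complex.I)‖ ^ 2)
    (ξ : Fin m → ℝ) (s S : ℝ) (hs : 0 < s) (hS : 0 < S) (ε : ℝ) (hε : 0 < ε) :
    (c * (2 * Real.sqrt s) * (∑ k, ξ k ^ 2)) / (2 * Real.pi) *
      (SPD_Psi g0 0 (s + ε) ε - SPD_Psi g0 0 (S + ε) ε - S * a ^ 2 * SPD_Psi g0 0 (0 + ε) ε)
      ≤ ∑ k, ∑ j, ξ k * ξ j * SPD_Psi (G k j) ((l k - l j : ℝ) : ℂ) (0 + ε) ε := by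
  let A : ℂ → Fin m → Fin m → ℝ := fun z k j => SPD_A (G k j) ε z
  have hAsym : ∀ z k j, A z k j = A z j k := fun z k j => by simp only [A]; rw [hsym]
  have hApsd : ∀ z, ∀ c : Fin m → ℝ, 0 ≤ ∑ k, ∑ j, c k * c j * A z k j := by
    intro z c
    have h := SPD_pd_gauss (fun w => (∑ k, ∑ j, c k * c j * G k j w) * Real.cos ⟪w, z⟫)
      (by fun_prop) (∑ k, ∑ j, |c k * c j| * C) (fun w => ?_) (hp c z) ε hε
    · refine h.trans (le_of_eq ?_)
      have e : ∀ w : ℂ, (∑ k, ∑ j, c k * c j * G k j w) * Real.cos ⟪w, z⟫ * Real.exp (-ε * ‖w‖ ^ 2)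
          = ∑ k, ∑ j, c k * c j * (G k j w * Real.exp (-ε * ‖w‖ ^ 2) * Real.cos ⟪w, z⟫) := by
        intro w
        rw [Finset.sum_mul, Finset.sum_mul]
        refine Finset.sum_congr rfl fun k _ => ?_
        rw [Finset.sum_mul, Finset.sum_mul]
        refine Finset.sum_congr rfl fun j _ => ?_
        ring
      simp_rw [e]
      have hi : ∀ k j, Integrable (fun w : ℂ =>
          c k * c j * (G k j w * Real.exp (-ε * ‖w‖ ^ 2) * Real.cos ⟪w, z⟫)) := fun k j =>
        (SPD_A_int2 (G k j) (hG k j) C (hb k j) ε hε z).const_mul _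
      rw [integral_finsetSum _ fun k _ => integrable_finsetSum _ fun j _ => hi k j]
      refine Finset.sum_congr rfl fun k _ => ?_
      rw [integral_finsetSum _ fun j _ => hi k j]
      refine Finset.sum_congr rfl fun j _ => ?_
      rw [integral_const_mul]; rfl
    · rw [abs_mul]
      refine (mul_le_of_le_one_right (abs_nonneg _) (Real.abs_cos_le_one _)).trans ?_
      refine (Finset.abs_sum_le_sum_abs _ _).trans (Finset.sum_le_sum fun k _ => ?_)
      refine (Finset.abs_sum_le_sum_abs _ _).trans (Finset.sum_le_sum fun j _ => ?_)
      rw [abs_mul]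
      exact mul_le_mul_of_nonneg_left (hb k j w) (abs_nonneg _)
  set K := c * (2 * Real.sqrt s) * (∑ k, ξ k ^ 2) with hK
  have hK0 : 0 ≤ K := by positivity
  let br : ℝ → ℝ := fun r => Real.exp (-s * r ^ 2) - Real.exp (-S * r ^ 2) - S * a ^ 2
  let V : ℂ → ℝ := fun z => Real.exp (-ε * ‖z‖ ^ 2) *
    (∑ k, ∑ j, ξ k * ξ j * A z k j * Real.cos ((l k - l j) * z.re))
    - K / (2 * Real.pi) * (Real.exp (-ε * ‖z‖ ^ 2) * SPD_A g0 ε z * br ‖z‖)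
  have hV : 0 ≤ ∫ z, V z := by
    refine SPD_polar_nonneg V fun r hr' => ?_
    have hn : ∀ θ : ℝ, ‖(r * (Real.cos θ + Real.sin θ * Complex.I) : ℂ)‖ = r := by
      intro θ
      rw [norm_mul, Complex.ofReal_cos, Complex.ofReal_sin, ← Complex.exp_mul_I,
        Complex.norm_exp_ofReal_mul_I, Complex.norm_real, Real.norm_eq_abs, abs_of_pos hr', mul_one]
    have hre : ∀ θ : ℝ, (r * (Real.cos θ + Real.sin θ * Complex.I) : ℂ).re = r * Real.cos θ := by
      intro θ
      rw [Complex.re_ofReal_mul, Complex.add_re, Complex.ofReal_re, Complex.re_ofReal_mul]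
      simp
    let W : ℝ → ℝ := fun u => ∑ k, ∑ j, ξ k * ξ j * A (r : ℂ) k j * Real.cos ((l k - l j) * u)
    have eV : ∀ θ : ℝ, V (r * (Real.cos θ + Real.sin θ * Complex.I)) =
        Real.exp (-ε * r ^ 2) * (W (r * Real.cos θ) -
          K / (2 * Real.pi) * (SPD_A g0 ε r * br r)) := by
      intro θ
      have e1 : ∀ k j, A (r * (Real.cos θ + Real.sin θ * Complex.I)) k j = A r k j := by
        intro k j
        simp only [A]
        rw [SPD_A_radial (G k j) (hr k j), hn]
      have e2 : SPD_A g0 ε (r * (Real.cos θ + Real.sin θ * Complex.I)) = SPD_A g0 ε r := by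
        rw [SPD_A_radial g0 hr0, hn]
      simp only [V, W, e1, e2, hn, hre]
      ring
    simp_rw [eV]
    rw [intervalIntegral.integral_const_mul]
    refine mul_nonneg (Real.exp_pos _).le ?_
    have hWc : Continuous W := by fun_prop
    rw [intervalIntegral.integral_sub (Continuous.intervalIntegrable (by fun_prop) _ _)
      (by simp), intervalIntegral.integral_const]
    obtain ⟨hW0, hW1⟩ := SPD_W (A r) (hAsym r) (hApsd r) l a c ha hI ξ
    have hdd : ∀ k, A r k k = SPD_A g0 ε r := fun k => by simp only [A, hd]
    simp only [hdd, ← Finset.sum_mul] at hW1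
    obtain ⟨hb1, hb2⟩ := SPD_bracket s S a r hs hS ha hr'
    have hA0' := hA0 ε hε (r : ℂ)
    have hWint0 : 0 ≤ ∫ θ in (-Real.pi)..Real.pi, W (r * Real.cos θ) :=
      intervalIntegral.integral_nonneg (by linarith [Real.pi_pos]) fun θ _ => hW0 _
    have eK : (Real.pi - -Real.pi) • (K / (2 * Real.pi) * (SPD_A g0 ε r * br r))
        = K * (SPD_A g0 ε r * br r) := by
      rw [smul_eq_mul]
      have := Real.pi_pos
      field_simp
      ring
    rw [eK, sub_nonneg]
    rcases lt_or_ge r a with h | h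
    · refine le_trans ?_ hWint0
      exact mul_nonpos_of_nonneg_of_nonpos hK0 (mul_nonpos_of_nonneg_of_nonpos hA0' (hb1 h))
    · have h5 := SPD_angular W hWc hW0 a r ha h
      have h6 := hW1.trans h5
      refine le_of_mul_le_mul_left ?_ hr'
      refine le_trans ?_ h6
      have h7 : r * (K * (SPD_A g0 ε r * br r)) =
        (c * ((∑ k, ξ k ^ 2) * SPD_A g0 ε r)) * (2 * Real.sqrt s * r * br r) := by
        rw [hK]; ring
      rw [h7]
      exact mul_le_of_le_one_right (by positivity) hb2
  -- integrability
  have hgen : ∀ (g : ℂ → ℝ), Continuous g → (∀ w, |g w| ≤ C) → ∀ (x : ℂ) (β : ℝ), 0 < β →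
      Integrable (fun z : ℂ => Real.exp (-β * ‖z‖ ^ 2) * Real.cos ⟪x, z⟫ * SPD_A g ε z) := by
    intro g hgc hgb x β hβ
    obtain ⟨B, hB⟩ := SPD_A_bound g hgc C hgb ε hε
    have hcont := SPD_A_cont g hgc C hgb ε hε
    refine ((SPD_gauss_int β hβ).mul_const B).mono' (by fun_prop) (Eventually.of_forall fun z => ?_)
    rw [norm_mul, norm_mul, Real.norm_eq_abs, Real.norm_eq_abs, Real.norm_eq_abs, Real.abs_exp]
    refine mul_le_mul (mul_le_of_le_one_right (Real.exp_pos _).le (Real.abs_cos_le_one _)) (hB z)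
      (abs_nonneg _) (Real.exp_pos _).le
  have heven : ∀ g : ℂ → ℝ, (∀ s t : ℂ, ‖s‖ = ‖t‖ → g s = g t) → ∀ w, g (-w) = g w :=
    fun g hg w => hg _ _ (norm_neg w)
  have eV : ∀ z, V z = (∑ k, ∑ j, ξ k * ξ j * (Real.exp (-(0 + ε) * ‖z‖ ^ 2) *
        Real.cos ⟪((l k - l j : ℝ) : ℂ), z⟫ * SPD_A (G k j) ε z))
      - K / (2 * Real.pi) * (Real.exp (-(s + ε) * ‖z‖ ^ 2) * Real.cos ⟪(0 : ℂ), z⟫ * SPD_A g0 ε z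
        - Real.exp (-(S + ε) * ‖z‖ ^ 2) * Real.cos ⟪(0 : ℂ), z⟫ * SPD_A g0 ε z
        - S * a ^ 2 * (Real.exp (-(0 + ε) * ‖z‖ ^ 2) * Real.cos ⟪(0 : ℂ), z⟫ * SPD_A g0 ε z)) := by
    intro z
    simp only [V, br, A]
    congr 1
    · rw [Finset.mul_sum]
      refine Finset.sum_congr rfl fun k _ => ?_
      rw [Finset.mul_sum]
      refine Finset.sum_congr rfl fun j _ => ?_
      have : ⟪((l k - l j : ℝ) : ℂ), z⟫ = (l k - l j) * z.re := by
        rw [Complex.inner]; simp; ring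
      rw [this, zero_add]
      ring
    · simp only [inner_zero_left, Real.cos_zero, mul_one, zero_add]
      rw [show -(s + ε) * ‖z‖ ^ 2 = -ε * ‖z‖ ^ 2 + -s * ‖z‖ ^ 2 by ring,
        show -(S + ε) * ‖z‖ ^ 2 = -ε * ‖z‖ ^ 2 + -S * ‖z‖ ^ 2 by ring, Real.exp_add, Real.exp_add]
      ring
  simp_rw [eV] at hV
  have i1 : ∀ k j, Integrable (fun z : ℂ => ξ k * ξ j * (Real.exp (-(0 + ε) * ‖z‖ ^ 2) *
        Real.cos ⟪((l k - l j : ℝ) : ℂ), z⟫ * SPD_A (G k j) ε z)) := fun k j =>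
    (hgen _ (hG k j) (hb k j) _ _ (by linarith)).const_mul _
  have i2 := hgen g0 hg0 hb0 0 (s + ε) (by linarith)
  have i3 := hgen g0 hg0 hb0 0 (S + ε) (by linarith)
  have i4 := (hgen g0 hg0 hb0 0 (0 + ε) (by linarith)).const_mul (S * a ^ 2)
  have i5 : Integrable (fun z : ℂ =>
      Real.exp (-(s + ε) * ‖z‖ ^ 2) * Real.cos ⟪(0 : ℂ), z⟫ * SPD_A g0 ε z
        - Real.exp (-(S + ε) * ‖z‖ ^ 2) * Real.cos ⟪(0 : ℂ), z⟫ * SPD_A g0 ε z) := i2.sub i3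
  have i6 : Integrable (fun z : ℂ =>
      Real.exp (-(s + ε) * ‖z‖ ^ 2) * Real.cos ⟪(0 : ℂ), z⟫ * SPD_A g0 ε z
        - Real.exp (-(S + ε) * ‖z‖ ^ 2) * Real.cos ⟪(0 : ℂ), z⟫ * SPD_A g0 ε z
        - S * a ^ 2 * (Real.exp (-(0 + ε) * ‖z‖ ^ 2) * Real.cos ⟪(0 : ℂ), z⟫ * SPD_A g0 ε z)) :=
    i5.sub i4
  rw [integral_sub (integrable_finsetSum _ fun k _ => integrable_finsetSum _ fun j _ => i1 k j)
    (i6.const_mul _), integral_const_mul, integral_sub i5 i4,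
    integral_sub i2 i3, integral_const_mul,
    integral_finsetSum _ fun k _ => integrable_finsetSum _ fun j _ => i1 k j] at hV
  simp_rw [integral_finsetSum _ fun j _ => i1 _ j, integral_const_mul] at hV
  rw [SPD_A_gauss g0 hg0 C hb0 (heven g0 hr0) _ _ hε (by linarith),
    SPD_A_gauss g0 hg0 C hb0 (heven g0 hr0) _ _ hε (by linarith),
    SPD_A_gauss g0 hg0 C hb0 (heven g0 hr0) _ _ hε (by linarith)] at hV
  have e5 : ∀ k j, ∫ z : ℂ, Real.exp (-(0 + ε) * ‖z‖ ^ 2) *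
        Real.cos ⟪((l k - l j : ℝ) : ℂ), z⟫ * SPD_A (G k j) ε z =
      Real.pi * SPD_Psi (G k j) ((l k - l j : ℝ) : ℂ) (0 + ε) ε := fun k j =>
    SPD_A_gauss (G k j) (hG k j) C (hb k j) (heven _ (hr k j)) _ _ hε (by linarith) _
  simp_rw [e5] at hV
  have e6 : ∑ k, ∑ j, ξ k * ξ j * (Real.pi * SPD_Psi (G k j) ((l k - l j : ℝ) : ℂ) (0 + ε) ε)
      = Real.pi * ∑ k, ∑ j, ξ k * ξ j * SPD_Psi (G k j) ((l k - l j : ℝ) : ℂ) (0 + ε) ε := by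
    simp_rw [Finset.mul_sum]
    refine Finset.sum_congr rfl fun k _ => Finset.sum_congr rfl fun j _ => ?_
    ring
  rw [e6] at hV
  refine le_of_mul_le_mul_left ?_ Real.pi_pos
  linarith

theorem SPD_core {m : ℕ} (G : Fin m → Fin m → ℂ → ℝ) (g0 : ℂ → ℝ) (C : ℝ)
    (hg0 : Continuous g0) (hb0 : ∀ w, |g0 w| ≤ C) (hr0 : ∀ s t : ℂ, ‖s‖ = ‖t‖ → g0 s = g0 t)
    (hA0 : ∀ ε > 0, ∀ z, 0 ≤ SPD_A g0 ε z)
    (hG : ∀ k j, Continuous (G k j)) (hb : ∀ k j w, |G k j w| ≤ C)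
    (hr : ∀ k j, ∀ s t : ℂ, ‖s‖ = ‖t‖ → G k j s = G k j t)
    (hd : ∀ k, G k k = g0) (hsym : ∀ k j, G k j = G j k)
    (hp : ∀ (c : Fin m → ℝ) (z : ℂ) (N : ℕ) (w : Fin N → ℂ), 0 ≤ ∑ a, ∑ b,
      (∑ k, ∑ j, c k * c j * G k j (w a - w b)) * Real.cos ⟪w a - w b, z⟫)
    (l : Fin m → ℝ) (a c : ℝ) (ha : 0 < a) (hc : 0 < c)
    (hI : ∀ η : Fin m → ℂ, c * ∑ k, ‖η k‖ ^ 2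
      ≤ ∫ u in (-a)..a, ‖∑ k, η k * Complex.exp (l k * u * Complex.I)‖ ^ 2)
    (ξ : Fin m → ℝ) (s S : ℝ) (hs : 0 < s) (hS : 0 < S) :
    (c * (2 * Real.sqrt s) * (∑ k, ξ k ^ 2)) / (2 * Real.pi) *
      (SPD_Psi g0 0 s 0 - SPD_Psi g0 0 S 0 - S * a ^ 2 * SPD_Psi g0 0 0 0)
      ≤ ∑ k, ∑ j, ξ k * ξ j * (4 * Real.pi * G k j ((l k - l j : ℝ) : ℂ)) := by
  have h0 := SPD_Psi_tendsto g0 hg0 C hb0 0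
  simp_rw [← SPD_Psi_zero]
  refine le_of_tendsto_of_tendsto (b := nhdsWithin 0 (Set.Ioi 0))
    ((((h0 s).sub (h0 S)).sub ((h0 0).const_mul (S * a ^ 2))).const_mul _)
    (tendsto_finsetSum _ fun k _ => tendsto_finsetSum _ fun j _ =>
      (SPD_Psi_tendsto (G k j) (hG k j) C (hb k j) ((l k - l j : ℝ) : ℂ) 0).const_mul _) ?_
  filter_upwards [self_mem_nhdsWithin] with ε hε
  exact SPD_core_eps G g0 C hg0 hb0 hr0 hA0 hG hb hr hd hsym hp l a c ha hc hI ξ s S hs hS ε hε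

theorem SPD_dens (Λ : ℕ → ℝ) (h : upperDensity Λ = 0) : ∀ ε > 0, ∃ r0 : ℝ, ∀ r ≥ r0,
    ∀ (x : ℝ) (S : Finset ℕ), (∀ l ∈ S, |Λ l - x| ≤ r) → (S.card : ℝ) ≤ ε * r := by
  intro ε hε
  have h1 := Filter.eventually_lt_of_limsup_lt (f := Filter.atTop) (b := ENNReal.ofReal (ε / 2))
    (u := fun r : ℝ =>
    (⨆ a : ℝ, ∑' _ : {k : ℕ // Λ k ∈ Set.Icc a (a + r)}, (1 : ℝ≥0∞)) / ENNReal.ofReal r)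
    (by
      change upperDensity Λ < _
      rw [h]; simpa using hε)
  obtain ⟨R, hR⟩ := Filter.eventually_atTop.1 h1
  refine ⟨max R 1, fun r hr x S hS => ?_⟩
  have hr1 : 1 ≤ r := (le_max_right _ _).trans hr
  have hrR : R ≤ r := (le_max_left _ _).trans hr
  have h2 := (hR (2 * r) (by linarith)).le
  rw [ENNReal.div_le_iff (by simp; linarith) ENNReal.ofReal_ne_top,
    ← ENNReal.ofReal_mul (by linarith)] at h2
  have h3 : (S.card : ℝ≥0∞) ≤
      ∑' _ : {k : ℕ // Λ k ∈ Set.Icc (x - r) (x - r + 2 * r)}, (1 : ℝ≥0∞) := by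
    have hmem : ∀ l ∈ S, Λ l ∈ Set.Icc (x - r) (x - r + 2 * r) := by
      intro l hl
      have := abs_le.1 (hS l hl)
      constructor <;> linarith
    classical
    let e : {l // l ∈ S} ↪ {k : ℕ // Λ k ∈ Set.Icc (x - r) (x - r + 2 * r)} :=
      ⟨fun l => ⟨l.1, hmem l.1 l.2⟩, fun a b hab => by
        apply Subtype.ext; exact congrArg (fun q => q.1) hab⟩
    have := ENNReal.sum_le_tsum (f := fun _ : {k : ℕ // Λ k ∈ Set.Icc (x - r) (x - r + 2 * r)} =>
      (1 : ℝ≥0∞)) (S.attach.map e)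
    simpa using this
  have h4 := (h3.trans (le_iSup (fun a : ℝ =>
    ∑' _ : {k : ℕ // Λ k ∈ Set.Icc a (a + 2 * r)}, (1 : ℝ≥0∞)) (x - r))).trans h2
  have h5 : (S.card : ℝ≥0∞) = ENNReal.ofReal (S.card : ℝ) := by simp
  rw [h5, ENNReal.ofReal_le_ofReal_iff (by positivity)] at h4
  linarith

def SPD_P {p : ℕ} (y : EuclideanSpace ℝ (Fin (p + 1))) (w : ℂ) :
    EuclideanSpace ℝ (Fin (p + 1 + 1)) :=
  WithLp.toLp 2 (Fin.snoc (α := fun _ => ℝ) (Fin.snoc (α := fun _ => ℝ)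
    (fun i : Fin p => y i.castSucc) w.re) w.im)

def SPD_D {p : ℕ} (y y' : EuclideanSpace ℝ (Fin (p + 1))) : ℝ :=
  ∑ i : Fin p, (y i.castSucc - y' i.castSucc) ^ 2

theorem SPD_D_nonneg {p : ℕ} (y y' : EuclideanSpace ℝ (Fin (p + 1))) : 0 ≤ SPD_D y y' := by
  unfold SPD_D; positivity

theorem SPD_P_norm {p : ℕ} (y y' : EuclideanSpace ℝ (Fin (p + 1))) (w v : ℂ) :
    ‖SPD_P y w - SPD_P y' v‖ = Real.sqrt (SPD_D y y' + ‖w - v‖ ^ 2) := by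
  rw [EuclideanSpace.norm_eq]
  congr 1
  rw [Fin.sum_univ_castSucc, Fin.sum_univ_castSucc]
  simp only [SPD_P, SPD_D, PiLp.sub_apply, Fin.snoc_castSucc, Fin.snoc_last, Real.norm_eq_abs,
    sq_abs]
  rw [← Complex.normSq_eq_norm_sq, Complex.normSq_apply, Complex.sub_re, Complex.sub_im]
  ring

theorem SPD_y_norm {p : ℕ} (y y' : EuclideanSpace ℝ (Fin (p + 1))) :
    ‖y - y'‖ = Real.sqrt (SPD_D y y' +
      ‖((y (Fin.last p) - y' (Fin.last p) : ℝ) : ℂ)‖ ^ 2) := by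
  rw [EuclideanSpace.norm_eq]
  congr 1
  rw [Fin.sum_univ_castSucc, Complex.norm_real]
  simp only [SPD_D, PiLp.sub_apply, Real.norm_eq_abs, sq_abs]

theorem SPD_pd_fintype {E : Type*} [NormedAddCommGroup E] {g : E → ℂ} (h : IsPosDefFn g)
    {ι : Type*} [Fintype ι] (x : ι → E) (ξ : ι → ℂ) :
    (0 : ℂ) ≤ ∑ j, ∑ k, ξ k * (starRingEnd ℂ) (ξ j) * g (x k - x j) := by
  have := h.2 (Fintype.card ι) (fun i => x ((Fintype.equivFin ι).symm i))
    (fun i => ξ ((Fintype.equivFin ι).symm i))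
  refine this.trans (le_of_eq ?_)
  rw [← Equiv.sum_comp (Fintype.equivFin ι).symm]
  refine Finset.sum_congr rfl fun j _ => ?_
  rw [← Equiv.sum_comp (Fintype.equivFin ι).symm]

theorem SPD_hp {p : ℕ} (f : ℝ → ℝ)
    (hpd : IsPosDefFn (fun x : EuclideanSpace ℝ (Fin (p + 1 + 1)) => (f ‖x‖ : ℂ)))
    {m : ℕ} (y : Fin m → EuclideanSpace ℝ (Fin (p + 1)))
    (c : Fin m → ℝ) (z : ℂ) (N : ℕ) (w : Fin N → ℂ) : 0 ≤ ∑ a, ∑ b,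
      (∑ k, ∑ j, c k * c j * f (Real.sqrt (SPD_D (y k) (y j) + ‖w a - w b‖ ^ 2)))
        * Real.cos ⟪w a - w b, z⟫ := by
  have h := SPD_pd_fintype hpd (ι := Fin N × Fin m) (fun q => SPD_P (y q.2) (w q.1))
    (fun q => (c q.2 : ℂ) * Complex.exp ((⟪w q.1, z⟫ : ℝ) * Complex.I))
  have h2 := (Complex.le_def.1 h).1
  refine h2.trans (le_of_eq ?_)
  rw [Finset.sum_comm]
  simp only [Fintype.sum_prod_type, Complex.re_sum, SPD_P_norm]
  refine Finset.sum_congr rfl fun a _ => ?_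
  rw [Finset.sum_comm]
  refine Finset.sum_congr rfl fun b _ => ?_
  rw [Finset.sum_mul]
  refine Finset.sum_congr rfl fun k _ => ?_
  rw [Finset.sum_mul]
  refine Finset.sum_congr rfl fun j _ => ?_
  rw [map_mul, Complex.conj_ofReal, ← Complex.exp_conj, map_mul, Complex.conj_ofReal,
    Complex.conj_I]
  have e : (c k : ℂ) * Complex.exp ((⟪w a, z⟫ : ℝ) * Complex.I) *
      ((c j : ℂ) * Complex.exp ((⟪w b, z⟫ : ℝ) * -Complex.I)) *
      (f (Real.sqrt (SPD_D (y k) (y j) + ‖w a - w b‖ ^ 2)) : ℂ) =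
      ((c k * c j * f (Real.sqrt (SPD_D (y k) (y j) + ‖w a - w b‖ ^ 2)) : ℝ) : ℂ) *
      Complex.exp ((⟪w a - w b, z⟫ : ℝ) * Complex.I) := by
    rw [inner_sub_left, show ((⟪w a, z⟫ - ⟪w b, z⟫ : ℝ) : ℂ) * Complex.I =
      (⟪w a, z⟫ : ℝ) * Complex.I + (⟪w b, z⟫ : ℝ) * -Complex.I by push_cast; ring, Complex.exp_add]
    push_cast
    ring
  rw [e, Complex.re_ofReal_mul, Complex.exp_ofReal_mul_I_re]

theorem SPD_f_bound {p : ℕ} (f : ℝ → ℝ)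
    (hpd : IsPosDefFn (fun x : EuclideanSpace ℝ (Fin (p + 1 + 1)) => (f ‖x‖ : ℂ)))
    (t : ℝ) (ht : 0 ≤ t) : |f t| ≤ f 0 := by
  have key : ∀ e : ℝ, 0 ≤ f 0 + e * e * f 0 + 2 * e * f t := by
    intro e
    have h := hpd.2 2 ![0, EuclideanSpace.single 0 t] ![1, (e : ℂ)]
    have h2 := (Complex.le_def.1 h).1
    simp [Fin.sum_univ_two, abs_of_nonneg ht] at h2
    linarith
  rw [abs_le]
  constructor
  · linarith [key 1]
  · linarith [key (-1)]

/-- Let `n ≥ 2` and let `f ∈ Φ_{n+1}` be nonconstant (continuous on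
`[0,∞)` with `x ↦ f(|x|)` positive definite on `ℝ^{n+1}`). Let `X = {x_k}` be a sequence
of points of `ℝⁿ` and let `Xₙ` be the sequence of `n`-th coordinates. If `d_*(Xₙ) > 0`
and `D*(Xₙ) = 0`, then `x ↦ f(|x|)` is strongly `X`-positive definite on `ℝⁿ`. -/
theorem statement_9 (n : ℕ) (hn : 2 ≤ n) (f : ℝ → ℝ)
    (hcont : ContinuousOn f (Set.Ici 0))
    (hnonconst : ∃ s t : ℝ, 0 ≤ s ∧ 0 ≤ t ∧ f s ≠ f t)
    (hpd : IsPosDefFn (fun x : EuclideanSpace ℝ (Fin (n + 1)) => (f ‖x‖ : ℂ)))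
    (X : ℕ → EuclideanSpace ℝ (Fin n))
    (hsep : ∃ d : ℝ, 0 < d ∧ ∀ k j, k ≠ j →
      d ≤ |X k ⟨n - 1, by omega⟩ - X j ⟨n - 1, by omega⟩|)
    (hdens : upperDensity (fun k => X k ⟨n - 1, by omega⟩) = 0) :
    IsStronglyPosDef X (fun x => (f ‖x‖ : ℂ)) := by
  obtain ⟨p, rfl⟩ : ∃ p, n = p + 1 := ⟨n - 1, by omega⟩
  change ∃ d : ℝ, 0 < d ∧ ∀ k j, k ≠ j → d ≤ |X k (Fin.last p) - X j (Fin.last p)| at hsep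
  change upperDensity (fun k => X k (Fin.last p)) = 0 at hdens
  obtain ⟨d, hd, hsep⟩ := hsep
  have hbd := SPD_f_bound f hpd
  have hFc : ∀ D : ℝ, Continuous (fun w : ℂ => f (Real.sqrt (D + ‖w‖ ^ 2))) := fun D =>
    hcont.comp_continuous (by fun_prop) fun w => Real.sqrt_nonneg _
  have hFb : ∀ (D : ℝ) (w : ℂ), |f (Real.sqrt (D + ‖w‖ ^ 2))| ≤ f 0 := fun D w =>
    hbd _ (Real.sqrt_nonneg _)
  have hFr : ∀ (D : ℝ) (s t : ℂ), ‖s‖ = ‖t‖ → f (Real.sqrt (D + ‖s‖ ^ 2)) =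
      f (Real.sqrt (D + ‖t‖ ^ 2)) := fun D s t h => by rw [h]
  obtain ⟨t0, ht0, hft0⟩ : ∃ t0 : ℝ, 0 ≤ t0 ∧ f t0 < f 0 := by
    obtain ⟨s, t, hs, ht, hst⟩ := hnonconst
    by_contra hcon
    push Not at hcon
    have h1 := le_antisymm ((le_abs_self _).trans (hbd s hs)) (hcon s hs)
    have h2 := le_antisymm ((le_abs_self _).trans (hbd t ht)) (hcon t ht)
    exact hst (h1.trans h2.symm)
  have hf0 : 0 < f 0 := by
    have := (abs_le.1 (hbd t0 ht0)).1
    linarith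
  set g0 : ℂ → ℝ := fun w => f (Real.sqrt (0 + ‖w‖ ^ 2)) with hg0
  have hg00 : g0 0 = f 0 := by simp [hg0]
  have hDs : ∀ y : EuclideanSpace ℝ (Fin (p + 1)), SPD_D y y = 0 := fun y => by simp [SPD_D]
  have hA0 : ∀ ε > 0, ∀ z, 0 ≤ SPD_A g0 ε z := by
    intro ε hε z
    have := SPD_pd_gauss (fun w => g0 w * Real.cos ⟪w, z⟫)
      ((hFc 0).mul (by fun_prop)) (f 0) (fun w => by
        rw [abs_mul]
        exact (mul_le_of_le_one_right (abs_nonneg _) (Real.abs_cos_le_one _)).trans (hFb 0 w))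
      (fun N w => by
        have := SPD_hp f hpd (m := 1) (fun _ => 0) (fun _ => 1) z N w
        simpa [hDs, hg0] using this) ε hε
    refine this.trans (le_of_eq ?_)
    unfold SPD_A
    refine integral_congr_ae (Eventually.of_forall fun s => ?_)
    simp only; ring
  have hlt : SPD_Psi g0 0 1 0 < SPD_Psi g0 0 0 0 := by
    refine SPD_Psi_lt g0 (hFc 0) (fun w => by rw [hg00]; exact hFb 0 w) (t0 : ℂ) ?_
    rw [hg00]
    simp only [hg0, Complex.norm_real, Real.norm_eq_abs, sq_abs, zero_add]
    rwa [Real.sqrt_sq ht0]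
  have hP0 : 0 < SPD_Psi g0 0 0 0 := by
    rw [SPD_Psi_zero, hg00]
    have := Real.pi_pos
    positivity
  set δ := (SPD_Psi g0 0 0 0 - SPD_Psi g0 0 1 0) / 4 with hδ
  have hδ0 : 0 < δ := by rw [hδ]; linarith
  obtain ⟨s, hs, hsδ⟩ : ∃ s : ℝ, 0 < s ∧ SPD_Psi g0 0 0 0 - δ < SPD_Psi g0 0 s 0 := by
    have hc := (SPD_Psi_cont g0 (hFc 0) (f 0) (hFb 0) 0).tendsto 0
    have h1 := (hc.eventually (lt_mem_nhds (show SPD_Psi g0 0 0 0 - δ < SPD_Psi g0 0 0 0 by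
      linarith))).filter_mono (nhdsWithin_le_nhds (s := Set.Ioi 0))
    obtain ⟨s, hs1, hs2⟩ := (h1.and self_mem_nhdsWithin).exists
    exact ⟨s, hs2, hs1⟩
  set a := Real.sqrt (δ / SPD_Psi g0 0 0 0) with ha_def
  have ha : 0 < a := Real.sqrt_pos.2 (by positivity)
  have ha2 : a ^ 2 * SPD_Psi g0 0 0 0 = δ := by
    rw [ha_def, Real.sq_sqrt (by positivity)]
    field_simp
  have hbr : δ ≤ SPD_Psi g0 0 s 0 - SPD_Psi g0 0 1 0 - 1 * a ^ 2 * SPD_Psi g0 0 0 0 := by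
    rw [one_mul, ha2]
    have : SPD_Psi g0 0 0 0 - SPD_Psi g0 0 1 0 = 4 * δ := by rw [hδ]; ring
    linarith
  obtain ⟨c, hc, hI⟩ := SPD_ingham (fun k => X k (Fin.last p)) d hd hsep (SPD_dens _ hdens) a ha
  have hpi := Real.pi_pos
  refine ⟨c * (2 * Real.sqrt s) / (2 * Real.pi) * δ / (4 * Real.pi), by positivity, ?_⟩
  intro m y hy hyi ξ
  choose κ hκ using hy
  have hκi : Function.Injective κ := fun i j hij => hyi (by rw [← hκ i, ← hκ j, hij])
  let G : Fin m → Fin m → ℂ → ℝ := fun k j w => f (Real.sqrt (SPD_D (y k) (y j) + ‖w‖ ^ 2))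
  let l : Fin m → ℝ := fun k => y k (Fin.last p)
  have hcore : ∀ η : Fin m → ℝ, c * (2 * Real.sqrt s) / (2 * Real.pi) * δ / (4 * Real.pi) *
      (∑ k, η k ^ 2) ≤ ∑ k, ∑ j, η k * η j * f ‖y k - y j‖ := by
    intro η
    have h := SPD_core G g0 (f 0) (hFc 0) (hFb 0) (hFr 0) hA0 (fun k j => hFc _)
      (fun k j => hFb _) (fun k j => hFr _) (fun k => by simp only [G, hDs, hg0])
      (fun k j => by
        have : SPD_D (y k) (y j) = SPD_D (y j) (y k) := by
          unfold SPD_D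
          exact Finset.sum_congr rfl fun i _ => by ring
        simp only [G, this])
      (fun c z N w => SPD_hp f hpd y c z N w) l a c ha hc
      (fun η => by
        have := hI m κ hκi η
        simp only [hκ] at this
        exact this) η s 1 hs one_pos
    have e : ∑ k, ∑ j, η k * η j * (4 * Real.pi * G k j ((l k - l j : ℝ) : ℂ)) =
        (4 * Real.pi) * ∑ k, ∑ j, η k * η j * f ‖y k - y j‖ := by
      simp_rw [Finset.mul_sum]
      refine Finset.sum_congr rfl fun k _ => Finset.sum_congr rfl fun j _ => ?_
      rw [SPD_y_norm]
      simp only [G, l]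
      ring
    rw [e] at h
    have h2 := (mul_le_mul_of_nonneg_left hbr
      (show 0 ≤ (c * (2 * Real.sqrt s) * (∑ k, η k ^ 2)) / (2 * Real.pi) by positivity)).trans h
    rw [mul_comm (4 * Real.pi), ← div_le_iff₀ (by positivity)] at h2
    refine le_trans (le_of_eq ?_) h2
    ring
  have hnn := SPD_pd_fintype hpd (fun k => SPD_P (y k) (l k : ℂ)) ξ
  have en : ∀ k j, ‖SPD_P (y k) (l k : ℂ) - SPD_P (y j) (l j : ℂ)‖ = ‖y k - y j‖ := by
    intro k j
    rw [SPD_P_norm, SPD_y_norm, ← Complex.ofReal_sub]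
  simp only [en] at hnn
  rw [Complex.le_def] at hnn ⊢
  refine ⟨?_, (Complex.ofReal_im _).trans hnn.2⟩
  rw [Complex.ofReal_re]
  have hre : (∑ j, ∑ k, ξ k * (starRingEnd ℂ) (ξ j) * (f ‖y k - y j‖ : ℂ)).re =
      (∑ k, ∑ j, (ξ k).re * (ξ j).re * f ‖y k - y j‖) +
      ∑ k, ∑ j, (ξ k).im * (ξ j).im * f ‖y k - y j‖ := by
    rw [Finset.sum_comm, Complex.re_sum, ← Finset.sum_add_distrib]
    refine Finset.sum_congr rfl fun k _ => ?_
    rw [Complex.re_sum, ← Finset.sum_add_distrib]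
    refine Finset.sum_congr rfl fun j _ => ?_
    rw [Complex.re_mul_ofReal]
    simp
    ring
  rw [hre]
  refine le_trans (le_of_eq ?_) (add_le_add (hcore fun k => (ξ k).re) (hcore fun k => (ξ k).im))
  rw [← mul_add, ← Finset.sum_add_distrib]
  congr 1
  refine Finset.sum_congr rfl fun k _ => ?_
  rw [← Complex.normSq_eq_norm_sq, Complex.normSq_apply]
  ring
end
end

section
/- Let n ≥ 2, let ν be a finite positive Borel measure on [0,∞), and let f(t) = ∫_0^∞ Ω_n(rt) dν(r) for t ∈ [0,∞) (so f ∈ Φ_n with representing measure ν). Let X = {x_k}_{k≥1} be a sequence of pairwise distinct points of ℝ^n. Suppose that for all j ≠ k there are positive numbers α_{kj} such that sup_{j∈ℕ} Σ_{k≠j} (α_{kj}|x_k − x_j|)^{−(n−1)/2} < ∞ and sup_{j∈ℕ} Σ_{k≠j} ν([0, α_{kj}]) < ∞. Then the Gram matrix (f(|x_k − x_j|))_{k,j∈ℕ} defines a bounded self-adjoint operator on ℓ²(ℕ). -/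
open MeasureTheory Filter
open scoped ComplexOrder ENNReal RealInnerProductSpace

noncomputable section

theorem schur_pointwise (p y : ℕ → ℝ) (hp : ∀ k, 0 ≤ p k) (hy : ∀ k, 0 ≤ y k)
    (hps : Summable p) (hpy2 : Summable fun k => p k * y k ^ 2) :
    Summable (fun k => p k * y k) ∧
      (∑' k, p k * y k) ^ 2 ≤ (∑' k, p k) * ∑' k, p k * y k ^ 2 := by
  have h1 : Summable (fun k => p k * y k) := by
    refine Summable.of_nonneg_of_le (fun k => mul_nonneg (hp k) (hy k)) (fun k => ?_)
      (hps.add hpy2)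
    nlinarith [hp k, mul_nonneg (hp k) (sq_nonneg (y k - 1)), mul_nonneg (hp k) (sq_nonneg (y k)), mul_nonneg (hp k) (hy k)]
  refine ⟨h1, ?_⟩
  refine le_of_tendsto (h1.hasSum.pow 2) (Eventually.of_forall fun s => ?_)
  calc (∑ k ∈ s, p k * y k) ^ 2 ≤ (∑ k ∈ s, p k) * ∑ k ∈ s, p k * y k ^ 2 := by
        refine Finset.sum_sq_le_sum_mul_sum_of_sq_le_mul s (fun k _ => hp k)
          (fun k _ => mul_nonneg (hp k) (sq_nonneg _)) (fun k _ => le_of_eq (by ring))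
    _ ≤ _ := mul_le_mul (hps.sum_le_tsum _ fun k _ => hp k)
        (hpy2.sum_le_tsum _ fun k _ => mul_nonneg (hp k) (sq_nonneg _))
        (Finset.sum_nonneg fun k _ => mul_nonneg (hp k) (sq_nonneg _))
        (tsum_nonneg hp)

theorem schur_test (a : ℕ → ℕ → ℂ) (hsymm : ∀ k j, a k j = a j k)
    (hreal : ∀ k j, (starRingEnd ℂ) (a k j) = a k j)
    (hs : ∀ j, Summable fun k => ‖a k j‖) (M : ℝ) (hM : ∀ j, ∑' k, ‖a k j‖ ≤ M) :
    ∃ A : ell2 →L[ℂ] ell2, IsSelfAdjoint A ∧ ∀ k j : ℕ, A (stdBasis k) j = a k j := by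
  have hM0 : 0 ≤ M := (tsum_nonneg fun k => norm_nonneg _).trans (hM 0)
  have hx2 : ∀ x : ell2, Summable fun k => ‖x k‖ ^ 2 := fun x => by
    have := (lp.memℓp x).summable (by norm_num)
    simpa using this
  have hx2' : ∀ x : ell2, ∑' k, ‖x k‖ ^ 2 = ‖x‖ ^ 2 := fun x => by
    have := lp.norm_rpow_eq_tsum (p := 2) (by norm_num) x
    simpa using this.symm
  have hle : ∀ k j, ‖a k j‖ ≤ M := fun k j =>
    ((hs j).le_tsum k fun _ _ => norm_nonneg _).trans (hM j)
  have hpy : ∀ (x : ell2) (j : ℕ), Summable fun k => ‖a k j‖ * ‖x k‖ ^ 2 := fun x j =>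
    Summable.of_nonneg_of_le (fun k => by positivity)
      (fun k => mul_le_mul_of_nonneg_right (hle k j) (by positivity)) ((hx2 x).mul_left M)
  have hsn : ∀ (x : ell2) (j : ℕ), Summable fun k => ‖a k j * x k‖ := fun x j => by
    simpa only [norm_mul] using (schur_pointwise _ _ (fun k => norm_nonneg (a k j))
      (fun k => norm_nonneg (x k)) (hs j) (hpy x j)).1
  have hb : ∀ (x : ell2) (s : Finset ℕ),
      ∑ j ∈ s, ‖∑' k, a k j * x k‖ ^ (2 : ℕ) ≤ (M * ‖x‖) ^ 2 := fun x s => by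
    calc ∑ j ∈ s, ‖∑' k, a k j * x k‖ ^ 2 ≤ ∑ j ∈ s, M * ∑' k, ‖a k j‖ * ‖x k‖ ^ 2 := by
          refine Finset.sum_le_sum fun j _ => ?_
          have h1 := norm_tsum_le_tsum_norm (hsn x j)
          have h2 := (schur_pointwise _ _ (fun k => norm_nonneg (a k j))
            (fun k => norm_nonneg (x k)) (hs j) (hpy x j)).2
          simp only [norm_mul] at h1
          calc _ ≤ (∑' k, ‖a k j‖ * ‖x k‖) ^ 2 := by gcongr
            _ ≤ _ := h2
            _ ≤ _ := mul_le_mul_of_nonneg_right (hM j) (tsum_nonneg fun k => by positivity)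
      _ = M * ∑' k, ∑ j ∈ s, ‖a k j‖ * ‖x k‖ ^ 2 := by
          rw [← Finset.mul_sum, Summable.tsum_finsetSum fun j _ => hpy x j]
      _ ≤ M * ∑' k, M * ‖x k‖ ^ 2 := by
          refine mul_le_mul_of_nonneg_left ?_ hM0
          refine Summable.tsum_le_tsum (fun k => ?_) (summable_sum fun j _ => hpy x j)
            ((hx2 x).mul_left M)
          rw [← Finset.sum_mul]
          refine mul_le_mul_of_nonneg_right ?_ (by positivity)
          simp only [hsymm k]
          exact ((hs k).sum_le_tsum s fun _ _ => norm_nonneg _).trans (hM k)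
      _ = _ := by rw [tsum_mul_left, hx2']; ring
  have hmem : ∀ x : ell2, Memℓp (fun j => ∑' k, a k j * x k) 2 := fun x =>
    memℓp_gen' (C := (M * ‖x‖) ^ 2) fun s => by simpa using hb x s
  let L : ell2 →ₗ[ℂ] ell2 :=
    { toFun := fun x => ⟨fun j => ∑' k, a k j * x k, hmem x⟩
      map_add' := fun x y => by
        ext j
        change ∑' k, a k j * (x k + y k) = ∑' k, a k j * x k + ∑' k, a k j * y k
        rw [← (hsn x j).of_norm.tsum_add (hsn y j).of_norm]
        simp only [mul_add]
      map_smul' := fun c x => by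
        ext j
        change ∑' k, a k j * (c * x k) = c * ∑' k, a k j * x k
        rw [← tsum_mul_left]
        exact tsum_congr fun k => by ring }
  let A : ell2 →L[ℂ] ell2 := L.mkContinuous M fun x =>
    lp.norm_le_of_forall_sum_le (by norm_num) (by positivity) fun s => by
      simpa [L] using hb x s
  have hA : ∀ k j : ℕ, A (stdBasis k) j = a k j := fun k j => by
    change ∑' i, a i j * (stdBasis k) i = a k j
    rw [tsum_eq_single k]
    · simp [stdBasis]
    · intro i hi
      simp [stdBasis, hi]
  refine ⟨A, ?_, hA⟩
  rw [ContinuousLinearMap.isSelfAdjoint_iff']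
  refine lp.ext_continuousLinearMap (by norm_num) fun k => ?_
  ext j
  change (ContinuousLinearMap.adjoint A) (stdBasis k) j = A (stdBasis k) j
  have h1 : ∀ (y : ell2) (j : ℕ), y j = inner ℂ (stdBasis j) y := fun y j => by
    rw [stdBasis, lp.inner_single_left]; simp
  rw [h1, ContinuousLinearMap.adjoint_inner_right, ← inner_conj_symm, ← h1, hA, hA, hreal, hsymm]

theorem ode_decay (a : ℝ) (w w1 w2 : ℝ → ℝ) (h1 : ∀ t, HasDerivAt w (w1 t) t)
    (h2 : ∀ t, HasDerivAt w1 (w2 t) t)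
    (hode : ∀ t, 0 < t → t * w2 t + 2 * a * w1 t + t * w t = 0) :
    ∃ C : ℝ, ∀ t, 1 ≤ t → |w t| ≤ C * t ^ (-a) := by
  let v : ℝ → ℝ := fun t => t ^ a * w t
  let v1 : ℝ → ℝ := fun t => a * t ^ (a - 1) * w t + t ^ a * w1 t
  have hv : ∀ t, 0 < t → HasDerivAt v (v1 t) t := fun t ht => by
    have := (Real.hasDerivAt_rpow_const (x := t) (p := a) (Or.inl ht.ne')).mul (h1 t)
    exact this
  have hv1 : ∀ t, 0 < t → HasDerivAt v1 ((a * (a - 1) / t ^ 2 - 1) * v t) t := fun t ht => by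
    have := (((Real.hasDerivAt_rpow_const (x := t) (p := a - 1) (Or.inl ht.ne')).const_mul a).mul
      (h1 t)).add ((Real.hasDerivAt_rpow_const (x := t) (p := a) (Or.inl ht.ne')).mul (h2 t))
    refine this.congr_deriv ?_
    have e1 : t ^ (a - 1) = t ^ a / t := Real.rpow_sub_one ht.ne' a
    have e2 : t ^ (a - 1 - 1) = t ^ a / t / t := by rw [Real.rpow_sub_one ht.ne', e1]
    have e3 : w2 t = - (2 * a * w1 t) / t - w t := by
      have := hode t ht
      field_simp
      linarith
    simp only [v, e1, e2, e3]
    field_simp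
    ring
  set c : ℝ := |a * (a - 1)| with hc
  let H : ℝ → ℝ := fun t => (v t ^ 2 + v1 t ^ 2) * Real.exp (c / t)
  have hH : ∀ t, 0 < t → HasDerivAt H
      (((2 * v t * v1 t + 2 * v1 t * ((a * (a - 1) / t ^ 2 - 1) * v t)) * Real.exp (c / t)
        + (v t ^ 2 + v1 t ^ 2) * (Real.exp (c / t) * (- c / t ^ 2)))) t := fun t ht => by
    have e : HasDerivAt (fun t : ℝ => c / t) (- c / t ^ 2) t := by
      exact ((hasDerivAt_const t c).div (hasDerivAt_id t) ht.ne').congr_deriv (by simp)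
    refine ((((hv t ht).pow 2).add ((hv1 t ht).pow 2)).mul e.exp).congr_deriv ?_
    simp
  have hanti : AntitoneOn H (Set.Ici 1) := by
    refine antitoneOn_of_deriv_nonpos (convex_Ici 1)
      (fun t ht => (hH t (lt_of_lt_of_le one_pos ht)).continuousAt.continuousWithinAt)
      (fun t ht => ?_) (fun t ht => ?_)
    · rw [interior_Ici] at ht
      exact (hH t (one_pos.trans ht)).differentiableAt.differentiableWithinAt
    · rw [interior_Ici] at ht
      have ht0 : 0 < t := one_pos.trans ht
      rw [(hH t ht0).deriv]
      have : (2 * v t * v1 t + 2 * v1 t * ((a * (a - 1) / t ^ 2 - 1) * v t)) * Real.exp (c / t)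
        + (v t ^ 2 + v1 t ^ 2) * (Real.exp (c / t) * (- c / t ^ 2))
        = Real.exp (c / t) / t ^ 2 * (a * (a - 1) * (2 * v t * v1 t)
          - c * (v t ^ 2 + v1 t ^ 2)) := by
        field_simp
        ring
      rw [this]
      refine mul_nonpos_of_nonneg_of_nonpos (by positivity) ?_
      have hb : |2 * v t * v1 t| ≤ v t ^ 2 + v1 t ^ 2 := by
        rw [abs_le]
        constructor <;> nlinarith [sq_nonneg (v t + v1 t), sq_nonneg (v t - v1 t)]
      have := (le_abs_self (a * (a - 1) * (2 * v t * v1 t)))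
      rw [abs_mul, ← hc] at this
      have := mul_le_mul_of_nonneg_left hb (abs_nonneg (a * (a - 1)))
      rw [← hc] at this
      linarith
  refine ⟨Real.sqrt (H 1), fun t ht => ?_⟩
  have ht0 : 0 < t := one_pos.trans_le ht
  have h := hanti (Set.mem_Ici.2 le_rfl) (Set.mem_Ici.2 ht) ht
  have hle : v t ^ 2 ≤ H 1 := by
    refine le_trans ?_ h
    have : (1 : ℝ) ≤ Real.exp (c / t) := Real.one_le_exp (by positivity)
    simp only [H]
    nlinarith [sq_nonneg (v t), sq_nonneg (v1 t)]
  have h3 := Real.abs_le_sqrt hle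
  simp only [v] at h3
  rw [abs_mul, abs_of_pos (Real.rpow_pos_of_pos ht0 a)] at h3
  rw [Real.rpow_neg ht0.le, ← div_eq_mul_inv, le_div_iff₀ (Real.rpow_pos_of_pos ht0 a)]
  linarith

theorem hasDerivAt_integral_bdd {E : Type*} [TopologicalSpace E] [MeasurableSpace E]
    [OpensMeasurableSpace E] [SecondCountableTopology E] (σ : Measure E) [IsFiniteMeasure σ]
    (F F' : ℝ → E → ℝ) (hF : ∀ t, Continuous (F t)) (hF' : ∀ t, Continuous (F' t))
    (hd : ∀ u t, HasDerivAt (fun s => F s u) (F' t u) t) (B : ℝ)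
    (hB : ∀ᵐ u ∂σ, ∀ t, |F t u| ≤ B) (hB' : ∀ᵐ u ∂σ, ∀ t, |F' t u| ≤ B) (t : ℝ) :
    HasDerivAt (fun s => ∫ u, F s u ∂σ) (∫ u, F' t u ∂σ) t := by
  refine (hasDerivAt_integral_of_dominated_loc_of_deriv_le (s := Set.univ) (bound := fun _ => B)
    univ_mem (Eventually.of_forall fun s => (hF s).aestronglyMeasurable) ?_
    (hF' t).aestronglyMeasurable ?_ (integrable_const B) ?_).2
  · exact Integrable.of_bound (hF t).aestronglyMeasurable B (hB.mono fun u hu => hu t)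
  · exact hB'.mono fun u hu s _ => hu s
  · exact Eventually.of_forall fun u s _ => hd u s

theorem sphere_re {n : ℕ}
    (σ : Measure (EuclideanSpace ℝ (Fin n))) [IsProbabilityMeasure σ]
    (Ω : ℝ → ℂ)
    (hΩ : ∀ x : EuclideanSpace ℝ (Fin n),
      Ω ‖x‖ = ∫ u, Complex.exp (Complex.I * (⟪u, x⟫ : ℝ)) ∂σ)
    (x : EuclideanSpace ℝ (Fin n)) :
    Ω ‖x‖ = ((∫ u, Real.cos ⟪u, x⟫ ∂σ : ℝ) : ℂ) := by
  have hInt : ∀ y : EuclideanSpace ℝ (Fin n),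
      Integrable (fun u => Complex.exp (Complex.I * (⟪u, y⟫ : ℝ))) σ := fun y => by
    refine Integrable.of_bound (Continuous.aestronglyMeasurable (by fun_prop)) 1
      (Eventually.of_forall fun u => ?_)
    rw [mul_comm, Complex.norm_exp_ofReal_mul_I]
  have h1 := hΩ x
  have h2 := hΩ (-x)
  rw [norm_neg] at h2
  have h3 : Ω ‖x‖ + Ω ‖x‖ = ∫ u, 2 * ((Real.cos ⟪u, x⟫ : ℝ) : ℂ) ∂σ := by
    nth_rewrite 1 [h1]
    rw [h2, ← integral_add (hInt x) (hInt (-x))]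
    refine integral_congr_ae (Eventually.of_forall fun u => ?_)
    simp only [inner_neg_right, Complex.ofReal_neg, Complex.ofReal_cos]
    rw [Complex.two_cos]
    congr 2 <;> ring
  rw [integral_const_mul, integral_complex_ofReal] at h3
  linear_combination h3 / 2

theorem sphere_decay (n : ℕ) (hn : 2 ≤ n)
    (σ : Measure (EuclideanSpace ℝ (Fin n))) [IsProbabilityMeasure σ]
    (hσsupp : σ (Metric.sphere (0 : EuclideanSpace ℝ (Fin n)) 1)ᶜ = 0)
    (Ω : ℝ → ℂ)
    (hΩ : ∀ x : EuclideanSpace ℝ (Fin n),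
      Ω ‖x‖ = ∫ u, Complex.exp (Complex.I * (⟪u, x⟫ : ℝ)) ∂σ) :
    (∀ t, 0 ≤ t → (starRingEnd ℂ) (Ω t) = Ω t ∧ ‖Ω t‖ ≤ 1) ∧
    ∃ C : ℝ, 0 ≤ C ∧ ∀ t, 0 < t → ‖Ω t‖ ≤ C * t ^ (-(((n : ℝ) - 1) / 2)) := by
  let i0 : Fin n := ⟨0, by omega⟩
  let e : Fin n → EuclideanSpace ℝ (Fin n) := fun i => EuclideanSpace.single i 1
  have hin : ∀ u i, ⟪u, e i⟫ = u i := fun u i => by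
    simp [e, EuclideanSpace.inner_single_right]
  have hsph : ∀ᵐ u ∂σ, ‖u‖ = 1 := by
    have : ∀ᵐ u ∂σ, u ∈ Metric.sphere (0 : EuclideanSpace ℝ (Fin n)) 1 := hσsupp
    filter_upwards [this] with u hu
    simpa using hu
  have hco : ∀ᵐ u ∂σ, ∀ i, |u i| ≤ 1 := by
    filter_upwards [hsph] with u hu i
    have := PiLp.norm_apply_le u i
    rwa [hu, Real.norm_eq_abs] at this
  let w : ℝ → ℝ := fun t => ∫ u, Real.cos (t * u i0) ∂σ
  let w1 : ℝ → ℝ := fun t => ∫ u, - (u i0 * Real.sin (t * u i0)) ∂σ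
  let w2 : ℝ → ℝ := fun t => ∫ u, - (u i0 ^ 2 * Real.cos (t * u i0)) ∂σ
  have hΩw : ∀ t, 0 ≤ t → Ω t = (w t : ℂ) := fun t ht => by
    have h := sphere_re σ Ω hΩ (t • e i0)
    have hnorm : ‖t • e i0‖ = t := by simp [norm_smul, e, abs_of_nonneg ht]
    rw [hnorm] at h
    rw [h]
    simp only [inner_smul_right, hin, w]
  have hwle : ∀ t, |w t| ≤ 1 := fun t => by
    have := norm_integral_le_of_norm_le_const (μ := σ) (C := 1)
      (f := fun u => Real.cos (t * u i0)) (Eventually.of_forall fun u => Real.abs_cos_le_one _)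
    simpa using this
  have hd1 : ∀ t, HasDerivAt w (w1 t) t := by
    refine hasDerivAt_integral_bdd σ _ (fun t u => - (u i0 * Real.sin (t * u i0)))
      (fun t => by fun_prop) (fun t => by fun_prop) (fun u t => ?_) 1
      (Eventually.of_forall fun u t => Real.abs_cos_le_one _) ?_
    · exact (((hasDerivAt_id t).mul_const (u i0)).cos).congr_deriv (by simp; ring)
    · filter_upwards [hco] with u hu t
      rw [abs_neg, abs_mul]
      exact mul_le_one₀ (hu i0) (abs_nonneg _) (Real.abs_sin_le_one _)
  have hd2 : ∀ t, HasDerivAt w1 (w2 t) t := by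
    refine hasDerivAt_integral_bdd σ _ (fun t u => - (u i0 ^ 2 * Real.cos (t * u i0)))
      (fun t => by fun_prop) (fun t => by fun_prop) (fun u t => ?_) 1 ?_ ?_
    · exact (((((hasDerivAt_id t).mul_const (u i0)).sin).const_mul (u i0)).neg).congr_deriv
        (by simp; ring)
    · filter_upwards [hco] with u hu t
      rw [abs_neg, abs_mul]
      exact mul_le_one₀ (hu i0) (abs_nonneg _) (Real.abs_sin_le_one _)
    · filter_upwards [hco] with u hu t
      rw [abs_neg, abs_mul, abs_pow]
      exact mul_le_one₀ (pow_le_one₀ (abs_nonneg _) (hu i0)) (abs_nonneg _)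
        (Real.abs_cos_le_one _)
  -- rotation in the plane spanned by `e i0` and `e j`
  have hrot : ∀ s : ℝ, 0 < s → ∀ j, j ≠ i0 →
      (∫ u, (u j ^ 2 * Real.cos (s * u i0)) ∂σ) * s = - w1 s := by
    intro s hs j hj
    let p : ℝ → EuclideanSpace ℝ (Fin n) → ℝ := fun θ u => Real.cos θ * u i0 + Real.sin θ * u j
    let q : ℝ → EuclideanSpace ℝ (Fin n) → ℝ := fun θ u => - Real.sin θ * u i0 + Real.cos θ * u j
    have hp : ∀ u θ, HasDerivAt (fun θ => p θ u) (q θ u) θ := fun u θ =>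
      ((Real.hasDerivAt_cos θ).mul_const _).add ((Real.hasDerivAt_sin θ).mul_const _)
    have hq : ∀ u θ, HasDerivAt (fun θ => q θ u) (- p θ u) θ := fun u θ =>
      (((Real.hasDerivAt_sin θ).neg.mul_const _).add
        ((Real.hasDerivAt_cos θ).mul_const _)).congr_deriv (by simp only [p]; ring)
    have hpb : ∀ᵐ u ∂σ, ∀ θ, |p θ u| ≤ 2 := by
      filter_upwards [hco] with u hu θ
      refine (abs_add_le _ _).trans ?_
      rw [abs_mul, abs_mul]
      have := mul_le_one₀ (Real.abs_cos_le_one θ) (abs_nonneg _) (hu i0)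
      have := mul_le_one₀ (Real.abs_sin_le_one θ) (abs_nonneg _) (hu j)
      linarith
    have hqb : ∀ᵐ u ∂σ, ∀ θ, |q θ u| ≤ 2 := by
      filter_upwards [hco] with u hu θ
      refine (abs_add_le _ _).trans ?_
      rw [abs_mul, abs_mul, abs_neg]
      have := mul_le_one₀ (Real.abs_sin_le_one θ) (abs_nonneg _) (hu i0)
      have := mul_le_one₀ (Real.abs_cos_le_one θ) (abs_nonneg _) (hu j)
      linarith
    have hpc : ∀ θ, Continuous (p θ) := fun θ => by simp only [p]; fun_prop
    have hqc : ∀ θ, Continuous (q θ) := fun θ => by simp only [q]; fun_prop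
    have hconst : ∀ θ, ∫ u, Real.cos (s * p θ u) ∂σ = w s := fun θ => by
      have h := sphere_re σ Ω hΩ (s • (Real.cos θ • e i0 + Real.sin θ • e j))
      have hnorm : ‖s • (Real.cos θ • e i0 + Real.sin θ • e j)‖ = s := by
        rw [norm_smul, Real.norm_eq_abs, abs_of_pos hs]
        have : ‖Real.cos θ • e i0 + Real.sin θ • e j‖ ^ 2 = 1 := by
          rw [← real_inner_self_eq_norm_sq]
          simp only [inner_add_right, inner_smul_right, hin]
          simp [e, hj, hj.symm]
          nlinarith [Real.cos_sq_add_sin_sq θ]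
        have h2 : ‖Real.cos θ • e i0 + Real.sin θ • e j‖ = 1 := by
          rwa [pow_eq_one_iff_of_nonneg (norm_nonneg _) two_ne_zero] at this
        rw [h2, mul_one]
      rw [hnorm, hΩw s hs.le] at h
      have h' := Complex.ofReal_injective h
      rw [h']
      simp only [inner_smul_right, inner_add_right, hin, p]
    have hder1 : ∀ θ, HasDerivAt (fun θ => ∫ u, Real.cos (s * p θ u) ∂σ)
        (∫ u, - (s * (q θ u * Real.sin (s * p θ u))) ∂σ) θ := by
      refine hasDerivAt_integral_bdd σ _ (fun θ u => - (s * (q θ u * Real.sin (s * p θ u))))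
        (fun t => by fun_prop) (fun t => by fun_prop) (fun u t => ?_) (1 + s * 2) ?_ ?_
      · exact (((hp u t).const_mul s).cos).congr_deriv (by ring)
      · refine Eventually.of_forall fun u t => (Real.abs_cos_le_one _).trans ?_
        linarith
      · filter_upwards [hqb] with u hu t
        rw [abs_neg, abs_mul, abs_mul, abs_of_pos hs]
        have := mul_le_mul (hu t) (Real.abs_sin_le_one (s * p t u)) (abs_nonneg _) zero_le_two
        nlinarith
    have hzero : ∀ θ, ∫ u, - (s * (q θ u * Real.sin (s * p θ u))) ∂σ = 0 := fun θ => by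
      have h := hder1 θ
      simp only [hconst] at h
      exact h.unique (hasDerivAt_const θ (w s))
    have hder2 : HasDerivAt (fun θ => ∫ u, - (s * (q θ u * Real.sin (s * p θ u))) ∂σ)
        (∫ u, - (s * (- p 0 u * Real.sin (s * p 0 u)
          + q 0 u * (s * (q 0 u * Real.cos (s * p 0 u))))) ∂σ) 0 := by
      refine hasDerivAt_integral_bdd σ _ (fun θ u => - (s * (- p θ u * Real.sin (s * p θ u)
          + q θ u * (s * (q θ u * Real.cos (s * p θ u))))))
        (fun t => by fun_prop) (fun t => by fun_prop) (fun u t => ?_) (s * (2 + 2 * (s * 2))) ?_ ?_ 0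
      · exact (((hq u t).mul (((hp u t).const_mul s).sin)).const_mul s).neg.congr_deriv (by ring)
      · filter_upwards [hqb] with u hu t
        rw [abs_neg, abs_mul, abs_mul, abs_of_pos hs]
        have := mul_le_mul (hu t) (Real.abs_sin_le_one (s * p t u)) (abs_nonneg _) zero_le_two
        refine mul_le_mul_of_nonneg_left ?_ hs.le
        nlinarith
      · filter_upwards [hpb, hqb] with u hu hu' t
        rw [abs_neg, abs_mul, abs_of_pos hs]
        refine mul_le_mul_of_nonneg_left ((abs_add_le _ _).trans (add_le_add ?_ ?_)) hs.le
        · rw [abs_mul, abs_neg]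
          have := mul_le_mul (hu t) (Real.abs_sin_le_one (s * p t u)) (abs_nonneg _) zero_le_two
          linarith
        · rw [abs_mul, abs_mul, abs_mul, abs_of_pos hs]
          have := mul_le_mul (hu' t) (Real.abs_cos_le_one (s * p t u)) (abs_nonneg _) zero_le_two
          rw [mul_one] at this
          exact mul_le_mul (hu' t) (mul_le_mul_of_nonneg_left this hs.le) (by positivity)
            zero_le_two
    simp only [hzero] at hder2
    have h := hder2.unique (hasDerivAt_const 0 0)
    have hp0 : ∀ u, p 0 u = u i0 := fun u => by simp [p]
    have hq0 : ∀ u, q 0 u = u j := fun u => by simp [q]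
    simp only [hp0, hq0] at h
    have hI1 : Integrable (fun u : EuclideanSpace ℝ (Fin n) => u i0 * Real.sin (s * u i0)) σ := by
      refine Integrable.of_bound (Continuous.aestronglyMeasurable (by fun_prop)) 1 ?_
      filter_upwards [hco] with u hu
      rw [Real.norm_eq_abs, abs_mul]
      exact mul_le_one₀ (hu i0) (abs_nonneg _) (Real.abs_sin_le_one _)
    have hI2 : Integrable (fun u : EuclideanSpace ℝ (Fin n) => u j ^ 2 * Real.cos (s * u i0)) σ := by
      refine Integrable.of_bound (Continuous.aestronglyMeasurable (by fun_prop)) 1 ?_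
      filter_upwards [hco] with u hu
      rw [Real.norm_eq_abs, abs_mul, abs_pow]
      exact mul_le_one₀ (pow_le_one₀ (abs_nonneg _) (hu j)) (abs_nonneg _)
        (Real.abs_cos_le_one _)
    have h4 : ∫ u, - (s * (- u i0 * Real.sin (s * u i0)
          + u j * (s * (u j * Real.cos (s * u i0))))) ∂σ
        = s * (∫ u, u i0 * Real.sin (s * u i0) ∂σ) - s ^ 2 * ∫ u, u j ^ 2 * Real.cos (s * u i0) ∂σ := by
      rw [← integral_const_mul, ← integral_const_mul,
        ← integral_sub (hI1.const_mul s) (hI2.const_mul (s ^ 2))]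
      refine integral_congr_ae (Eventually.of_forall fun u => ?_)
      simp only
      ring
    rw [h4] at h
    simp only [w1, integral_neg, neg_neg]
    have h5 : s * ((∫ u, u i0 * Real.sin (s * u i0) ∂σ)
      - s * ∫ u, u j ^ 2 * Real.cos (s * u i0) ∂σ) = 0 := by linarith
    have h6 := (mul_eq_zero.1 h5).resolve_left hs.ne'
    linarith
  have hode : ∀ t, 0 < t → t * w2 t + 2 * (((n : ℝ) - 1) / 2) * w1 t + t * w t = 0 := by
    intro t ht
    have hI : ∀ j, Integrable
        (fun u : EuclideanSpace ℝ (Fin n) => u j ^ 2 * Real.cos (t * u i0)) σ := fun j => by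
      refine Integrable.of_bound (Continuous.aestronglyMeasurable (by fun_prop)) 1 ?_
      filter_upwards [hco] with u hu
      rw [Real.norm_eq_abs, abs_mul, abs_pow]
      exact mul_le_one₀ (pow_le_one₀ (abs_nonneg _) (hu j)) (abs_nonneg _)
        (Real.abs_cos_le_one _)
    have hsum : ∑ j, ∫ u, u j ^ 2 * Real.cos (t * u i0) ∂σ = w t := by
      rw [← integral_finsetSum _ fun j _ => hI j]
      refine integral_congr_ae ?_
      filter_upwards [hsph] with u hu
      rw [← Finset.sum_mul]
      have : ∑ j, u j ^ 2 = 1 := by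
        rw [← EuclideanSpace.real_norm_sq_eq, hu, one_pow]
      rw [this, one_mul]
    have hw2 : ∫ u, u i0 ^ 2 * Real.cos (t * u i0) ∂σ = - w2 t := by
      simp only [w2, integral_neg, neg_neg]
    rw [← Finset.add_sum_erase _ _ (Finset.mem_univ i0), hw2] at hsum
    have hcard : ∑ j ∈ Finset.univ.erase i0, ((∫ u, u j ^ 2 * Real.cos (t * u i0) ∂σ) * t)
        = ((n : ℝ) - 1) * (- w1 t) := by
      rw [Finset.sum_congr rfl fun j hj => hrot t ht j (Finset.ne_of_mem_erase hj)]
      rw [Finset.sum_const, Finset.card_erase_of_mem (Finset.mem_univ _), Finset.card_univ,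
        Fintype.card_fin, nsmul_eq_mul, Nat.cast_sub (by omega), Nat.cast_one]
    rw [← Finset.sum_mul] at hcard
    linear_combination (-t) * hsum + hcard
  refine ⟨fun t ht => ⟨by rw [hΩw t ht, Complex.conj_ofReal], ?_⟩, ?_⟩
  · rw [hΩw t ht, Complex.norm_real]
    exact hwle t
  obtain ⟨C, hC⟩ := ode_decay _ w w1 w2 hd1 hd2 hode
  refine ⟨max C 1, by positivity, fun t ht => ?_⟩
  rw [hΩw t ht.le, Complex.norm_real, Real.norm_eq_abs]
  have hpos : 0 < t ^ (-(((n : ℝ) - 1) / 2)) := Real.rpow_pos_of_pos ht _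
  rcases le_total 1 t with h1 | h1
  · exact (hC t h1).trans (mul_le_mul_of_nonneg_right (le_max_left _ _) hpos.le)
  · refine (hwle t).trans ?_
    have hn' : (2 : ℝ) ≤ n := by exact_mod_cast hn
    have : 1 ≤ t ^ (-(((n : ℝ) - 1) / 2)) :=
      Real.one_le_rpow_of_pos_of_le_one_of_nonpos ht h1 (by linarith)
    nlinarith [le_max_right C 1]

/-- Let `n ≥ 2`, `ν` a finite positive Borel measure on `[0,∞)`, and
`f(t) = ∫ Ωₙ(rt) dν(r)`, where `Ωₙ(|x|) = ∫_S e^{i⟨u,x⟩} dσ(u)` with `σ` the normalized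
surface measure of the unit sphere `S` of `ℝⁿ` (characterized as the unique
rotation-invariant probability measure carried by `S`). Let `X` be a sequence of pairwise
distinct points of `ℝⁿ`, and suppose that for `j ≠ k` there are `α_{kj} > 0` with
`sup_j ∑_{k≠j} (α_{kj}|x_k−x_j|)^{−(n−1)/2} < ∞` and `sup_j ∑_{k≠j} ν([0,α_{kj}]) < ∞`.
Then the Gram matrix `(f(|x_k − x_j|))_{k,j}` defines a bounded self-adjoint operator on
`ℓ²(ℕ)`. -/
theorem statement_13 (n : ℕ) (hn : 2 ≤ n)
    (ν : Measure ℝ) [IsFiniteMeasure ν] (hνneg : ν (Set.Iio 0) = 0)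
    (σ : Measure (EuclideanSpace ℝ (Fin n)))
    (hσprob : IsProbabilityMeasure σ)
    (hσsupp : σ (Metric.sphere (0 : EuclideanSpace ℝ (Fin n)) 1)ᶜ = 0)
    (hσinv : ∀ R : EuclideanSpace ℝ (Fin n) ≃ₗᵢ[ℝ] EuclideanSpace ℝ (Fin n),
      Measure.map R σ = σ)
    (Ω : ℝ → ℂ)
    (hΩ : ∀ x : EuclideanSpace ℝ (Fin n),
      Ω ‖x‖ = ∫ u, Complex.exp (Complex.I * (⟪u, x⟫ : ℝ)) ∂σ)
    (f : ℝ → ℂ) (hf : ∀ t, f t = ∫ r, Ω (r * t) ∂ν)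
    (X : ℕ → EuclideanSpace ℝ (Fin n)) (hX : Function.Injective X)
    (α : ℕ → ℕ → ℝ) (hα : ∀ k j, k ≠ j → 0 < α k j)
    (hsum1 : ∀ j, Summable fun k =>
      if k = j then (0 : ℝ) else (α k j * dist (X k) (X j)) ^ (-(((n : ℝ) - 1) / 2)))
    (hK : ∃ K : ℝ, ∀ j, (∑' k,
      if k = j then (0 : ℝ) else (α k j * dist (X k) (X j)) ^ (-(((n : ℝ) - 1) / 2))) ≤ K)
    (hsum2 : ∀ j, Summable fun k =>
      if k = j then (0 : ℝ) else (ν (Set.Icc 0 (α k j))).toReal)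
    (hL : ∃ L : ℝ, ∀ j, (∑' k,
      if k = j then (0 : ℝ) else (ν (Set.Icc 0 (α k j))).toReal) ≤ L) :
    ∃ A : ell2 →L[ℂ] ell2, IsSelfAdjoint A ∧
      ∀ k j : ℕ, A (stdBasis k) j = f (dist (X k) (X j)) := by
  obtain ⟨hre, C, hC0, hC⟩ := sphere_decay n hn σ hσsupp Ω hΩ
  obtain ⟨K, hK⟩ := hK
  obtain ⟨L, hL⟩ := hL
  have hνnn : ∀ᵐ r ∂ν, 0 ≤ r := by
    have : ∀ᵐ r ∂ν, r ∉ Set.Iio (0 : ℝ) := measure_eq_zero_iff_ae_notMem.1 hνneg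
    filter_upwards [this] with r hr
    simpa using hr
  have hbase : ∀ t, 0 ≤ t → ‖f t‖ ≤ ν.real Set.univ := fun t ht => by
    rw [hf]
    have := norm_integral_le_of_norm_le_const (μ := ν) (C := 1) (f := fun r => Ω (r * t))
      (hνnn.mono fun r hr => (hre _ (mul_nonneg hr ht)).2)
    simpa using this
  have hkey : ∀ k j, k ≠ j → ‖f (dist (X k) (X j))‖ ≤ (ν (Set.Icc 0 (α k j))).toReal
      + C * ν.real Set.univ * (α k j * dist (X k) (X j)) ^ (-(((n : ℝ) - 1) / 2)) := by
    intro k j hkj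
    have hd : 0 < dist (X k) (X j) := dist_pos.2 fun h => hkj (hX h)
    have ha := hα k j hkj
    set t := dist (X k) (X j) with ht
    set b := (α k j * t) ^ (-(((n : ℝ) - 1) / 2)) with hb
    have hb0 : 0 ≤ b := by positivity
    rw [hf]
    have hInt : Integrable ((Set.Icc 0 (α k j)).indicator (fun _ : ℝ => (1 : ℝ))) ν :=
      (integrable_const 1).indicator measurableSet_Icc
    have h := norm_integral_le_of_norm_le (μ := ν) (f := fun r => Ω (r * t))
      (hInt.add (integrable_const (C * b))) (by
        filter_upwards [hνnn] with r hr
        simp only [Pi.add_apply]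
        by_cases hr' : r ≤ α k j
        · rw [Set.indicator_of_mem (show r ∈ Set.Icc 0 (α k j) from ⟨hr, hr'⟩)]
          have := (hre _ (mul_nonneg hr hd.le)).2
          have : 0 ≤ C * b := by positivity
          linarith
        · rw [Set.indicator_of_notMem (fun h => hr' h.2), zero_add]
          have hlt : α k j < r := not_le.1 hr'
          refine (hC _ (mul_pos (ha.trans hlt) hd)).trans ?_
          refine mul_le_mul_of_nonneg_left ?_ hC0
          have hn' : (2 : ℝ) ≤ n := by exact_mod_cast hn
          exact Real.rpow_le_rpow_of_nonpos (by positivity) (by gcongr) (by linarith))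
    refine h.trans (le_of_eq ?_)
    rw [integral_add' hInt (integrable_const _), integral_indicator measurableSet_Icc]
    simp [Measure.real]
    ring
  set V := ν.real Set.univ with hV
  have hV0 : 0 ≤ V := measureReal_nonneg
  let g : ℕ → ℕ → ℝ := fun j k =>
    (if k = j then V else 0) +
    ((if k = j then (0 : ℝ) else (ν (Set.Icc 0 (α k j))).toReal) + C * V *
      (if k = j then (0 : ℝ) else (α k j * dist (X k) (X j)) ^ (-(((n : ℝ) - 1) / 2))))
  have hgle : ∀ j k, ‖f (dist (X k) (X j))‖ ≤ g j k := fun j k => by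
    simp only [g]
    split_ifs with h
    · simpa using hbase _ dist_nonneg
    · simpa using hkey k j h
  have hg1 : ∀ j, HasSum (fun k : ℕ => if k = j then V else 0) V := fun j => hasSum_ite_eq j V
  have hg : ∀ j, HasSum (g j) (V + ((∑' k,
      if k = j then (0 : ℝ) else (ν (Set.Icc 0 (α k j))).toReal) + C * V * (∑' k,
      if k = j then (0 : ℝ) else (α k j * dist (X k) (X j)) ^ (-(((n : ℝ) - 1) / 2))))) :=
    fun j => (hg1 j).add ((hsum2 j).hasSum.add ((hsum1 j).hasSum.mul_left (C * V)))
  have hsf : ∀ j, Summable fun k => ‖f (dist (X k) (X j))‖ := fun j =>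
    Summable.of_nonneg_of_le (fun k => norm_nonneg _) (hgle j) (hg j).summable
  refine schur_test (fun k j => f (dist (X k) (X j))) (fun k j => by rw [dist_comm])
    (fun k j => ?_) hsf (V + (L + C * V * K)) (fun j => ?_)
  · rw [hf, ← integral_conj]
    refine integral_congr_ae (hνnn.mono fun r hr => ?_)
    exact (hre _ (mul_nonneg hr dist_nonneg)).1
  · refine ((hsf j).tsum_le_tsum (hgle j) (hg j).summable).trans ?_
    rw [(hg j).tsum_eq]
    have := mul_le_mul_of_nonneg_left (hK j) (mul_nonneg hC0 hV0)
    linarith [hL j]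
end
end

section
/- Let X = {x_j}_{j≥1} be a sequence of pairwise distinct points of ℝ³ which has no finite accumulation point, and let φ_j ∈ L²(ℝ³) be given by φ_j(x) = e^{−|x−x_j|}/|x−x_j|. Then the sequence {φ_j}_{j≥1} is ω-linearly independent: if {c_j}_{j≥1} is a complex sequence with Σ_j |c_j|² < ∞ and the series Σ_{j=1}^∞ c_j φ_j converges to 0 in L²(ℝ³), then c_j = 0 for all j. -/
open MeasureTheory Filter
open scoped ComplexOrder ENNReal RealInnerProductSpace

noncomputable section

lemma yk_coords (F : ℝ → ℝ → ℝ≥0∞) (hF : Measurable (Function.uncurry F)) :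
    ∫⁻ x : EuclideanSpace ℝ (Fin 3), F (x 0) (x 1 ^ 2 + x 2 ^ 2) =
      ∫⁻ t : ℝ, ENNReal.ofReal (2 * Real.pi) *
        ∫⁻ r in Set.Ioi (0 : ℝ), ENNReal.ofReal r * F t (r ^ 2) := by
  have h1 := (EuclideanSpace.volume_preserving_symm_measurableEquiv_toLp (Fin 3)).lintegral_comp_emb
    (MeasurableEquiv.measurableEmbedding _) (fun y : Fin 3 → ℝ => F (y 0) (y 1 ^ 2 + y 2 ^ 2))
  have h2 := (volume_preserving_piFinSuccAbove (fun _ : Fin 3 => ℝ) 0).lintegral_comp_emb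
    (MeasurableEquiv.measurableEmbedding _)
    (fun p : ℝ × (Fin 2 → ℝ) => F p.1 (p.2 0 ^ 2 + p.2 1 ^ 2))
  have e1 : ∫⁻ x : EuclideanSpace ℝ (Fin 3), F (x 0) (x 1 ^ 2 + x 2 ^ 2) =
      ∫⁻ p : ℝ × (Fin 2 → ℝ), F p.1 (p.2 0 ^ 2 + p.2 1 ^ 2) := by
    rw [← h2]
    exact h1
  have hm : Measurable (fun p : ℝ × (Fin 2 → ℝ) => F p.1 (p.2 0 ^ 2 + p.2 1 ^ 2)) := by
    have : Measurable (fun p : ℝ × (Fin 2 → ℝ) => (p.1, p.2 0 ^ 2 + p.2 1 ^ 2)) := by fun_prop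
    exact hF.comp this
  rw [e1, Measure.volume_eq_prod, lintegral_prod _ hm.aemeasurable]
  refine lintegral_congr fun t => ?_
  have h3 := (volume_preserving_finTwoArrow ℝ).lintegral_comp_emb
    (MeasurableEquiv.measurableEmbedding _) (fun p : ℝ × ℝ => F t (p.1 ^ 2 + p.2 ^ 2))
  have e3 : ∫⁻ y : Fin 2 → ℝ, F t (y 0 ^ 2 + y 1 ^ 2) = ∫⁻ p : ℝ × ℝ, F t (p.1 ^ 2 + p.2 ^ 2) := by
    rw [← h3]
    rfl
  change ∫⁻ y : Fin 2 → ℝ, F t (y 0 ^ 2 + y 1 ^ 2) = _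
  rw [e3, ← lintegral_comp_polarCoord_symm]
  have e4 : ∀ p : ℝ × ℝ, (polarCoord.symm p).1 ^ 2 + (polarCoord.symm p).2 ^ 2 = p.1 ^ 2 := by
    intro p
    simp only [polarCoord_symm_apply]
    have := Real.sin_sq_add_cos_sq p.2
    linear_combination p.1 ^ 2 * this
  simp_rw [e4, smul_eq_mul]
  have hm2 : Measurable fun r : ℝ => ENNReal.ofReal r * F t (r ^ 2) := by
    have : Measurable (fun r : ℝ => (t, r ^ 2)) := by fun_prop
    exact (ENNReal.measurable_ofReal).mul (hF.comp this)
  rw [polarCoord_target, Measure.volume_eq_prod, ← Measure.prod_restrict,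
    lintegral_prod _ (by exact (hm2.comp measurable_fst).aemeasurable)]
  simp only [lintegral_const, Measure.restrict_apply MeasurableSet.univ, Set.univ_inter,
    Real.volume_Ioo]
  rw [lintegral_mul_const _ hm2, mul_comm]
  congr 2
  ring

lemma yk_ftc (G g : ℝ → ℝ) (a b : ℝ) (hab : a ≤ b)
    (hd : ∀ x ∈ Set.Icc a b, HasDerivAt G (g x) x) (hc : ContinuousOn g (Set.Icc a b))
    (hn : ∀ x ∈ Set.Ioo a b, 0 ≤ g x) :
    ∫⁻ x in Set.Ioo a b, ENNReal.ofReal (g x) = ENNReal.ofReal (G b - G a) := by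
  have hi : IntervalIntegrable g volume a b := by
    apply ContinuousOn.intervalIntegrable
    rwa [Set.uIcc_of_le hab]
  rw [← intervalIntegral.integral_eq_sub_of_hasDerivAt (f := G) (f' := g)
    (by rwa [Set.uIcc_of_le hab]) hi, intervalIntegral.integral_of_le hab,
    integral_Ioc_eq_integral_Ioo, ofReal_integral_eq_lintegral_ofReal]
  · exact ((intervalIntegrable_iff_integrableOn_Ioo_of_le hab).1 hi)
  · exact (ae_restrict_iff' measurableSet_Ioo).2 (Eventually.of_forall hn)

lemma yk_inner (a b : ℝ) (ha : a ≠ 0) (hb : 0 ≤ b) :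
    ∫⁻ r in Set.Ioo 0 b, ENNReal.ofReal (r * (Real.exp (-√(a ^ 2 + r ^ 2)) / √(a ^ 2 + r ^ 2))) =
      ENNReal.ofReal (Real.exp (-|a|) - Real.exp (-√(a ^ 2 + b ^ 2))) := by
  have hpos : ∀ r : ℝ, 0 < a ^ 2 + r ^ 2 := fun r => by positivity
  rw [yk_ftc (fun r => - Real.exp (-√(a ^ 2 + r ^ 2)))
    (fun r => r * (Real.exp (-√(a ^ 2 + r ^ 2)) / √(a ^ 2 + r ^ 2))) 0 b hb]
  · congr 1
    simp [Real.sqrt_sq_eq_abs]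
    ring
  · intro r _
    have h1 : HasDerivAt (fun r : ℝ => a ^ 2 + r ^ 2) (2 * r) r := by
      simpa using (hasDerivAt_pow 2 r).const_add (a ^ 2)
    have h2 := ((h1.sqrt (hpos r).ne').neg.exp).neg
    refine HasDerivAt.congr_deriv h2 ?_
    have : √(a ^ 2 + r ^ 2) ≠ 0 := (Real.sqrt_pos.2 (hpos r)).ne'
    simp only [Pi.neg_apply]
    field_simp
  · have : ∀ r : ℝ, √(a ^ 2 + r ^ 2) ≠ 0 := fun r => (Real.sqrt_pos.2 (hpos r)).ne'
    fun_prop (disch := simp [this])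
  · intro r hr
    have := hr.1
    positivity

/-- normalised ball integrals -/
def ykC (R : ℝ) : ℝ := R * Real.cosh R - Real.sinh R
def ykD (R : ℝ) : ℝ := 1 - (1 + R) * Real.exp (-R)

lemma ykC_deriv (r : ℝ) : HasDerivAt ykC (r * Real.sinh r) r := by
  have := ((hasDerivAt_id r).mul (Real.hasDerivAt_cosh r)).sub (Real.hasDerivAt_sinh r)
  refine HasDerivAt.congr_deriv this ?_
  simp

lemma ykD_deriv (r : ℝ) : HasDerivAt ykD (r * Real.exp (-r)) r := by
  have h := (((hasDerivAt_id r).const_add 1).mul (hasDerivAt_id r).neg.exp).const_sub 1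
  refine HasDerivAt.congr_deriv h ?_
  simp
  ring

lemma yk_strict (r : ℝ) (hr : 0 < r) : ykC r * ykD (2 * r) - ykC (2 * r) * ykD r ≠ 0 := by
  have hcC : Continuous ykC := continuous_iff_continuousAt.2 fun x => (ykC_deriv x).continuousAt
  have hcD : Continuous ykD := continuous_iff_continuousAt.2 fun x => (ykD_deriv x).continuousAt
  obtain ⟨a, ha, h1⟩ := exists_ratio_hasDerivAt_eq_ratio_slope ykC (fun r => r * Real.sinh r)
    hr hcC.continuousOn (fun x _ => ykC_deriv x) ykD (fun r => r * Real.exp (-r))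
    hcD.continuousOn (fun x _ => ykD_deriv x)
  obtain ⟨b, hb, h2⟩ := exists_ratio_hasDerivAt_eq_ratio_slope ykC (fun r => r * Real.sinh r)
    (show r < 2 * r by linarith) hcC.continuousOn (fun x _ => ykC_deriv x) ykD
    (fun r => r * Real.exp (-r)) hcD.continuousOn (fun x _ => ykD_deriv x)
  have hC : StrictMonoOn ykC (Set.Ici 0) := by
    apply strictMonoOn_of_deriv_pos (convex_Ici 0) hcC.continuousOn
    intro x hx
    rw [interior_Ici] at hx
    rw [(ykC_deriv x).deriv]
    exact mul_pos hx (Real.sinh_pos_iff.2 hx)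
  have c0 : ykC 0 = 0 := by simp [ykC]
  have d0 : ykD 0 = 0 := by simp [ykD]
  have p1 : 0 < ykC r := by
    have := hC (Set.mem_Ici.2 le_rfl) (Set.mem_Ici.2 hr.le) hr
    rwa [c0] at this
  have p2 : ykC r < ykC (2 * r) :=
    hC (Set.mem_Ici.2 hr.le) (Set.mem_Ici.2 (by linarith)) (by linarith)
  rw [c0, d0] at h1
  intro h
  have ha0 := ha.1
  have hab : a < b := ha.2.trans hb.1
  have hb0 : 0 < b := ha0.trans hab
  have h1' : ykD r * Real.sinh a = ykC r * Real.exp (-a) := by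
    apply mul_left_cancel₀ ha0.ne'
    linear_combination h1
  have h2' : (ykD (2 * r) - ykD r) * Real.sinh b = (ykC (2 * r) - ykC r) * Real.exp (-b) := by
    apply mul_left_cancel₀ hb0.ne'
    linear_combination h2
  have h3 : ykD r * Real.sinh b = ykC r * Real.exp (-b) := by
    apply mul_left_cancel₀ (sub_pos.2 p2).ne'
    linear_combination ykC r * h2' - Real.sinh b * h
  have s1 : Real.sinh a < Real.sinh b := Real.sinh_lt_sinh.2 hab
  have s2 : Real.exp (-b) < Real.exp (-a) := Real.exp_lt_exp.2 (by linarith)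
  have s0 : 0 < Real.sinh a := Real.sinh_pos_iff.2 ha0
  have hDp : 0 < ykD r := by
    have : 0 < ykD r * Real.sinh a := h1' ▸ mul_pos p1 (Real.exp_pos _)
    exact (pos_iff_pos_of_mul_pos this).2 s0
  nlinarith [mul_lt_mul_of_pos_left s1 hDp, mul_lt_mul_of_pos_left s2 p1]

/-- the fibre integral -/
lemma yk_fibre (s R : ℝ) (hR : 0 < R) :
    ∫⁻ x in Metric.ball (0 : EuclideanSpace ℝ (Fin 3)) R,
      ENNReal.ofReal (Real.exp (-dist x (EuclideanSpace.single 0 s)) /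
        dist x (EuclideanSpace.single 0 s)) =
    ENNReal.ofReal (2 * Real.pi) * ∫⁻ t in Set.Ioo (-R) R,
      ENNReal.ofReal (Real.exp (-|t - s|) - Real.exp (-√(s ^ 2 + R ^ 2 - 2 * s * t))) := by
  let F : ℝ → ℝ → ℝ≥0∞ := fun t q => Set.indicator {p : ℝ × ℝ | p.1 ^ 2 + p.2 < R ^ 2}
    (fun p => ENNReal.ofReal (Real.exp (-√((p.1 - s) ^ 2 + p.2)) / √((p.1 - s) ^ 2 + p.2))) (t, q)
  have hF : Measurable (Function.uncurry F) := by
    apply Measurable.indicator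
    · fun_prop
    · exact measurableSet_lt (by fun_prop) (by fun_prop)
  rw [← lintegral_indicator measurableSet_ball]
  have e : ∀ x : EuclideanSpace ℝ (Fin 3), Set.indicator (Metric.ball 0 R) (fun x =>
      ENNReal.ofReal (Real.exp (-dist x (EuclideanSpace.single 0 s)) /
        dist x (EuclideanSpace.single 0 s))) x = F (x 0) (x 1 ^ 2 + x 2 ^ 2) := by
    intro x
    have h1 : x ∈ Metric.ball (0 : EuclideanSpace ℝ (Fin 3)) R ↔
        x 0 ^ 2 + (x 1 ^ 2 + x 2 ^ 2) < R ^ 2 := by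
      rw [mem_ball_zero_iff, ← sq_lt_sq₀ (norm_nonneg _) hR.le, EuclideanSpace.real_norm_sq_eq,
        Fin.sum_univ_three, add_assoc]
    have h2 : dist x (EuclideanSpace.single 0 s) = √((x 0 - s) ^ 2 + (x 1 ^ 2 + x 2 ^ 2)) := by
      rw [EuclideanSpace.dist_eq, Fin.sum_univ_three, add_assoc]
      simp [Real.dist_eq]
    by_cases hx : x ∈ Metric.ball (0 : EuclideanSpace ℝ (Fin 3)) R
    · have hx' : (x 0, x 1 ^ 2 + x 2 ^ 2) ∈ {p : ℝ × ℝ | p.1 ^ 2 + p.2 < R ^ 2} := h1.1 hx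
      simp only [F]
      rw [Set.indicator_of_mem hx, Set.indicator_of_mem hx', h2]
    · have hx' : (x 0, x 1 ^ 2 + x 2 ^ 2) ∉ {p : ℝ × ℝ | p.1 ^ 2 + p.2 < R ^ 2} := mt h1.2 hx
      simp only [F]
      rw [Set.indicator_of_notMem hx, Set.indicator_of_notMem hx']
  simp_rw [e]
  rw [yk_coords F hF, lintegral_const_mul' _ _ ENNReal.ofReal_ne_top,
    ← lintegral_indicator measurableSet_Ioo]
  congr 1
  have hs : ∀ᵐ t : ℝ, t ≠ s := by simp [ae_iff]
  refine lintegral_congr_ae ?_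
  filter_upwards [hs] with t ht
  by_cases htR : t ∈ Set.Ioo (-R) R
  · rw [Set.indicator_of_mem htR]
    have hq : 0 < R ^ 2 - t ^ 2 := by nlinarith [htR.1, htR.2]
    have := yk_inner (t - s) (√(R ^ 2 - t ^ 2)) (sub_ne_zero.2 ht) (Real.sqrt_nonneg _)
    rw [Real.sq_sqrt hq.le, show (t - s) ^ 2 + (R ^ 2 - t ^ 2) = s ^ 2 + R ^ 2 - 2 * s * t by ring]
      at this
    rw [← this, ← lintegral_indicator measurableSet_Ioo, ← lintegral_indicator measurableSet_Ioi]
    refine lintegral_congr fun r => ?_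
    by_cases hr : 0 < r
    · have : t ^ 2 + r ^ 2 < R ^ 2 ↔ r < √(R ^ 2 - t ^ 2) := by
        rw [Real.lt_sqrt hr.le]
        constructor <;> intro h <;> linarith
      simp only [F, Set.indicator_apply, Set.mem_Ioi, hr, Set.mem_Ioo, Set.mem_ofPred_eq, this,
        true_and, if_true]
      split_ifs
      · rw [ENNReal.ofReal_mul hr.le]
      · simp
    · simp [hr]
  · rw [Set.indicator_of_notMem htR]
    have : ∀ r : ℝ, F t (r ^ 2) = 0 := by
      intro r
      apply Set.indicator_of_notMem
      simp only [Set.mem_ofPred_eq, not_lt]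
      have : R ^ 2 ≤ t ^ 2 := by
        by_contra! h
        exact htR (abs_lt.1 (abs_lt_of_sq_lt_sq h hR.le))
      nlinarith [sq_nonneg r]
    simp [this]

lemma yk_far (s R : ℝ) (hR : 0 < R) (hs : R < s) :
    ∫⁻ t in Set.Ioo (-R) R,
      ENNReal.ofReal (Real.exp (-|t - s|) - Real.exp (-√(s ^ 2 + R ^ 2 - 2 * s * t))) =
    ENNReal.ofReal (2 * ykC R * (Real.exp (-s) / s)) := by
  have hs0 : 0 < s := hR.trans hs
  have hpos : ∀ t ∈ Set.Icc (-R) R, 0 < s ^ 2 + R ^ 2 - 2 * s * t := by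
    intro t ht
    nlinarith [ht.2, mul_le_mul_of_nonneg_left ht.2 hs0.le]
  have hcong : ∫⁻ t in Set.Ioo (-R) R,
      ENNReal.ofReal (Real.exp (-|t - s|) - Real.exp (-√(s ^ 2 + R ^ 2 - 2 * s * t))) =
      ∫⁻ t in Set.Ioo (-R) R,
      ENNReal.ofReal (Real.exp (t - s) - Real.exp (-√(s ^ 2 + R ^ 2 - 2 * s * t))) := by
    refine setLIntegral_congr_fun measurableSet_Ioo fun t ht => ?_
    rw [abs_of_neg (by linarith [ht.2]), neg_neg]
  rw [hcong, yk_ftc (fun t => Real.exp (t - s) - (1 + √(s ^ 2 + R ^ 2 - 2 * s * t)) *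
    Real.exp (-√(s ^ 2 + R ^ 2 - 2 * s * t)) / s) _ (-R) R (by linarith)]
  · congr 1
    have h1 : √(s ^ 2 + R ^ 2 - 2 * s * R) = s - R := by
      rw [show s ^ 2 + R ^ 2 - 2 * s * R = (s - R) ^ 2 by ring, Real.sqrt_sq (by linarith)]
    have h2 : √(s ^ 2 + R ^ 2 - 2 * s * -R) = s + R := by
      rw [show s ^ 2 + R ^ 2 - 2 * s * -R = (s + R) ^ 2 by ring, Real.sqrt_sq (by linarith)]
    simp only [h1, h2, ykC, Real.cosh_eq, Real.sinh_eq]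
    rw [show R - s = R + -s by ring, show -R - s = -R + -s by ring,
      show -(s - R) = R + -s by ring, show -(s + R) = -R + -s by ring]
    simp only [Real.exp_add]
    field_simp
    ring
  · intro t ht
    have hp := hpos t ht
    have hq : √(s ^ 2 + R ^ 2 - 2 * s * t) ≠ 0 := (Real.sqrt_pos.2 hp).ne'
    have h1 : HasDerivAt (fun t : ℝ => s ^ 2 + R ^ 2 - 2 * s * t) (-(2 * s)) t := by
      simpa using ((hasDerivAt_id t).const_mul (2 * s)).const_sub (s ^ 2 + R ^ 2)
    have h2 := h1.sqrt hp.ne'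
    have h3 := (((hasDerivAt_id t).sub_const s).exp).sub
      (((h2.const_add 1).mul h2.neg.exp).div_const s)
    refine HasDerivAt.congr_deriv h3 ?_
    simp only [id, Pi.neg_apply]
    generalize √(s ^ 2 + R ^ 2 - 2 * s * t) = u at hq
    field_simp
    ring
  · fun_prop
  · intro t ht
    have : s - t ≤ √(s ^ 2 + R ^ 2 - 2 * s * t) := by
      apply Real.le_sqrt_of_sq_le
      nlinarith [ht.1, ht.2]
    rw [sub_nonneg]
    exact Real.exp_le_exp.2 (by linarith)

lemma yk_near (R : ℝ) (hR : 0 < R) :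
    ∫⁻ t in Set.Ioo (-R) R,
      ENNReal.ofReal (Real.exp (-|t - 0|) - Real.exp (-√((0:ℝ) ^ 2 + R ^ 2 - 2 * 0 * t))) =
    ENNReal.ofReal (2 * ykD R) := by
  have hq : √R ^ 2 = R := Real.sq_sqrt hR.le
  have e : ∀ t, ENNReal.ofReal (Real.exp (-|t - 0|) - Real.exp (-√((0:ℝ) ^ 2 + R ^ 2 - 2 * 0 * t)))
      = ENNReal.ofReal (Real.exp (-|t|) - Real.exp (-R)) := by
    intro t
    simp [Real.sqrt_sq hR.le]
  simp_rw [e]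
  have hc : Continuous fun t : ℝ => Real.exp (-|t|) - Real.exp (-R) := by fun_prop
  have hi : ∀ a b, IntervalIntegrable (fun t : ℝ => Real.exp (-|t|) - Real.exp (-R)) volume a b :=
    fun a b => hc.intervalIntegrable a b
  rw [← ofReal_integral_eq_lintegral_ofReal]
  · congr 1
    rw [← integral_Ioc_eq_integral_Ioo, ← intervalIntegral.integral_of_le (by linarith),
      ← intervalIntegral.integral_add_adjacent_intervals (hi (-R) 0) (hi 0 R)]
    have i1 : ∫ t in (-R)..0, (Real.exp (-|t|) - Real.exp (-R)) =
        ∫ t in (-R)..0, (Real.exp t - Real.exp (-R)) := by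
      refine intervalIntegral.integral_congr fun t ht => ?_
      rw [Set.uIcc_of_le (by linarith)] at ht
      simp only [abs_of_nonpos ht.2, neg_neg]
    have i2 : ∫ t in (0:ℝ)..R, (Real.exp (-|t|) - Real.exp (-R)) =
        ∫ t in (0:ℝ)..R, (Real.exp (-t) - Real.exp (-R)) := by
      refine intervalIntegral.integral_congr fun t ht => ?_
      rw [Set.uIcc_of_le hR.le] at ht
      simp only [abs_of_nonneg ht.1]
    rw [i1, i2, intervalIntegral.integral_eq_sub_of_hasDerivAt
      (f := fun t => Real.exp t - t * Real.exp (-R)),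
      intervalIntegral.integral_eq_sub_of_hasDerivAt
      (f := fun t => - Real.exp (-t) - t * Real.exp (-R))]
    · simp [ykD]
      ring
    · intro t _
      have := ((hasDerivAt_id t).neg.exp.neg).sub ((hasDerivAt_id t).mul_const (Real.exp (-R)))
      refine HasDerivAt.congr_deriv this ?_
      simp
    · exact Continuous.intervalIntegrable (by fun_prop) _ _
    · intro t _
      have := (Real.hasDerivAt_exp t).sub ((hasDerivAt_id t).mul_const (Real.exp (-R)))
      refine HasDerivAt.congr_deriv this ?_
      simp
    · exact Continuous.intervalIntegrable (by fun_prop) _ _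
  · exact (intervalIntegrable_iff_integrableOn_Ioo_of_le (by linarith)).1 (hi (-R) R)
  · refine (ae_restrict_iff' measurableSet_Ioo).2 (Eventually.of_forall fun t ht => ?_)
    have := abs_lt.2 ht
    simp only [Pi.zero_apply, sub_nonneg]
    exact Real.exp_le_exp.2 (by linarith)

lemma yk_rot (p y : EuclideanSpace ℝ (Fin 3)) (R : ℝ) :
    ∫⁻ x in Metric.ball y R, ENNReal.ofReal (Real.exp (-dist x p) / dist x p) =
    ∫⁻ x in Metric.ball (0 : EuclideanSpace ℝ (Fin 3)) R,
      ENNReal.ofReal (Real.exp (-dist x (EuclideanSpace.single 0 (dist p y))) /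
        dist x (EuclideanSpace.single 0 (dist p y))) := by
  have hn : ‖p - y‖ = ‖(EuclideanSpace.single 0 (dist p y) : EuclideanSpace ℝ (Fin 3))‖ := by
    simp [dist_eq_norm]
  set q : EuclideanSpace ℝ (Fin 3) := EuclideanSpace.single 0 (dist p y)
  let T := (ℝ ∙ ((p - y) - q))ᗮ.reflection
  have hT : T (p - y) = q := Submodule.reflection_sub hn
  have hd : ∀ x, dist (T (x - y)) q = dist x p := by
    intro x
    rw [← hT, T.dist_map, dist_sub_right]
  have hmp : MeasurePreserving (fun x => T (x - y)) volume volume :=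
    T.measurePreserving.comp (measurePreserving_sub_right volume y)
  have hme : MeasurableEmbedding (fun x => T (x - y)) :=
    T.toHomeomorph.measurableEmbedding.comp (Homeomorph.subRight y).measurableEmbedding
  have := hmp.setLIntegral_comp_preimage_emb hme
    (fun x => ENNReal.ofReal (Real.exp (-dist x q) / dist x q)) (Metric.ball 0 R)
  rw [← this]
  simp only [hd]
  congr 2
  ext x
  rw [Set.mem_preimage, mem_ball_zero_iff, T.norm_map, mem_ball_iff_norm]

lemma yk_int (p y : EuclideanSpace ℝ (Fin 3)) (R : ℝ) (V : ℝ) (hV : 0 ≤ V)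
    (h : ∫⁻ x in Metric.ball y R, ENNReal.ofReal (Real.exp (-dist x p) / dist x p) =
      ENNReal.ofReal V) :
    ∫ x in Metric.ball y R, ((Real.exp (-dist x p) / dist x p : ℝ) : ℂ) = (V : ℂ) := by
  rw [integral_complex_ofReal, integral_eq_lintegral_of_nonneg_ae, h, ENNReal.toReal_ofReal hV]
  · exact Eventually.of_forall fun x => by positivity
  · exact Measurable.aestronglyMeasurable (by fun_prop)

theorem statement_15 (X : ℕ → EuclideanSpace ℝ (Fin 3)) (hX : Function.Injective X)
    (hacc : ∀ y : EuclideanSpace ℝ (Fin 3), ¬ AccPt y (Filter.principal (Set.range X)))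
    (φ : ℕ → Lp ℂ 2 (volume : Measure (EuclideanSpace ℝ (Fin 3))))
    (hφ : ∀ j, (φ j : EuclideanSpace ℝ (Fin 3) → ℂ) =ᵐ[volume] fun x =>
      ((Real.exp (-dist x (X j)) / dist x (X j) : ℝ) : ℂ))
    (c : ℕ → ℂ) (hc : Summable fun j => ‖c j‖ ^ 2)
    (hconv : Tendsto (fun N => ∑ j ∈ Finset.range N, c j • φ j) atTop (nhds 0)) :
    ∀ j, c j = 0 := by
  intro k
  obtain ⟨δ, hδ, hsep⟩ : ∃ δ > 0, ∀ j, j ≠ k → δ ≤ dist (X j) (X k) := by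
    have h := hacc (X k)
    rw [accPt_iff_frequently, not_frequently, Metric.eventually_nhds_iff] at h
    obtain ⟨δ, hδ, h⟩ := h
    refine ⟨δ, hδ, fun j hj => ?_⟩
    by_contra! hlt
    exact h hlt ⟨hX.ne hj, Set.mem_range_self j⟩
  have hCpos : ∀ R, 0 < R → 0 ≤ ykC R := by
    intro R hR
    have hm : MonotoneOn ykC (Set.Ici 0) := by
      apply monotoneOn_of_deriv_nonneg (convex_Ici 0)
        (fun x _ => (ykC_deriv x).continuousAt.continuousWithinAt)
        (fun x _ => (ykC_deriv x).differentiableAt.differentiableWithinAt)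
      intro x hx
      rw [interior_Ici] at hx
      rw [(ykC_deriv x).deriv]
      exact mul_nonneg (le_of_lt hx) (Real.sinh_nonneg_iff.2 (le_of_lt hx))
    have := hm (Set.mem_Ici.2 le_rfl) (Set.mem_Ici.2 hR.le) hR.le
    simpa [ykC] using this
  have hDpos : ∀ R, 0 < R → 0 ≤ ykD R := by
    intro R hR
    have h1 := Real.add_one_le_exp R
    have h2 : Real.exp R * Real.exp (-R) = 1 := by rw [← Real.exp_add]; simp
    have h3 := mul_le_mul_of_nonneg_right h1 (Real.exp_pos (-R)).le
    unfold ykD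
    linarith
  -- the functional
  let L : ℝ → Lp ℂ 2 (volume : Measure (EuclideanSpace ℝ (Fin 3))) → ℂ := fun R f =>
    inner ℂ (indicatorConstLp 2 (measurableSet_ball (x := X k) (ε := R))
      measure_ball_lt_top.ne (1 : ℂ)) f
  have hL : ∀ R j, L R (φ j) =
      ∫ x in Metric.ball (X k) R, ((Real.exp (-dist x (X j)) / dist x (X j) : ℝ) : ℂ) := by
    intro R j
    simp only [L]
    rw [L2.inner_indicatorConstLp_one]
    exact integral_congr_ae (ae_restrict_of_ae (hφ j))
  have hLfar : ∀ R, 0 < R → R < δ → ∀ j, j ≠ k → L R (φ j) =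
      ((2 * Real.pi * (2 * ykC R * (Real.exp (-dist (X j) (X k)) / dist (X j) (X k))) : ℝ) : ℂ) := by
    intro R hR hRδ j hj
    have := hCpos R hR
    rw [hL]
    apply yk_int _ _ _ _ (by positivity)
    rw [yk_rot, yk_fibre _ _ hR, yk_far _ _ hR (hRδ.trans_le (hsep j hj)),
      ← ENNReal.ofReal_mul (by positivity)]
  have hLnear : ∀ R, 0 < R → L R (φ k) = ((2 * Real.pi * (2 * ykD R) : ℝ) : ℂ) := by
    intro R hR
    have := hDpos R hR
    rw [hL]
    apply yk_int _ _ _ _ (by positivity)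
    rw [yk_rot, yk_fibre _ _ hR, dist_self, yk_near _ hR,
      ← ENNReal.ofReal_mul (by positivity)]
  have hlim : ∀ R, Tendsto (fun N => ∑ j ∈ Finset.range N, c j * L R (φ j)) atTop (nhds 0) := by
    intro R
    have h : Tendsto (fun N => L R (∑ j ∈ Finset.range N, c j • φ j)) atTop (nhds (L R 0)) :=
      ((continuous_const.inner continuous_id).tendsto _).comp hconv
    simpa [L, inner_sum, inner_smul_right] using h
  set r := δ / 4 with hr
  have hr0 : 0 < r := by positivity
  have hcomb := ((hlim (2 * r)).const_mul (ykC r : ℂ)).sub ((hlim r).const_mul (ykC (2 * r) : ℂ))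
  have hev : (fun N => (ykC r : ℂ) * ∑ j ∈ Finset.range N, c j * L (2 * r) (φ j) -
      (ykC (2 * r) : ℂ) * ∑ j ∈ Finset.range N, c j * L r (φ j)) =ᶠ[atTop]
      fun _ => c k * ((4 * Real.pi * (ykC r * ykD (2 * r) - ykC (2 * r) * ykD r) : ℝ) : ℂ) := by
    filter_upwards [eventually_gt_atTop k] with N hN
    rw [Finset.mul_sum, Finset.mul_sum, ← Finset.sum_sub_distrib,
      Finset.sum_eq_single_of_mem k (Finset.mem_range.2 hN)]
    · rw [hLnear _ hr0, hLnear _ (by positivity)]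
      push_cast
      ring
    · intro j _ hj
      rw [hLfar _ hr0 (by linarith) j hj, hLfar _ (by positivity) (by linarith) j hj]
      push_cast
      ring
  have h0 := tendsto_nhds_unique (tendsto_const_nhds.congr' hev.symm) hcomb
  simp only [mul_zero, sub_zero] at h0
  rcases mul_eq_zero.1 h0 with h | h
  · exact h
  · exfalso
    have h' := Complex.ofReal_eq_zero.1 h
    have := yk_strict r hr0
    have hpi := Real.pi_pos
    exact mul_ne_zero (by positivity) this h'
end
end
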